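/- There exists a universal constant α > 0 with the following property. Let 𝒮 be a finite family of convex bodies in ℝ² forming convex pseudodisks, let P ⊆ ℝ² be a finite set of points with P ⊆ ⋃𝒮, let 𝒪 ⊆ 𝒮 be a cover of P of minimum cardinality, and let 0 < ε < 1. Suppose 𝒬 ⊆ 𝒮 is a cover of P that is b-locally optimal for some integer b ≥ α/ε², and that additionally satisfies the stability condition: there is no Q ∈ 𝒬 and R ∈ 𝒮 \ 𝒬 such that Q \ ⋃_{P' ∈ 𝒬, P' ≠ Q} P' ⊆ R. Then |𝒬| ≤ (1+ε)·|𝒪|. -/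

import Mathlib

open Set

attribute [local instance] Classical.propDecidable

/-- The Euclidean plane. -/
abbrev Plane := EuclideanSpace ℝ (Fin 2)

/-- A convex body: compact, convex, with nonempty interior. -/
def IsConvexBody (S : Set Plane) : Prop :=
  IsCompact S ∧ Convex ℝ S ∧ (interior S).Nonempty

/-- A family forms convex pseudodisks: each member is a convex body and the
boundaries of any two distinct members meet in at most two points. -/
def ConvexPseudodisks (𝒮 : Finset (Set Plane)) : Prop :=
  (∀ S ∈ 𝒮, IsConvexBody S) ∧
    ∀ A ∈ 𝒮, ∀ B ∈ 𝒮, A ≠ B →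
      ∃ p q : Plane, frontier A ∩ frontier B ⊆ {p, q}

/-- `𝒬` covers the point set `P`. -/
def CoversIn (P : Finset Plane) (𝒬 : Finset (Set Plane)) : Prop :=
  ∀ p ∈ P, ∃ Q ∈ 𝒬, p ∈ Q

/-- `𝒬` is a `b`-locally optimal cover of `P` from `𝒮`. -/
def BLocallyOptimalCover (𝒮 𝒬 : Finset (Set Plane)) (P : Finset Plane)
    (b : ℕ) : Prop :=
  ¬ ∃ X : Finset (Set Plane), X ⊆ 𝒬 ∧ X.card ≤ b ∧
      ∃ X' : Finset (Set Plane), X' ⊆ 𝒮 ∧ X'.card < X.card ∧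
        CoversIn P ((𝒬 \ X) ∪ X')

/-- `T` is nonempty and connected for the relation `E`. -/
def ConnSet {V : Type*} (E : V → V → Prop) (T : Set V) : Prop :=
  T.Nonempty ∧ ∀ S ⊆ T, S.Nonempty → (∀ u ∈ S, ∀ v ∈ T, E u v → v ∈ S) → S = T

/-- The relation `E` has no complete minor on five vertices. -/
def NoK5 {V : Type*} (E : V → V → Prop) : Prop :=
  ¬ ∃ C : Fin 5 → Set V, (∀ i, ConnSet E (C i)) ∧ (∀ i j, i ≠ j → Disjoint (C i) (C j)) ∧
    ∀ i j, i ≠ j → ∃ u ∈ C i, ∃ v ∈ C j, E u v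

section Separator

variable {V : Type*} {E : V → V → Prop}

theorem ConnSet.singleton (v : V) : ConnSet E {v} :=
  ⟨singleton_nonempty v, fun _ hS hne _ => (subset_singleton_iff_eq.mp hS).resolve_left hne.ne_empty⟩

theorem ConnSet.union (hE : ∀ u v, E u v → E v u) {S T : Set V} (hS : ConnSet E S)
    (hT : ConnSet E T) {u v : V} (hu : u ∈ S) (hv : v ∈ T) (huv : u = v ∨ E u v) :
    ConnSet E (S ∪ T) := by
  refine ⟨hS.1.mono subset_union_left, fun R hR hne hcl => ?_⟩
  have key : ∀ T', ConnSet E T' → T' ⊆ S ∪ T → (R ∩ T').Nonempty → T' ⊆ R := by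
    intro T' hT' hsub hn
    have := hT'.2 (R ∩ T') inter_subset_right hn
      (fun a ha b hb hab => ⟨hcl a ha.1 b (hsub hb) hab, hb⟩)
    exact inter_eq_right.mp this
  have hS' := key S hS subset_union_left
  have hT' := key T hT subset_union_right
  refine subset_antisymm hR ?_
  obtain ⟨x, hx⟩ := hne
  have hfin : S ⊆ R ∨ T ⊆ R := (hR hx).imp (fun h => hS' ⟨x, hx, h⟩) (fun h => hT' ⟨x, hx, h⟩)
  rcases hfin with h | h
  · refine union_subset h (hT' ⟨v, ?_, hv⟩)
    rcases huv with rfl | e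
    · exact h hu
    · exact hcl u (h hu) v (Or.inr hv) e
  · refine union_subset (hS' ⟨u, ?_, hu⟩) h
    rcases huv with rfl | e
    · exact h hv
    · exact hcl v (h hv) u (Or.inl hu) (hE _ _ e)

theorem exists_small_layer {ι : Type*} [DecidableEq ι] (S : ℕ → Finset ι) (hS : Monotone S) (r N : ℕ)
    (hN : (S r).card ≤ N) (hr : 0 < r) : ∃ t < r, r * (S (t + 1) \ S t).card ≤ N := by
  by_contra! h
  have hsum : ∑ t ∈ Finset.range r, (S (t + 1) \ S t).card ≤ (S r).card := by
    clear h hN hr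
    induction r with
    | zero => simp
    | succ r ih =>
      rw [Finset.sum_range_succ]
      have := Finset.card_sdiff_add_card_eq_card (hS (Nat.le_succ r))
      simp only [Nat.succ_eq_add_one] at this
      omega
  have h2 : r * N < ∑ t ∈ Finset.range r, r * (S (t + 1) \ S t).card := by
    calc r * N = ∑ t ∈ Finset.range r, N := by simp
      _ < _ := Finset.sum_lt_sum_of_nonempty (by simpa using hr.ne') (fun t ht => h t (by simpa using ht))
  rw [← Finset.mul_sum] at h2
  have := Nat.mul_le_mul_left r (hsum.trans hN)
  omega

theorem exists_small_tree_or_separator (hE : ∀ u v, E u v → E v u) (D : Finset V) (k r : ℕ)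
    (hk : 0 < k) (hr : 0 < r) (A : ℕ → Set V) :
    (∃ T : Finset V, T ⊆ D ∧ ConnSet E (T : Set V) ∧ T.card ≤ r + 1 ∧
      ∀ i < k, ∃ v ∈ T, v ∈ A i) ∨
    (∃ Z : Finset V, Z ⊆ D ∧ r * Z.card ≤ k * D.card ∧ ∃ g : V → ℕ,
      (∀ v ∈ D \ Z, g v < k ∧ v ∉ A (g v)) ∧
      ∀ u ∈ D \ Z, ∀ v ∈ D \ Z, E u v → g u = g v) := by
  by_cases hT : (∃ T : Finset V, T ⊆ D ∧ ConnSet E (T : Set V) ∧ T.card ≤ r + 1 ∧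
      ∀ i < k, ∃ v ∈ T, v ∈ A i)
  · exact Or.inl hT
  right
  let p : ℕ → V → ℕ → Prop := fun t v i => ∃ T : Finset V, T ⊆ D ∧ ConnSet E (T : Set V) ∧
    v ∈ T ∧ T.card ≤ t + 1 ∧ ∀ j ≤ i, ∃ v ∈ T, v ∈ A j
  let S : ℕ → Finset (V × ℕ) := fun t =>
    (D ×ˢ Finset.range k).filter (fun x => p t x.1 x.2)
  have hp : ∀ t t' v i, t ≤ t' → p t v i → p t' v i := by
    rintro t t' v i h ⟨T, h1, h2, h3, h4, h5⟩
    exact ⟨T, h1, h2, h3, by omega, h5⟩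
  have hmono : Monotone S := by
    intro t t' h x hx
    simp only [S, Finset.mem_filter] at hx ⊢
    exact ⟨hx.1, hp _ _ _ _ h hx.2⟩
  have hno : ∀ t ≤ r, ∀ v, ¬ p t v (k - 1) := by
    rintro t ht v ⟨T, h1, h2, h3, h4, h5⟩
    exact hT ⟨T, h1, h2, by omega, fun i hi => h5 i (by omega)⟩
  obtain ⟨t, htr, ht⟩ := exists_small_layer S hmono r (k * D.card)
    ((Finset.card_filter_le _ _).trans (by simp [mul_comm])) hr
  have hex : ∀ v, ∃ i, ¬ p t v i := fun v => ⟨k - 1, hno t htr.le v⟩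
  have hex' : ∀ v, ∃ i, ¬ p t v i ∧ ∀ m < i, p t v m := fun v =>
    ⟨Nat.find (hex v), Nat.find_spec (hex v), fun m hm => not_not.mp (Nat.find_min (hex v) hm)⟩
  choose g hg1 hg2 using hex'
  refine ⟨(S (t + 1) \ S t).image Prod.fst, ?_, ?_, g, ?_, ?_⟩
  · intro v hv
    simp only [S, Finset.mem_image, Finset.mem_sdiff, Finset.mem_filter, Finset.mem_product] at hv
    obtain ⟨x, hx, rfl⟩ := hv
    exact hx.1.1.1
  · exact (Nat.mul_le_mul_left r Finset.card_image_le).trans ht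
  · intro v hv
    rw [Finset.mem_sdiff] at hv
    constructor
    · by_contra hk'
      exact hno t htr.le v (hg2 v (k - 1) (by omega))
    · intro hA
      have h1 := hg1 v
      have h2 := hg2 v
      rcases hm : g v with _ | m
      · rw [hm] at h1 hA
        refine h1 ⟨{v}, by simpa using hv.1, by simpa using ConnSet.singleton v, by simp, by simp, ?_⟩
        intro j hj
        exact ⟨v, by simp, by rwa [Nat.le_zero.mp hj]⟩
      · rw [hm] at h1 hA
        have h3 := h2 m (by omega)
        obtain ⟨T, q1, q2, q3, q4, q5⟩ := h3
        refine h1 ⟨T, q1, q2, q3, q4, fun j hj => ?_⟩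
        rcases Nat.lt_or_ge j (m + 1) with hj' | hj'
        · exact q5 j (by omega)
        · exact ⟨v, q3, by rwa [show j = m + 1 by omega]⟩
  · have key : ∀ u ∈ D \ (S (t + 1) \ S t).image Prod.fst,
        ∀ v ∈ D \ (S (t + 1) \ S t).image Prod.fst, E u v → ∀ i, p t u i → p t v i := by
      intro u hu v hv huv i hpi
      rw [Finset.mem_sdiff] at hu hv
      have hik : i < k := by
        by_contra hik
        obtain ⟨T, h1, h2, h3, h4, h5⟩ := hpi
        exact hT ⟨T, h1, h2, by omega, fun i hi => h5 i (by omega)⟩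
      have h1 : p (t + 1) v i := by
        obtain ⟨T, h1, h2, h3, h4, h5⟩ := hpi
        refine ⟨insert v T, ?_, ?_, by simp, (Finset.card_insert_le _ _).trans (by omega), ?_⟩
        · exact Finset.insert_subset hv.1 h1
        · have := (ConnSet.singleton (E := E) v).union hE h2 (mem_singleton v) h3
            (Or.inr (hE _ _ huv))
          simpa using this
        · intro j hj
          obtain ⟨w, hw, hw'⟩ := h5 j hj
          exact ⟨w, by simp [hw], hw'⟩
      by_contra h2
      apply hv.2
      rw [Finset.mem_image]
      refine ⟨(v, i), ?_, rfl⟩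
      simp only [S, Finset.mem_sdiff, Finset.mem_filter, Finset.mem_product, Finset.mem_range]
      exact ⟨⟨⟨hv.1, hik⟩, h1⟩, fun h => h2 h.2⟩
    intro u hu v hv huv
    have hiff : ∀ i, p t u i ↔ p t v i := fun i =>
      ⟨key u hu v hv huv i, key v hv u hu (hE _ _ huv) i⟩
    rcases lt_trichotomy (g u) (g v) with h | h | h
    · exact absurd ((hiff _).mpr (hg2 v _ h)) (hg1 u)
    · exact h
    · exact absurd ((hiff _).mp (hg2 u _ h)) (hg1 v)

theorem exists_balanced_subset {ι : Type*} [DecidableEq ι] (s : Finset ι) (w : ι → ℕ) (n : ℕ)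
    (hs : ∑ i ∈ s, w i ≤ n) (hw : ∀ i ∈ s, 3 * w i ≤ 2 * n) :
    ∃ J ⊆ s, 3 * ∑ i ∈ J, w i ≤ 2 * n ∧ 3 * ∑ i ∈ s \ J, w i ≤ 2 * n := by
  have hsplit : ∀ J ⊆ s, ∑ i ∈ s \ J, w i + ∑ i ∈ J, w i = ∑ i ∈ s, w i :=
    fun J hJ => Finset.sum_sdiff hJ
  by_cases h : ∃ i ∈ s, n ≤ 3 * w i
  · obtain ⟨i, hi, hin⟩ := h
    have h1 := hsplit {i} (by simpa using hi)
    have h2 := hw i hi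
    exact ⟨{i}, by simpa using hi, by simpa using h2, by simp only [Finset.sum_singleton] at h1; omega⟩
  push Not at h
  have key : ∀ t ⊆ s, ∃ J ⊆ t, 3 * ∑ i ∈ J, w i ≤ 2 * n ∧ (n ≤ 3 * ∑ i ∈ J, w i ∨ J = t) := by
    intro t
    induction t using Finset.induction_on with
    | empty => exact fun _ => ⟨∅, by simp, by simp, Or.inr rfl⟩
    | insert a t ha ih =>
      intro ht
      obtain ⟨J, h1, h2, h3⟩ := ih ((Finset.subset_insert _ _).trans ht)
      rcases Nat.lt_or_ge (3 * ∑ i ∈ J, w i) n with h4 | h4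
      · obtain rfl : J = t := h3.resolve_left (by omega)
        refine ⟨insert a J, subset_rfl, ?_, Or.inr rfl⟩
        rw [Finset.sum_insert ha]
        have := h a (ht (by simp))
        omega
      · exact ⟨J, h1.trans (Finset.subset_insert _ _), h2, Or.inl h4⟩
  obtain ⟨J, h1, h2, h3⟩ := key s subset_rfl
  refine ⟨J, h1, h2, ?_⟩
  have h4 := hsplit J h1
  rcases h3 with h3 | rfl
  · omega
  · simp

/-- `A` and `B` cover `W` together with all `E`-pairs of `W`, have overlap at most `t`, and
neither of them exceeds two thirds of `W` by more than `t`. -/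
structure Separation (E : V → V → Prop) (W A B : Finset V) (t : ℕ) : Prop where
  left_subset : A ⊆ W
  right_subset : B ⊆ W
  cover : W ⊆ A ∪ B
  edge : ∀ u ∈ W, ∀ v ∈ W, E u v → (u ∈ A ∧ v ∈ A) ∨ (u ∈ B ∧ v ∈ B)
  card_add : A.card + B.card ≤ W.card + t
  card_left : 3 * A.card ≤ 2 * W.card + 3 * t
  card_right : 3 * B.card ≤ 2 * W.card + 3 * t

theorem exists_separation_of_classes (W Y : Finset V) (hY : Y ⊆ W) (t : ℕ) (ht : Y.card ≤ t)
    (g : V → ℕ) (hg : ∀ v ∈ W \ Y, g v < 6)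
    (hE : ∀ u ∈ W \ Y, ∀ v ∈ W \ Y, E u v → g u = g v)
    (hc : ∀ i < 6, 3 * ((W \ Y).filter (g · = i)).card ≤ 2 * W.card) :
    ∃ A B, Separation E W A B t := by
  have hmaps : ∀ v ∈ W \ Y, g v ∈ Finset.range 6 := fun v hv => Finset.mem_range.mpr (hg v hv)
  have hsum := Finset.card_eq_sum_card_fiberwise (f := g) (s := W \ Y) (t := Finset.range 6) hmaps
  have hle : (W \ Y).card ≤ W.card := Finset.card_le_card Finset.sdiff_subset
  obtain ⟨J, hJ, h1, h2⟩ := exists_balanced_subset (Finset.range 6)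
    (fun i => ((W \ Y).filter (g · = i)).card) W.card (hsum ▸ hle)
    (fun i hi => hc i (Finset.mem_range.mp hi))
  have hcard : ∀ K : Finset ℕ, ((W \ Y).filter (g · ∈ K)).card =
      ∑ i ∈ K, ((W \ Y).filter (g · = i)).card := by
    intro K
    rw [Finset.card_eq_sum_card_fiberwise (f := g) (s := (W \ Y).filter (g · ∈ K)) (t := K)
      (fun v hv => (Finset.mem_filter.mp hv).2)]
    refine Finset.sum_congr rfl fun i hi => ?_
    rw [Finset.filter_filter]
    congr 1
    refine Finset.filter_congr fun v _ => ⟨fun h => h.2, fun h => ⟨h ▸ hi, h⟩⟩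
  have hadd := Finset.sum_sdiff hJ (f := fun i => ((W \ Y).filter (g · = i)).card)
  have hWY := Finset.card_sdiff_add_card_eq_card hY
  have hu1 := Finset.card_union_le Y ((W \ Y).filter (g · ∈ J))
  have hu2 := Finset.card_union_le Y ((W \ Y).filter (g · ∈ Finset.range 6 \ J))
  rw [hcard] at hu1 hu2
  have hf : ∀ K : Finset ℕ, (W \ Y).filter (g · ∈ K) ⊆ W :=
    fun K => (Finset.filter_subset _ _).trans Finset.sdiff_subset
  refine ⟨Y ∪ (W \ Y).filter (g · ∈ J), Y ∪ (W \ Y).filter (g · ∈ Finset.range 6 \ J),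
    Finset.union_subset hY (hf _), Finset.union_subset hY (hf _), ?_, ?_, ?_, ?_, ?_⟩
  · intro v hv
    by_cases hvY : v ∈ Y
    · simp [hvY]
    · have := hg v (by simp [hv, hvY])
      by_cases hvJ : g v ∈ J <;> simp [hv, hvY, hvJ, this]
  · intro u hu v hv huv
    have h6 : ∀ w ∈ W, w ∉ Y → g w < 6 := fun w hw hw' => hg w (by simp [hw, hw'])
    by_cases huY : u ∈ Y
    · by_cases hvY : v ∈ Y
      · simp [huY, hvY]
      · have := h6 v hv hvY
        by_cases hvJ : g v ∈ J <;> simp [hv, huY, hvY, hvJ, this]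
    · have h3 := h6 u hu huY
      by_cases hvY : v ∈ Y
      · by_cases huJ : g u ∈ J <;> simp [hu, huY, hvY, huJ, h3]
      · have h5 := hE u (by simp [hu, huY]) v (by simp [hv, hvY]) huv
        by_cases huJ : g u ∈ J
        · left; simp [hu, huY, hv, huJ, hvY, ← h5]
        · right; simp [hu, huY, hv, huJ, hvY, h3, ← h5]
  · omega
  · omega
  · omega

theorem ConnSet.sUnion {C : Set V} (hC : C.Nonempty) (F : Set (Set V)) (hF : ∀ S ∈ F, ConnSet E S)
    (hCF : ∀ S ∈ F, C ⊆ S) (hne : F.Nonempty) : ConnSet E (⋃₀ F) := by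
  obtain ⟨c, hc⟩ := hC
  obtain ⟨S₀, hS₀⟩ := hne
  refine ⟨⟨c, S₀, hS₀, hCF _ hS₀ hc⟩, fun R hR hRn hcl => ?_⟩
  have key : ∀ S ∈ F, (R ∩ S).Nonempty → S ⊆ R := by
    intro S hS hn
    exact inter_eq_right.mp ((hF S hS).2 (R ∩ S) inter_subset_right hn
      (fun a ha b hb hab => ⟨hcl a ha.1 b ⟨S, hS, hb⟩ hab, hb⟩))
  obtain ⟨x, hx⟩ := hRn
  obtain ⟨S, hS, hxS⟩ := hR hx
  have hcR : c ∈ R := key S hS ⟨x, hx, hxS⟩ (hCF S hS hc)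
  refine subset_antisymm hR (sUnion_subset fun S' hS' => key S' hS' ⟨c, hcR, hCF _ hS' hc⟩)

/-- The state of the separator search: a family of touching clusters `C i`, and a large set `D`
whose neighbourhood is contained in the small parts `X i` of the clusters. -/
structure ClusterState (E : V → V → Prop) (W : Finset V) (s : ℕ) (I : Finset (Fin 5))
    (C : Fin 5 → Set V) (X : Fin 5 → Finset V) (D : Finset V) : Prop where
  subset : D ⊆ W
  large : 2 * W.card < 3 * D.card
  conn : ∀ i ∈ I, ConnSet E (C i)
  disj : ∀ i ∈ I, ∀ j ∈ I, i ≠ j → Disjoint (C i) (C j)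
  touch : ∀ i ∈ I, ∀ j ∈ I, i ≠ j → ∃ u ∈ C i, ∃ v ∈ C j, E u v
  disjD : ∀ i ∈ I, ∀ v ∈ D, v ∉ C i
  subC : ∀ i ∈ I, ∀ v ∈ X i, v ∈ C i
  card : ∀ i ∈ I, (X i).card ≤ s
  nbr : ∀ u ∈ D, ∀ v ∈ W, E u v → v ∈ D ∨ ∃ i ∈ I, v ∈ X i

theorem ClusterState.exists_separation (hE : ∀ u v, E u v → E v u) (hK : NoK5 E)
    {W : Finset V} {s r : ℕ} (hr : 0 < r) (hrs : r + 1 ≤ s) (hs : 5 * W.card ≤ r * s)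
    (m : ℕ) : ∀ (I : Finset (Fin 5)) (C : Fin 5 → Set V) (X : Fin 5 → Finset V) (D : Finset V),
    6 * D.card + I.card ≤ m → ClusterState E W s I C X D →
    ∃ A B, Separation E W A B (6 * s) := by
  induction m with
  | zero =>
    intro I C X D hm h
    have := h.large
    omega
  | succ m ih =>
  intro I C X D hm h
  have hDpos : 0 < D.card := by have := h.large; omega
  obtain ⟨d₀, hd₀⟩ := Finset.card_pos.mp hDpos
  set Y₀ : Finset V := (I.biUnion X) ∩ W with hY₀
  have hY₀card : Y₀.card ≤ 5 * s := by
    refine (Finset.card_le_card Finset.inter_subset_left).trans (Finset.card_biUnion_le.trans ?_)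
    refine (Finset.sum_le_card_nsmul _ _ s h.card).trans ?_
    have : I.card ≤ 5 := by simpa using Finset.card_le_univ I
    simpa using Nat.mul_le_mul_right s this
  have hY₀D : ∀ v ∈ Y₀, v ∉ D := by
    intro v hv hvD
    simp only [hY₀, Finset.mem_inter, Finset.mem_biUnion] at hv
    obtain ⟨⟨i, hi, hvi⟩, -⟩ := hv
    exact h.disjD i hi v hvD (h.subC i hi v hvi)
  have hnbr : ∀ u ∈ D, ∀ v ∈ W, E u v → v ∉ Y₀ → v ∈ D := by
    intro u hu v hv huv hvY
    refine (h.nbr u hu v hv huv).resolve_right ?_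
    rintro ⟨i, hi, hvi⟩
    exact hvY (by simp only [hY₀, Finset.mem_inter, Finset.mem_biUnion]; exact ⟨⟨i, hi, hvi⟩, hv⟩)
  have hout : 3 * (W \ D).card ≤ 2 * W.card := by
    have h1 := Finset.card_sdiff_add_card_eq_card h.subset
    have h2 := h.large
    omega
  by_cases hdrop : ∃ i ∈ I, ∀ u ∈ D, ∀ c ∈ C i, ¬ E u c
  · obtain ⟨i, hi, hdrop⟩ := hdrop
    refine ih (I.erase i) C X D ?_ ⟨h.subset, h.large, ?_, ?_, ?_, ?_, ?_, ?_, ?_⟩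
    · have := Finset.card_erase_add_one hi
      omega
    · exact fun j hj => h.conn j (Finset.mem_of_mem_erase hj)
    · exact fun j hj k hk => h.disj j (Finset.mem_of_mem_erase hj) k (Finset.mem_of_mem_erase hk)
    · exact fun j hj k hk => h.touch j (Finset.mem_of_mem_erase hj) k (Finset.mem_of_mem_erase hk)
    · exact fun j hj => h.disjD j (Finset.mem_of_mem_erase hj)
    · exact fun j hj => h.subC j (Finset.mem_of_mem_erase hj)
    · exact fun j hj => h.card j (Finset.mem_of_mem_erase hj)
    · intro u hu v hv huv
      refine (h.nbr u hu v hv huv).imp id ?_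
      rintro ⟨j, hj, hvj⟩
      refine ⟨j, Finset.mem_erase.mpr ⟨?_, hj⟩, hvj⟩
      rintro rfl
      exact hdrop u hu v (h.subC _ hi v hvj) huv
  push Not at hdrop
  let A : ℕ → Set V := fun k => {v | ∀ i ∈ I, (i : ℕ) = k → ∃ c ∈ C i, E v c}
  rcases exists_small_tree_or_separator hE D 5 r (by norm_num) hr A with
    ⟨T, hTD, hTc, hTr, hTA⟩ | ⟨Z, hZD, hZr, g, hg1, hg2⟩
  · have hI : ∃ j, j ∉ I := by
      by_contra! hall
      exact hK ⟨C, fun i => h.conn i (hall i), fun i j => h.disj i (hall i) j (hall j),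
        fun i j => h.touch i (hall i) j (hall j)⟩
    obtain ⟨j, hj⟩ := hI
    have hTcard : 0 < T.card := Finset.card_pos.mpr (by simpa using hTc.1)
    have hDT := Finset.card_sdiff_add_card_eq_card hTD
    by_cases hbig : 2 * W.card < 3 * (D \ T).card
    · have hne : ∀ i ∈ I, i ≠ j := fun i hi e => hj (e ▸ hi)
      have htouch : ∀ i ∈ I, ∃ u ∈ T, ∃ v ∈ C i, E u v := by
        intro i hi
        obtain ⟨v, hv, hvA⟩ := hTA i i.2
        exact ⟨v, hv, hvA i hi rfl⟩
      refine ih (insert j I) (Function.update C j T) (Function.update X j T) (D \ T) ?_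
        ⟨Finset.sdiff_subset.trans h.subset, hbig, ?_, ?_, ?_, ?_, ?_, ?_, ?_⟩
      · rw [Finset.card_insert_of_notMem hj]
        omega
      · intro i hi
        rcases Finset.mem_insert.mp hi with rfl | hi
        · simpa using hTc
        · simpa [hne i hi] using h.conn i hi
      · intro i hi k hk hik
        rcases Finset.mem_insert.mp hi with rfl | hi' <;> rcases Finset.mem_insert.mp hk with rfl | hk'
        · exact absurd rfl hik
        · simp only [Function.update_self, Function.update_of_ne (hne k hk')]
          exact Set.disjoint_left.mpr fun v hv => h.disjD k hk' v (hTD hv)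
        · simp only [Function.update_self, Function.update_of_ne (hne i hi')]
          exact Set.disjoint_right.mpr fun v hv => h.disjD i hi' v (hTD hv)
        · simp only [Function.update_of_ne (hne k hk'), Function.update_of_ne (hne i hi')]
          exact h.disj i hi' k hk' hik
      · intro i hi k hk hik
        rcases Finset.mem_insert.mp hi with rfl | hi' <;> rcases Finset.mem_insert.mp hk with rfl | hk'
        · exact absurd rfl hik
        · simp only [Function.update_self, Function.update_of_ne (hne k hk')]
          exact htouch k hk'
        · simp only [Function.update_self, Function.update_of_ne (hne i hi')]
          obtain ⟨u, hu, v, hv, huv⟩ := htouch i hi'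
          exact ⟨v, hv, u, hu, hE _ _ huv⟩
        · simp only [Function.update_of_ne (hne k hk'), Function.update_of_ne (hne i hi')]
          exact h.touch i hi' k hk' hik
      · intro i hi v hv
        rw [Finset.mem_sdiff] at hv
        rcases Finset.mem_insert.mp hi with rfl | hi
        · simpa using hv.2
        · simpa [hne i hi] using h.disjD i hi v hv.1
      · intro i hi
        rcases Finset.mem_insert.mp hi with rfl | hi
        · simp
        · simpa [hne i hi] using h.subC i hi
      · intro i hi
        rcases Finset.mem_insert.mp hi with rfl | hi
        · simpa using hTr.trans hrs
        · simpa [hne i hi] using h.card i hi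
      · intro u hu v hv huv
        rw [Finset.mem_sdiff] at hu
        rcases h.nbr u hu.1 v hv huv with h1 | ⟨i, hi, hvi⟩
        · by_cases hvT : v ∈ T
          · exact Or.inr ⟨j, Finset.mem_insert_self _ _, by simpa using hvT⟩
          · exact Or.inl (Finset.mem_sdiff.mpr ⟨h1, hvT⟩)
        · exact Or.inr ⟨i, Finset.mem_insert_of_mem hi, by simpa [hne i hi] using hvi⟩
    · have hYc := Finset.card_union_le Y₀ T
      refine exists_separation_of_classes W (Y₀ ∪ T)
        (Finset.union_subset Finset.inter_subset_right (hTD.trans h.subset)) _ (by omega)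
        (fun v => if v ∈ D then 0 else 1) ?_ ?_ ?_
      · intro v _
        split_ifs <;> norm_num
      · intro u hu v hv huv
        simp only [Finset.mem_sdiff, Finset.mem_union, not_or] at hu hv
        have : u ∈ D ↔ v ∈ D := ⟨fun hu' => hnbr u hu' v hv.1 huv hv.2.1,
          fun hv' => hnbr v hv' u hu.1 (hE _ _ huv) hu.2.1⟩
        simp [this]
      · intro i _
        rcases Nat.lt_or_ge i 1 with hi | hi
        · have hsub : (W \ (Y₀ ∪ T)).filter (fun v => (if v ∈ D then 0 else 1) = i) ⊆ D \ T := by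
            intro v hv
            simp only [Finset.mem_filter, Finset.mem_sdiff, Finset.mem_union, not_or] at hv ⊢
            refine ⟨?_, hv.1.2.2⟩
            by_contra hvD
            simp only [hvD, if_false] at hv
            omega
          have := Finset.card_le_card hsub
          omega
        · have hsub : (W \ (Y₀ ∪ T)).filter (fun v => (if v ∈ D then 0 else 1) = i) ⊆ W \ D := by
            intro v hv
            simp only [Finset.mem_filter, Finset.mem_sdiff] at hv ⊢
            refine ⟨hv.1.1, fun hvD => ?_⟩
            simp only [hvD, if_true] at hv
            omega
          have := Finset.card_le_card hsub
          omega
  · have hZs : Z.card ≤ s := by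
      have h1 : D.card ≤ W.card := Finset.card_le_card h.subset
      exact Nat.le_of_mul_le_mul_left (by omega) hr
    by_cases hbig : ∃ i < 5, 2 * W.card < 3 * ((D \ Z).filter (g · = i)).card
    · obtain ⟨i', hi', hbig⟩ := hbig
      set D' := (D \ Z).filter (g · = i') with hD'
      have hD'D : D' ⊆ D := (Finset.filter_subset _ _).trans Finset.sdiff_subset
      have hD'A : ∀ v ∈ D', v ∉ A i' := by
        intro v hv
        rw [hD', Finset.mem_filter] at hv
        exact hv.2 ▸ (hg1 v hv.1).2
      obtain ⟨v₀, hv₀⟩ : D'.Nonempty := Finset.card_pos.mp (by omega)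
      obtain ⟨i, hi, rfl⟩ : ∃ i ∈ I, (i : ℕ) = i' := by
        by_contra! hcon
        exact hD'A v₀ hv₀ fun i hi e => absurd e (hcon i hi)
      have hD'C : ∀ v ∈ D', ∀ c ∈ C i, ¬ E v c := by
        intro v hv c hc hvc
        exact hD'A v hv fun k hk e => ⟨c, by rwa [Fin.ext e], hvc⟩
      set F : Set (Set V) := {S | ConnSet E S ∧ C i ⊆ S ∧ S ⊆ C i ∪ (↑D \ ↑D')} with hF
      have hCF : C i ∈ F := ⟨h.conn i hi, subset_rfl, subset_union_left⟩
      set C' : Set V := ⋃₀ F with hC'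
      have hC'conn : ConnSet E C' := ConnSet.sUnion (h.conn i hi).1 F (fun S hS => hS.1)
        (fun S hS => hS.2.1) ⟨_, hCF⟩
      have hC'sub : C' ⊆ C i ∪ (↑D \ ↑D') := sUnion_subset fun S hS => hS.2.2
      have hCC' : C i ⊆ C' := subset_sUnion_of_mem hCF
      have hC'cl : ∀ d ∈ D, d ∉ D' → ∀ c ∈ C', E d c → d ∈ C' := by
        rintro d hd hd' c ⟨S, hS, hcS⟩ hdc
        refine ⟨{d} ∪ S, ⟨(ConnSet.singleton d).union hE hS.1 (mem_singleton d) hcS (Or.inr hdc),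
          hS.2.1.trans subset_union_right, union_subset ?_ hS.2.2⟩, Or.inl rfl⟩
        exact singleton_subset_iff.mpr (Or.inr ⟨hd, hd'⟩)
      have hC'D : ∀ v ∈ D, v ∈ C' → v ∉ D' := fun v hvD hvC =>
        ((hC'sub hvC).resolve_left (h.disjD i hi v hvD)).2
      set D'' := D.filter (· ∉ C') with hD''
      have hD''mem : ∀ v, v ∈ D'' ↔ v ∈ D ∧ v ∉ C' := fun v => Finset.mem_filter
      have hsub : D' ⊆ D'' := fun v hv =>
        (hD''mem v).mpr ⟨hD'D hv, fun hvC => hC'D v (hD'D hv) hvC hv⟩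
      have hD''lt : D''.card < D.card := by
        obtain ⟨u, hu, c, hc, huc⟩ := hdrop i hi
        refine Finset.card_lt_card ⟨Finset.filter_subset _ _, fun hcon => ?_⟩
        exact ((hD''mem u).mp (hcon hu)).2
          (hC'cl u hu (fun hu' => hD'C u hu' c hc huc) c (hCC' hc) huc)
      have hdisj : ∀ k ∈ I, k ≠ i → Disjoint C' (C k) := by
        intro k hk hki
        refine Set.disjoint_left.mpr fun v hv hvk => ?_
        rcases hC'sub hv with hv | hv
        · exact Set.disjoint_left.mp (h.disj i hi k hk hki.symm) hv hvk
        · exact h.disjD k hk v hv.1 hvk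
      refine ih I (Function.update C i C') (Function.update X i (Z.filter (· ∈ C'))) D'' (by omega)
        ⟨(Finset.filter_subset _ _).trans h.subset, ?_, ?_, ?_, ?_, ?_, ?_, ?_, ?_⟩
      · have := Finset.card_le_card hsub
        omega
      · intro k hk
        by_cases hki : k = i
        · subst hki; simpa using hC'conn
        · simpa [hki] using h.conn k hk
      · intro k hk l hl hkl
        by_cases hki : k = i
        · subst hki
          simp only [Function.update_self, Function.update_of_ne hkl.symm]
          exact hdisj l hl hkl.symm
        · by_cases hli : l = i
          · subst hli
            simp only [Function.update_self, Function.update_of_ne hkl]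
            exact (hdisj k hk hkl).symm
          · simpa [hki, hli] using h.disj k hk l hl hkl
      · intro k hk l hl hkl
        obtain ⟨u, hu, v, hv, huv⟩ := h.touch k hk l hl hkl
        refine ⟨u, ?_, v, ?_, huv⟩
        · by_cases hki : k = i
          · subst hki; simpa using hCC' hu
          · simpa [hki] using hu
        · by_cases hli : l = i
          · subst hli; simpa using hCC' hv
          · simpa [hli] using hv
      · intro k hk v hv
        rw [hD''mem] at hv
        by_cases hki : k = i
        · subst hki; simpa using hv.2
        · simpa [hki] using h.disjD k hk v hv.1
      · intro k hk v hv
        by_cases hki : k = i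
        · subst hki
          simp only [Function.update_self, Finset.mem_filter] at hv ⊢
          exact hv.2
        · simp only [Function.update_of_ne hki] at hv ⊢
          exact h.subC k hk v hv
      · intro k hk
        by_cases hki : k = i
        · subst hki
          simpa using (Finset.card_filter_le _ _).trans hZs
        · simpa [hki] using h.card k hk
      · intro u hu v hv huv
        rw [hD''mem] at hu
        rcases h.nbr u hu.1 v hv huv with hvD | ⟨k, hk, hvk⟩
        · by_cases hvC : v ∈ C'
          · have hvD' := hC'D v hvD hvC
            have huD' : u ∈ D' := by
              by_contra huD'
              exact hu.2 (hC'cl u hu.1 huD' v hvC huv)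
            have hvZ : v ∈ Z := by
              by_contra hvZ
              rw [hD', Finset.mem_filter] at huD' hvD'
              have hvm : v ∈ D \ Z := Finset.mem_sdiff.mpr ⟨hvD, hvZ⟩
              exact hvD' ⟨hvm, (hg2 u huD'.1 v hvm huv).symm.trans huD'.2⟩
            exact Or.inr ⟨i, hi, by simpa using ⟨hvZ, hvC⟩⟩
          · exact Or.inl ((hD''mem v).mpr ⟨hvD, hvC⟩)
        · by_cases hki : k = i
          · subst hki
            have hvc := h.subC k hk v hvk
            refine absurd (hC'cl u hu.1 (fun hu' => hD'C u hu' v hvc huv) v (hCC' hvc) huv) hu.2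
          · exact Or.inr ⟨k, hk, by simpa [hki] using hvk⟩
    · push Not at hbig
      have hYc := Finset.card_union_le Y₀ Z
      refine exists_separation_of_classes W (Y₀ ∪ Z)
        (Finset.union_subset Finset.inter_subset_right (hZD.trans h.subset)) _ (by omega)
        (fun v => if v ∈ D then g v else 5) ?_ ?_ ?_
      · intro v hv
        simp only [Finset.mem_sdiff, Finset.mem_union, not_or] at hv
        split_ifs with hvD
        · exact (hg1 v (Finset.mem_sdiff.mpr ⟨hvD, hv.2.2⟩)).1.trans (by norm_num)
        · norm_num
      · intro u hu v hv huv
        simp only [Finset.mem_sdiff, Finset.mem_union, not_or] at hu hv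
        by_cases huD : u ∈ D
        · have hvD := hnbr u huD v hv.1 huv hv.2.1
          simp only [huD, hvD, if_true]
          exact hg2 u (Finset.mem_sdiff.mpr ⟨huD, hu.2.2⟩) v (Finset.mem_sdiff.mpr ⟨hvD, hv.2.2⟩) huv
        · have hvD : v ∉ D := fun hv' => huD (hnbr v hv' u hu.1 (hE _ _ huv) hu.2.1)
          simp [huD, hvD]
      · intro i hi
        rcases Nat.lt_or_ge i 5 with hi5 | hi5
        · refine le_trans (Nat.mul_le_mul_left 3 (Finset.card_le_card ?_)) (hbig i hi5)
          intro v hv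
          simp only [Finset.mem_filter, Finset.mem_sdiff, Finset.mem_union, not_or] at hv ⊢
          by_cases hvD : v ∈ D
          · simp only [hvD, if_true] at hv
            exact ⟨⟨hvD, hv.1.2.2⟩, hv.2⟩
          · simp only [hvD, if_false] at hv
            omega
        · refine le_trans (Nat.mul_le_mul_left 3 (Finset.card_le_card ?_)) hout
          intro v hv
          simp only [Finset.mem_filter, Finset.mem_sdiff, Finset.mem_union, not_or] at hv ⊢
          refine ⟨hv.1.1, fun hvD => ?_⟩
          simp only [hvD, if_true] at hv
          have := (hg1 v (Finset.mem_sdiff.mpr ⟨hvD, hv.1.2.2⟩)).1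
          omega

theorem NoK5.exists_separation (hE : ∀ u v, E u v → E v u) (hK : NoK5 E) (W : Finset V)
    (hW : 0 < W.card) : ∃ A B, Separation E W A B (120 * Nat.sqrt W.card) := by
  have hr : 0 < Nat.sqrt W.card := Nat.sqrt_pos.mpr hW
  have hlt := Nat.lt_succ_sqrt W.card
  obtain ⟨A, B, h⟩ := ClusterState.exists_separation hE hK (W := W) (s := 20 * Nat.sqrt W.card) hr
    (by omega) (by simp only [Nat.succ_eq_add_one] at hlt; nlinarith) _ ∅ (fun _ => ∅) (fun _ => ∅) W
    le_rfl (by constructor <;> first | exact fun _ _ _ h _ => Or.inl h | simp | omega)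
  exact ⟨A, B, by rwa [show 6 * (20 * Nat.sqrt W.card) = 120 * Nat.sqrt W.card by ring] at h⟩

theorem division_bound {x y z ρ : ℝ} (hρ : 2400 ≤ ρ) (hx : 0 ≤ x) (hy : x / 2 ≤ y) (hz : x / 2 ≤ z)
    (h1 : x ^ 2 ≤ y ^ 2 + z ^ 2) (h2 : y ^ 2 + z ^ 2 ≤ x ^ 2 + 120 * x) :
    (y ^ 2 + 2400 * y ^ 2 / ρ - 1200 * y) + (z ^ 2 + 2400 * z ^ 2 / ρ - 1200 * z) ≤
      x ^ 2 + 2400 * x ^ 2 / ρ - 1200 * x := by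
  have hsum : 6 / 5 * x ≤ y + z := by
    have hyz : x / 2 * (x / 2) ≤ y * z := mul_le_mul hy hz (by linarith) (by linarith)
    have : (6 / 5 * x) ^ 2 ≤ (y + z) ^ 2 := by nlinarith
    exact le_of_sq_le_sq this (by linarith)
  have hκ : 2400 / ρ ≤ 1 := (div_le_one (by linarith)).mpr hρ
  have hκ0 : 0 ≤ 2400 / ρ := by positivity
  have e : ∀ w : ℝ, 2400 * w ^ 2 / ρ = 2400 / ρ * w ^ 2 := fun w => by ring
  rw [e, e, e]
  have h3 := mul_le_mul_of_nonneg_left h2 hκ0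
  have h4 := mul_le_mul_of_nonneg_right hκ (by linarith : 0 ≤ 120 * x)
  nlinarith

theorem NoK5.exists_division_aux (hE : ∀ u v, E u v → E v u) (hK : NoK5 E) (r : ℕ)
    (hr : 2400 ^ 2 ≤ r) (m : ℕ) : ∀ W : Finset V, W.card ≤ m → ∃ L : List (Finset V),
      (∀ p ∈ L, p ⊆ W ∧ p.card ≤ r) ∧ (∀ v ∈ W, ∃ p ∈ L, v ∈ p) ∧
      (∀ u ∈ W, ∀ v ∈ W, E u v → ∃ p ∈ L, u ∈ p ∧ v ∈ p) ∧
      (W.card ≤ r → (L.map Finset.card).sum ≤ W.card) ∧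
      (r ≤ 4 * W.card → ((L.map Finset.card).sum : ℝ) ≤
        W.card + 2400 * W.card / √r - 1200 * √W.card) := by
  induction m with
  | zero =>
    intro W hW
    obtain rfl : W = ∅ := by simpa using hW
    exact ⟨[], by simp, by simp, by simp, by simp, by simp⟩
  | succ m ih =>
  intro W hW
  have hρ : (2400 : ℝ) ≤ √r := Real.le_sqrt_of_sq_le (by exact_mod_cast hr)
  have hρ2 : √(r : ℝ) ^ 2 = r := Real.sq_sqrt (by positivity)
  rcases Nat.lt_or_ge r W.card with hlt | hle
  · obtain ⟨A, B, h⟩ := hK.exists_separation hE W (by omega)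
    have hm : ((Nat.sqrt W.card : ℕ) : ℝ) ≤ √W.card := Real.nat_sqrt_le_real_sqrt
    have hx : (2400 : ℝ) ≤ √W.card := hρ.trans (Real.sqrt_le_sqrt (by exact_mod_cast hlt.le))
    have hx2 : √(W.card : ℝ) ^ 2 = W.card := Real.sq_sqrt (by positivity)
    have hcov := (Finset.card_le_card h.cover).trans (Finset.card_union_le A B)
    have hms : Nat.sqrt W.card * 2400 ≤ W.card := by
      have : ((Nat.sqrt W.card * 2400 : ℕ) : ℝ) ≤ W.card := by
        push_cast
        nlinarith
      exact_mod_cast this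
    have h1 := h.card_left
    have h2 := h.card_right
    have h3 := h.card_add
    obtain ⟨L, l1, l2, l3, -, l4⟩ := ih A (by omega)
    obtain ⟨M, m1, m2, m3, -, m4⟩ := ih B (by omega)
    refine ⟨L ++ M, ?_, ?_, ?_, fun hcon => absurd hcon (by omega), fun _ => ?_⟩
    · intro p hp
      rcases List.mem_append.mp hp with hp | hp
      · exact ⟨(l1 p hp).1.trans h.left_subset, (l1 p hp).2⟩
      · exact ⟨(m1 p hp).1.trans h.right_subset, (m1 p hp).2⟩
    · intro v hv
      rcases Finset.mem_union.mp (h.cover hv) with hv | hv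
      · obtain ⟨p, hp, hvp⟩ := l2 v hv
        exact ⟨p, by simp [hp], hvp⟩
      · obtain ⟨p, hp, hvp⟩ := m2 v hv
        exact ⟨p, by simp [hp], hvp⟩
    · intro u hu v hv huv
      rcases h.edge u hu v hv huv with ⟨hu, hv⟩ | ⟨hu, hv⟩
      · obtain ⟨p, hp, hvp⟩ := l3 u hu v hv huv
        exact ⟨p, by simp [hp], hvp⟩
      · obtain ⟨p, hp, hvp⟩ := m3 u hu v hv huv
        exact ⟨p, by simp [hp], hvp⟩
    · have ha : √(A.card : ℝ) ^ 2 = A.card := Real.sq_sqrt (by positivity)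
      have hb : √(B.card : ℝ) ^ 2 = B.card := Real.sq_sqrt (by positivity)
      have hhalf : ∀ k : ℕ, W.card ≤ 4 * k → √(W.card : ℝ) / 2 ≤ √(k : ℝ) := by
        intro k hk
        refine Real.le_sqrt_of_sq_le ?_
        rw [div_pow, hx2]
        have : (W.card : ℝ) ≤ 4 * k := by exact_mod_cast hk
        linarith
      have hcov' : (W.card : ℝ) ≤ A.card + B.card := by exact_mod_cast hcov
      have h3' : (A.card : ℝ) + B.card ≤ W.card + 120 * Nat.sqrt W.card := by exact_mod_cast h3
      have key := division_bound hρ (Real.sqrt_nonneg (W.card : ℝ)) (hhalf A.card (by omega))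
        (hhalf B.card (by omega)) (by rw [ha, hb, hx2]; exact hcov')
        (by rw [ha, hb, hx2]; linarith)
      rw [ha, hb, hx2] at key
      have l4' := l4 (by omega)
      have m4' := m4 (by omega)
      rw [List.map_append, List.sum_append, Nat.cast_add]
      linarith
  · refine ⟨[W], by simpa using hle, ?_, ?_, by simp, fun hn => ?_⟩
    · simp
    · intro u hu v hv _
      simp [hu, hv]
    · have hx2 : √(W.card : ℝ) ^ 2 = W.card := Real.sq_sqrt (by positivity)
      have hx : √(r : ℝ) / 2 ≤ √W.card := by
        refine Real.le_sqrt_of_sq_le ?_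
        rw [div_pow, hρ2]
        have : (r : ℝ) ≤ 4 * W.card := by exact_mod_cast hn
        linarith
      have h0 : 1200 * √(W.card : ℝ) ≤ 2400 * W.card / √r := by
        rw [le_div_iff₀ (by linarith)]
        nlinarith
      simp only [List.map_cons, List.map_nil, List.sum_cons, List.sum_nil, add_zero]
      linarith

/-- An `r`-division of a finite graph without a complete minor on five vertices. -/
theorem NoK5.exists_division (hE : ∀ u v, E u v → E v u) (hK : NoK5 E) (r : ℕ)
    (hr : 2400 ^ 2 ≤ r) (W : Finset V) : ∃ (m : ℕ) (p : Fin m → Finset V),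
      (∀ i, p i ⊆ W ∧ (p i).card ≤ r) ∧ (∀ v ∈ W, ∃ i, v ∈ p i) ∧
      (∀ u ∈ W, ∀ v ∈ W, E u v → ∃ i, u ∈ p i ∧ v ∈ p i) ∧
      ((∑ i, (p i).card : ℕ) : ℝ) ≤ W.card + 2400 * W.card / √r := by
  obtain ⟨L, h1, h2, h3, h4, h5⟩ := hK.exists_division_aux hE r hr _ W le_rfl
  refine ⟨L.length, fun i => L[i], fun i => h1 _ (List.getElem_mem _), ?_, ?_, ?_⟩
  · intro v hv
    obtain ⟨p, hp, hvp⟩ := h2 v hv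
    obtain ⟨i, hi, rfl⟩ := List.getElem_of_mem hp
    exact ⟨⟨i, hi⟩, hvp⟩
  · intro u hu v hv huv
    obtain ⟨p, hp, hvp⟩ := h3 u hu v hv huv
    obtain ⟨i, hi, rfl⟩ := List.getElem_of_mem hp
    exact ⟨⟨i, hi⟩, hvp⟩
  · have : ∑ i : Fin L.length, (L[i]).card = (L.map Finset.card).sum := by
      simp
    rw [this]
    have hpos : 0 ≤ 2400 * (W.card : ℝ) / √r := by positivity
    rcases Nat.lt_or_ge r W.card with hlt | hle
    · have := h5 (by omega)
      have := Real.sqrt_nonneg (W.card : ℝ)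
      linarith
    · have : ((L.map Finset.card).sum : ℝ) ≤ W.card := by exact_mod_cast h4 hle
      linarith

theorem exchange_bound (hE : ∀ u v, E u v → E v u) (hK : NoK5 E) (b : ℕ) (hb : 2400 ^ 2 ≤ b)
    (Q O : Finset V) (hQO : Disjoint Q O)
    (hopt : ∀ X ⊆ Q, X.card ≤ b → ∀ X' ⊆ O,
      (∀ u ∈ X, ∀ v ∈ O, E u v → v ∈ X') → X.card ≤ X'.card) :
    (Q.card : ℝ) ≤ O.card + 2400 * (Q.card + O.card) / √b := by
  obtain ⟨m, p, h1, h2, h3, h4⟩ := hK.exists_division hE b hb (Q ∪ O)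
  have hcard : (Q ∪ O).card = Q.card + O.card := Finset.card_union_of_disjoint hQO
  set μ : V → ℕ := fun v => (Finset.univ.filter (fun i => v ∈ p i)).card with hμ
  have hμpos : ∀ v ∈ Q ∪ O, 1 ≤ μ v := by
    intro v hv
    obtain ⟨i, hi⟩ := h2 v hv
    exact Finset.card_pos.mpr ⟨i, by simpa using hi⟩
  have hdc : ∀ S : Finset V, ∑ i, (S.filter (· ∈ p i)).card = ∑ v ∈ S, μ v := by
    intro S
    exact (Finset.sum_card_bipartiteAbove_eq_sum_card_bipartiteBelow
      (s := S) (t := (Finset.univ : Finset (Fin m))) (fun v i => v ∈ p i)).symm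
  have hpi : ∀ i, (p i).card = ((Q ∪ O).filter (· ∈ p i)).card := by
    intro i
    congr 1
    ext v
    simp only [Finset.mem_filter]
    exact ⟨fun h => ⟨(h1 i).1 h, h⟩, fun h => h.2⟩
  have htot : ∑ i, (p i).card = ∑ v ∈ Q, μ v + ∑ v ∈ O, μ v := by
    rw [Finset.sum_congr rfl (fun i _ => hpi i), hdc, Finset.sum_union hQO]
  have hloc : ∀ i, ((Q.filter (μ · = 1)).filter (· ∈ p i)).card ≤ (O.filter (· ∈ p i)).card := by
    intro i
    refine hopt _ ((Finset.filter_subset _ _).trans (Finset.filter_subset _ _)) ?_ _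
      (Finset.filter_subset _ _) ?_
    · refine le_trans (Finset.card_le_card ?_) (h1 i).2
      exact fun v hv => (Finset.mem_filter.mp hv).2
    · intro u hu v hv huv
      simp only [Finset.mem_filter] at hu ⊢
      obtain ⟨j, hj1, hj2⟩ := h3 u (Finset.mem_union_left _ hu.1.1) v (Finset.mem_union_right _ hv) huv
      obtain ⟨k, hk⟩ := Finset.card_eq_one.mp hu.1.2
      have e1 : i = k := by
        have : i ∈ ({k} : Finset (Fin m)) := hk ▸ (by simpa using hu.2)
        simpa using this
      have e2 : j = k := by
        have : j ∈ ({k} : Finset (Fin m)) := hk ▸ (by simpa using hj1)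
        simpa using this
      exact ⟨hv, by rw [e1, ← e2]; exact hj2⟩
  have hsumloc := Finset.sum_le_sum (s := Finset.univ) (fun i _ => hloc i)
  rw [hdc, hdc] at hsumloc
  have hone : (Q.filter (μ · = 1)).card ≤ ∑ v ∈ O, μ v := by
    refine le_trans (le_of_eq ?_) hsumloc
    rw [Finset.card_eq_sum_ones]
    exact Finset.sum_congr rfl fun v hv => (Finset.mem_filter.mp hv).2.symm
  have htwo : 2 * Q.card ≤ ∑ v ∈ Q, μ v + (Q.filter (μ · = 1)).card := by
    rw [Finset.card_filter, ← Finset.sum_add_distrib, mul_comm, ← smul_eq_mul]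
    refine Finset.card_nsmul_le_sum _ _ _ fun v hv => ?_
    have := hμpos v (Finset.mem_union_left _ hv)
    split_ifs <;> omega
  have hfin : 2 * Q.card ≤ ∑ i, (p i).card := by omega
  have hfin' : (2 * Q.card : ℝ) ≤ ((∑ i, (p i).card : ℕ) : ℝ) := by exact_mod_cast hfin
  rw [hcard] at h4
  push_cast at h4 hfin'
  linarith

end Separator

theorem le_of_exchange_bound {q o c β ε : ℝ} (hq : 0 ≤ q) (ho : 0 ≤ o) (hc : 0 ≤ c) (hε : 0 < ε)
    (hε1 : ε < 1) (hβ : 9600 / ε ≤ β) (h : q ≤ o + 2400 * (q + o) / β) :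
    c + q ≤ (1 + ε) * (c + o) := by
  have hβ0 : 0 < β := lt_of_lt_of_le (by positivity) hβ
  have h1 : 2400 / β ≤ ε / 4 := by
    rw [div_le_iff₀ hε] at hβ
    rw [div_le_div_iff₀ hβ0 (by norm_num)]
    linarith
  have h2 : 2400 * (q + o) / β ≤ ε / 4 * (q + o) := by
    rw [mul_div_right_comm]
    exact mul_le_mul_of_nonneg_right h1 (by linarith)
  have h3 : q * (1 - ε / 4) ≤ o * (1 + ε / 4) := by linarith
  have h4 : o * (1 + ε / 4) ≤ (1 + ε) * o * (1 - ε / 4) := by nlinarith [mul_nonneg ho hε.le]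
  have h5 : q ≤ (1 + ε) * o := le_of_mul_le_mul_right (h3.trans h4) (by linarith)
  nlinarith [mul_nonneg hc hε.le]

section BarGraph

variable {β : Type*}

/-- The parity indicator of a proposition. -/
noncomputable def parity (p : Prop) : ZMod 2 := if p then 1 else 0

theorem parity_of {p : Prop} (h : p) : parity p = 1 := if_pos h

theorem parity_of_not {p : Prop} (h : ¬ p) : parity p = 0 := if_neg h

theorem parity_le_add_lt (x y : ℝ) : parity (x ≤ y) + parity (y < x) = 1 := by
  rcases le_or_gt x y with h | h
  · rw [parity_of h, parity_of_not h.not_gt, add_zero]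
  · rw [parity_of_not h.not_ge, parity_of h, zero_add]

variable [Fintype β]

/-- The pairing of two chains over the order induced by `h`. -/
noncomputable def pairLE (h : β → ℝ) (a b : β → ZMod 2) : ZMod 2 :=
  ∑ F, ∑ H, parity (h F ≤ h H) * (a F * b H)

/-- The pairing of two chains over the strict order induced by `h`. -/
noncomputable def pairLT (h : β → ℝ) (a b : β → ZMod 2) : ZMod 2 :=
  ∑ F, ∑ H, parity (h F < h H) * (a F * b H)

theorem pairLE_add_left (h : β → ℝ) (a a' b : β → ZMod 2) :
    pairLE h (fun F => a F + a' F) b = pairLE h a b + pairLE h a' b := by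
  simp only [pairLE, ← Finset.sum_add_distrib]
  exact Finset.sum_congr rfl fun F _ => Finset.sum_congr rfl fun H _ => by ring

theorem pairLT_add_left (h : β → ℝ) (a a' b : β → ZMod 2) :
    pairLT h (fun F => a F + a' F) b = pairLT h a b + pairLT h a' b := by
  simp only [pairLT, ← Finset.sum_add_distrib]
  exact Finset.sum_congr rfl fun F _ => Finset.sum_congr rfl fun H _ => by ring

theorem pairLE_add_pairLT (h : β → ℝ) (a b : β → ZMod 2) :
    pairLE h a b + pairLT h b a = (∑ F, a F) * ∑ H, b H := by
  rw [pairLT, Finset.sum_comm, pairLE, Finset.sum_mul_sum, ← Finset.sum_add_distrib]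
  refine Finset.sum_congr rfl fun F _ => ?_
  rw [← Finset.sum_add_distrib]
  refine Finset.sum_congr rfl fun H _ => ?_
  linear_combination (a F * b H) * parity_le_add_lt (h F) (h H)

theorem pairLE_congr {h h' : β → ℝ} {a b : β → ZMod 2}
    (hc : ∀ F H, a F ≠ 0 → b H ≠ 0 → (h F ≤ h H ↔ h' F ≤ h' H)) :
    pairLE h a b = pairLE h' a b := by
  refine Finset.sum_congr rfl fun F _ => Finset.sum_congr rfl fun H _ => ?_
  by_cases hF : a F = 0
  · simp [hF]
  by_cases hH : b H = 0
  · simp [hH]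
  rw [propext (hc F H hF hH)]

theorem sum_range_add_succ (f : ℕ → ZMod 2) (N : ℕ) :
    ∑ t ∈ Finset.range N, (f (t + 1) + f t) = f N + f 0 := by
  induction N with
  | zero => simp [CharTwo.add_self_eq_zero]
  | succ N ih =>
    rw [Finset.sum_range_succ, ih]
    linear_combination CharTwo.add_self_eq_zero (f N)

theorem crossing_formula (h : ℕ → β → ℝ) (N : ℕ) (a b da db : ℕ → β → ZMod 2)
    (ha0 : ∀ F, a 0 F = 0) (haN : ∀ F, a N F = 0)
    (hc : ∀ t F H, a (t + 1) F ≠ 0 → b (t + 1) H ≠ 0 →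
      (h t F ≤ h t H ↔ h (t + 1) F ≤ h (t + 1) H))
    (htot : ∀ t, ∑ F, (da t F + a t F + a (t + 1) F) = 0) :
    ∑ t ∈ Finset.range N, (pairLE (h t) (fun F => da t F + a t F + a (t + 1) F) (b (t + 1)) +
        pairLT (h t) (fun F => db t F + b t F + b (t + 1) F) (a t)) =
      ∑ t ∈ Finset.range N, (pairLE (h t) (da t) (b (t + 1)) + pairLT (h t) (db t) (a t) +
        (∑ F, da t F) * ∑ H, b (t + 1) H) := by
  set f : ℕ → ZMod 2 := fun t => pairLT (h t) (b t) (a t) with hf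
  have hN : f N = 0 := by simp [hf, pairLT, haN]
  have h0 : f 0 = 0 := by simp [hf, pairLT, ha0]
  have key : ∑ t ∈ Finset.range N, (f (t + 1) + f t) = 0 := by
    rw [sum_range_add_succ, hN, h0, add_zero]
  rw [← add_zero (∑ t ∈ Finset.range N, (pairLE (h t) (da t) (b (t + 1)) + _ + _)), ← key,
    ← Finset.sum_add_distrib]
  refine Finset.sum_congr rfl fun t _ => ?_
  rw [pairLE_add_left, pairLE_add_left, pairLT_add_left, pairLT_add_left,
    pairLE_congr (hc t)]
  have h1 := pairLE_add_pairLT (h t) (a t) (b (t + 1))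
  have h2 := pairLE_add_pairLT (h (t + 1)) (a (t + 1)) (b (t + 1))
  have h3 := htot t
  rw [Finset.sum_add_distrib, Finset.sum_add_distrib] at h3
  have h4 := CharTwo.add_self_eq_zero (f (t + 1))
  have h5 := CharTwo.add_self_eq_zero ((∑ F, da t F) * ∑ H, b (t + 1) H)
  simp only [hf] at h4 ⊢
  linear_combination h1 + h2 - h4 - h5 + h3 * ∑ H, b (t + 1) H

theorem no_interleaving_labels (W : Fin 5 → Fin 5 → Fin 5 → ZMod 2)
    (h : ∀ i j k l : Fin 5, i < j → k < l → i < k → j ≠ k → j ≠ l →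
      W k l i + W k l j + (W i j k + W i j l) + parity (k < j ∧ j < l) = 0) : False := by
  have two : (2 : ZMod 2) = 0 := rfl
  have e : ∀ i j k l : Fin 5, (i < j ∧ k < l ∧ i < k ∧ j ≠ k ∧ j ≠ l) →
      W k l i + W k l j + (W i j k + W i j l) + (if k < j ∧ j < l then 1 else 0) = 0 :=
    fun i j k l hh => by
      have := h i j k l hh.1 hh.2.1 hh.2.2.1 hh.2.2.2.1 hh.2.2.2.2
      unfold parity at this
      convert this
  have h1 := e 0 1 2 3 (by decide)
  have h2 := e 0 1 2 4 (by decide)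
  have h3 := e 0 1 3 4 (by decide)
  have h4 := e 0 2 1 3 (by decide)
  have h5 := e 0 2 1 4 (by decide)
  have h6 := e 0 2 3 4 (by decide)
  have h7 := e 0 3 1 2 (by decide)
  have h8 := e 0 3 1 4 (by decide)
  have h9 := e 0 3 2 4 (by decide)
  have h10 := e 0 4 1 2 (by decide)
  have h11 := e 0 4 1 3 (by decide)
  have h12 := e 0 4 2 3 (by decide)
  have h13 := e 1 2 3 4 (by decide)
  have h14 := e 1 3 2 4 (by decide)
  have h15 := e 1 4 2 3 (by decide)
  simp at h1 h2 h3 h4 h5 h6 h7 h8 h9 h10 h11 h12 h13 h14 h15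
  exact one_ne_zero (α := ZMod 2) (by linear_combination h1 + h2 + h3 + h4 + h5 + h6 + h7 +
    h8 + h9 + h10 + h11 + h12 + h13 + h14 + h15 - (W 2 3 0 + W 2 3 1 + W 0 1 2 + W 0 1 3 +
    W 2 4 0 + W 2 4 1 + W 0 1 4 + W 3 4 0 + W 3 4 1 + W 1 3 0 + W 1 3 2 + W 0 2 1 + W 0 2 3 +
    W 1 4 0 + W 1 4 2 + W 0 2 4 + W 3 4 2 + W 1 2 0 + W 1 2 3 + W 0 3 1 + W 0 3 2 + W 1 4 3 +
    W 0 3 4 + W 2 4 3 + W 1 2 4 + W 0 4 1 + W 0 4 2 + W 1 3 4 + W 0 4 3 + W 2 3 4 + 2) * two)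

/-- The bar graph: two bars are adjacent if they are consecutive at some time. -/
def BarAdj (vis : ℕ → β → Prop) (h : ℕ → β → ℝ) (F G : β) : Prop :=
  ∃ t, vis t F ∧ vis t G ∧ F ≠ G ∧
    ∀ K, vis t K → K ≠ F → K ≠ G → (h t F < h t K ↔ h t G < h t K)

/-- The vertical part of a chain joining `p` to `q` with horizontal part `a`. -/
noncomputable def vertPart (p q : ℕ × β) (a : ℕ → β → ZMod 2) (t : ℕ) (F : β) : ZMod 2 :=
  (parity (p = (t, F)) + parity (q = (t, F))) + a t F + a (t + 1) F

/-- A chain inside `U` from `p` to `q`. -/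
structure BarChain (vis : ℕ → β → Prop) (h : ℕ → β → ℝ) (U : Set β) (p q : ℕ × β)
    (a : ℕ → β → ZMod 2) : Prop where
  zero : ∀ F, a 0 F = 0
  supp : ∀ t F, a (t + 1) F ≠ 0 → F ∈ U ∧ vis t F ∧ vis (t + 1) F
  total : ∀ t, ∑ F, vertPart p q a t F = 0
  le : ∀ t K, vis t K → K ∉ U → ∑ F, parity (h t F ≤ h t K) * vertPart p q a t F = 0
  lt : ∀ t K, vis t K → K ∉ U → ∑ F, parity (h t F < h t K) * vertPart p q a t F = 0

theorem BarChain.trans {vis : ℕ → β → Prop} {h : ℕ → β → ℝ} {U : Set β} {p q r : ℕ × β}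
    {a b : ℕ → β → ZMod 2} (ha : BarChain vis h U p q a) (hb : BarChain vis h U q r b) :
    BarChain vis h U p r (fun t F => a t F + b t F) := by
  have key : ∀ t F, vertPart p r (fun t F => a t F + b t F) t F =
      vertPart p q a t F + vertPart q r b t F := by
    intro t F
    simp only [vertPart]
    linear_combination - CharTwo.add_self_eq_zero (parity (q = (t, F)))
  refine ⟨fun F => by simp [ha.zero, hb.zero], fun t F hF => ?_, fun t => ?_, fun t K hK hKU => ?_,
    fun t K hK hKU => ?_⟩
  · by_cases h1 : a (t + 1) F = 0
    · exact hb.supp t F (by simpa [h1] using hF)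
    · exact ha.supp t F h1
  · simp only [key, Finset.sum_add_distrib, ha.total, hb.total, add_zero]
  · simp only [key, mul_add, Finset.sum_add_distrib, ha.le t K hK hKU, hb.le t K hK hKU, add_zero]
  · simp only [key, mul_add, Finset.sum_add_distrib, ha.lt t K hK hKU, hb.lt t K hK hKU, add_zero]

theorem BarChain.symm {vis : ℕ → β → Prop} {h : ℕ → β → ℝ} {U : Set β} {p q : ℕ × β}
    {a : ℕ → β → ZMod 2} (ha : BarChain vis h U p q a) : BarChain vis h U q p a := by
  have key : vertPart q p a = vertPart p q a := by
    funext t F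
    simp only [vertPart]
    ring
  exact ⟨ha.zero, ha.supp, key ▸ ha.total, key ▸ ha.le, key ▸ ha.lt⟩

theorem BarChain.horizontal {vis : ℕ → β → Prop} {h : ℕ → β → ℝ} {U : Set β} {t : ℕ} {F : β}
    (hF : F ∈ U) (h1 : vis t F) (h2 : vis (t + 1) F) :
    BarChain vis h U (t, F) (t + 1, F) (fun s G => parity ((t + 1, F) = (s, G))) := by
  have key : ∀ s G, vertPart (t, F) (t + 1, F) (fun s G => parity ((t + 1, F) = (s, G))) s G
      = 0 := by
    intro s G
    simp only [vertPart]
    have : ((t + 1, F) = (s + 1, G)) = ((t, F) = (s, G)) := by simp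
    rw [this]
    linear_combination CharTwo.add_self_eq_zero (parity ((t, F) = (s, G))) +
      CharTwo.add_self_eq_zero (parity ((t + 1, F) = (s, G)))
  refine ⟨fun G => parity_of_not (by simp), fun s G hG => ?_, ?_, ?_, ?_⟩
  · have : (t + 1, F) = (s + 1, G) := by
      by_contra hne
      exact hG (parity_of_not hne)
    simp only [Prod.mk.injEq, add_left_inj] at this
    obtain ⟨rfl, rfl⟩ := this
    exact ⟨hF, h1, h2⟩
  all_goals intros; simp only [key, mul_zero, Finset.sum_const_zero]

theorem sum_mul_parity_eq (f : β → ZMod 2) (F : β) : ∑ G, f G * parity (F = G) = f F := by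
  rw [Finset.sum_eq_single F]
  · rw [parity_of rfl, mul_one]
  · intro G _ hG
    rw [parity_of_not (Ne.symm hG), mul_zero]
  · simp

theorem BarChain.vertical {vis : ℕ → β → Prop} {h : ℕ → β → ℝ} {U : Set β} {t : ℕ} {F G : β}
    (hinj : ∀ t F G, vis t F → vis t G → h t F = h t G → F = G)
    (hF : F ∈ U) (hG : G ∈ U) (h1 : vis t F) (h2 : vis t G)
    (h3 : ∀ K, vis t K → K ≠ F → K ≠ G → (h t F < h t K ↔ h t G < h t K)) :
    BarChain vis h U (t, F) (t, G) (fun _ _ => 0) := by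
  have key : ∀ f : β → ZMod 2, ∀ s,
      ∑ H, f H * vertPart (t, F) (t, G) (fun _ _ => 0) s H = parity (t = s) * (f F + f G) := by
    intro f s
    have : ∀ H, f H * vertPart (t, F) (t, G) (fun _ _ => 0) s H =
        parity (t = s) * (f H * parity (F = H) + f H * parity (G = H)) := by
      intro H
      by_cases hts : t = s <;> simp [vertPart, parity, hts, mul_add]
    rw [Finset.sum_congr rfl fun H _ => this H, ← Finset.mul_sum, Finset.sum_add_distrib,
      sum_mul_parity_eq, sum_mul_parity_eq]
  have hne : ∀ K, vis t K → K ∉ U → K ≠ F ∧ K ≠ G :=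
    fun K _ hKU => ⟨fun e => hKU (e ▸ hF), fun e => hKU (e ▸ hG)⟩
  refine ⟨fun _ => rfl, fun _ _ h => absurd rfl h, fun s => ?_, fun s K hK hKU => ?_,
    fun s K hK hKU => ?_⟩
  · have := key (fun _ => 1) s
    simpa [CharTwo.add_self_eq_zero] using this
  · rw [key (fun H => parity (h s H ≤ h s K)) s]
    by_cases hts : t = s
    · subst hts
      obtain ⟨hKF, hKG⟩ := hne K hK hKU
      have e1 : h t F ≤ h t K ↔ h t F < h t K :=
        ⟨fun hle => lt_of_le_of_ne hle fun e => hKF (hinj t _ _ h1 hK e).symm, le_of_lt⟩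
      have e2 : h t G ≤ h t K ↔ h t G < h t K :=
        ⟨fun hle => lt_of_le_of_ne hle fun e => hKG (hinj t _ _ h2 hK e).symm, le_of_lt⟩
      rw [propext e1, propext e2, propext (h3 K hK hKF hKG), CharTwo.add_self_eq_zero, mul_zero]
    · rw [parity_of_not hts, zero_mul]
  · rw [key (fun H => parity (h s H < h s K)) s]
    by_cases hts : t = s
    · subst hts
      obtain ⟨hKF, hKG⟩ := hne K hK hKU
      rw [propext (h3 K hK hKF hKG), CharTwo.add_self_eq_zero, mul_zero]
    · rw [parity_of_not hts, zero_mul]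

theorem exists_barChain {vis : ℕ → β → Prop} {h : ℕ → β → ℝ}
    (hinj : ∀ t F G, vis t F → vis t G → h t F = h t G → F = G)
    (hconv : ∀ s t u F, s ≤ t → t ≤ u → vis s F → vis u F → vis t F) {U : Set β}
    (hU : ConnSet (BarAdj vis h) U) {t : ℕ} {F : β} (hF : F ∈ U) (htF : vis t F) :
    ∀ G ∈ U, ∀ s, vis s G → ∃ a, BarChain vis h U (t, F) (s, G) a := by
  have hnil : ∀ s G, G ∈ U → vis s G → BarChain vis h U (s, G) (s, G) (fun _ _ => 0) :=
    fun s G hG hsG => BarChain.vertical hinj hG hG hsG hsG fun _ _ _ _ => Iff.rfl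
  have hmove : ∀ G ∈ U, ∀ d s, vis s G → vis (s + d) G →
      ∃ a, BarChain vis h U (s, G) (s + d, G) a := by
    intro G hG d
    induction d with
    | zero => exact fun s hs _ => ⟨_, hnil s G hG hs⟩
    | succ d ih =>
      intro s hs hs'
      have hmid := hconv s (s + d) (s + (d + 1)) G (by omega) (by omega) hs hs'
      obtain ⟨a, ha⟩ := ih s hs hmid
      exact ⟨_, ha.trans (BarChain.horizontal hG hmid hs')⟩
  have hmove' : ∀ G ∈ U, ∀ s s', vis s G → vis s' G → ∃ a, BarChain vis h U (s, G) (s', G) a := by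
    intro G hG s s' hs hs'
    rcases le_total s s' with hss | hss
    · obtain ⟨d, rfl⟩ := Nat.exists_eq_add_of_le hss
      exact hmove G hG d s hs hs'
    · obtain ⟨d, rfl⟩ := Nat.exists_eq_add_of_le hss
      obtain ⟨a, ha⟩ := hmove G hG d s' hs' hs
      exact ⟨a, ha.symm⟩
  set S : Set β := {G | G ∈ U ∧ ∀ s, vis s G → ∃ a, BarChain vis h U (t, F) (s, G) a} with hS
  have hSU : S = U := by
    refine hU.2 S (fun G hG => hG.1) ⟨F, hF, fun s hs => hmove' F hF t s htF hs⟩ ?_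
    rintro G ⟨hG, hG'⟩ G' hGU' ⟨r, hr, hr', hne, hK⟩
    refine ⟨hGU', fun s hs => ?_⟩
    obtain ⟨a, ha⟩ := hG' r hr
    obtain ⟨b, hb⟩ := hmove' G' hGU' r s hr' hs
    exact ⟨_, (ha.trans (BarChain.vertical hinj hG hGU' hr hr' hK)).trans hb⟩
  intro G hG
  exact (hSU ▸ hG : G ∈ S).2

theorem NoK5.mono {V : Type*} {E E' : V → V → Prop} (h : NoK5 E) (hE : ∀ u v, E' u v → E u v) :
    NoK5 E' := by
  rintro ⟨C, h1, h2, h3⟩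
  refine h ⟨C, fun i => ⟨(h1 i).1, fun S hS hn hcl => (h1 i).2 S hS hn
    fun u hu v hv huv => hcl u hu v hv (hE u v huv)⟩, h2, fun i j hij => ?_⟩
  obtain ⟨u, hu, v, hv, huv⟩ := h3 i j hij
  exact ⟨u, hu, v, hv, hE u v huv⟩

theorem false_of_bar_model {vis : ℕ → β → Prop} {h : ℕ → β → ℝ} {N : ℕ}
    (hN : ∀ t F, vis t F → t < N)
    (hinj : ∀ t F G, vis t F → vis t G → h t F = h t G → F = G)
    (hcons : ∀ t F G, vis t F → vis t G → vis (t + 1) F → vis (t + 1) G →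
      (h t F ≤ h t G ↔ h (t + 1) F ≤ h (t + 1) G))
    (hconv : ∀ s t u F, s ≤ t → t ≤ u → vis s F → vis u F → vis t F)
    (hE : ∀ u v, BarAdj vis h u v → BarAdj vis h v u)
    {C : Fin 5 → Set β} (hC : ∀ i, ConnSet (BarAdj vis h) (C i))
    (hdisj : ∀ i j, i ≠ j → Disjoint (C i) (C j))
    (htouch : ∀ i j, i ≠ j → ∃ u ∈ C i, ∃ v ∈ C j, BarAdj vis h u v)
    {τ : Fin 5 → ℕ} (hτ : StrictMono τ) {r : Fin 5 → β} (hr : ∀ i, r i ∈ C i)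
    (hvr : ∀ i, vis (τ i) (r i)) : False := by
  have hchain : ∀ i j, i < j → ∃ a, BarChain vis h (C i ∪ C j) (τ i, r i) (τ j, r j) a := by
    intro i j hij
    obtain ⟨u, hu, v, hv, huv⟩ := htouch i j hij.ne
    exact exists_barChain hinj hconv ((hC i).union hE (hC j) hu hv (Or.inr huv)) (Or.inl (hr i))
      (hvr i) _ (Or.inr (hr j)) _ (hvr j)
  have hchain' : ∀ i j, ∃ a, i < j → BarChain vis h (C i ∪ C j) (τ i, r i) (τ j, r j) a := by
    intro i j
    by_cases hij : i < j
    · obtain ⟨a, ha⟩ := hchain i j hij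
      exact ⟨a, fun _ => ha⟩
    · exact ⟨fun _ _ => 0, fun hij' => absurd hij' hij⟩
  choose a ha using hchain'
  have hinter : ∀ i j k, k ≠ i → k ≠ j → ∀ F ∈ C k, F ∉ C i ∪ C j := by
    rintro i j k hki hkj F hF (h1 | h1)
    · exact Set.disjoint_left.mp (hdisj k i hki) hF h1
    · exact Set.disjoint_left.mp (hdisj k j hkj) hF h1
  have hvis : ∀ i j, i < j → ∀ t F, a i j t F ≠ 0 → F ∈ C i ∪ C j ∧ vis t F := by
    intro i j hij t F hne
    rcases t with _ | t
    · exact absurd ((ha i j hij).zero F) hne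
    · exact ⟨((ha i j hij).supp t F hne).1, ((ha i j hij).supp t F hne).2.2⟩
  set W : Fin 5 → Fin 5 → Fin 5 → ZMod 2 :=
    fun i j k => ∑ H, parity (h (τ k) (r k) < h (τ k) H) * a i j (τ k) H with hW
  -- The number of horizontal parts at each time.
  have hmass : ∀ i j, i < j → ∀ t, ∑ F, a i j t F = parity (τ i < t ∧ t ≤ τ j) := by
    intro i j hij t
    have hij' := hτ hij
    induction t with
    | zero => simp [(ha i j hij).zero, parity_of_not]
    | succ t ih =>
      have h1 := (ha i j hij).total t
      simp only [vertPart, Finset.sum_add_distrib, ih] at h1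
      have h2 : ∀ k, ∑ F, parity ((τ k, r k) = (t, F)) = parity (τ k = t) := by
        intro k
        have := sum_mul_parity_eq (fun _ => parity (τ k = t)) (r k)
        rw [← this]
        refine Finset.sum_congr rfl fun F _ => ?_
        by_cases e1 : τ k = t <;> by_cases e2 : r k = F <;> simp [parity, e1, e2]
      rw [h2, h2] at h1
      have h3 : parity (τ i = t) + parity (τ j = t) + parity (τ i < t ∧ t ≤ τ j) =
          parity (τ i < t + 1 ∧ t + 1 ≤ τ j) := by
        have two : (1 + 1 : ZMod 2) = 0 := rfl
        simp only [parity]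
        split_ifs <;> first | omega | simp [two]
      rw [h3] at h1
      linear_combination h1 - CharTwo.add_self_eq_zero (parity (τ i < t + 1 ∧ t + 1 ≤ τ j))
  -- The two winding numbers around the root of a foreign cluster agree.
  have hwind : ∀ i j k, i < j → k ≠ i → k ≠ j →
      ∑ H, parity (h (τ k) (r k) ≤ h (τ k) H) * a i j (τ k + 1) H = W i j k := by
    intro i j k hij hki hkj
    have hout := hinter i j k hki hkj (r k) (hr k)
    have h1 := (ha i j hij).total (τ k)
    have h2 := (ha i j hij).le (τ k) (r k) (hvr k) hout
    have hv : ∀ F, vertPart (τ i, r i) (τ j, r j) (a i j) (τ k) F =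
        a i j (τ k) F + a i j (τ k + 1) F := by
      intro F
      have e1 : (τ i, r i) ≠ (τ k, F) := fun e => hki (hτ.injective (Prod.ext_iff.mp e).1).symm
      have e2 : (τ j, r j) ≠ (τ k, F) := fun e => hkj (hτ.injective (Prod.ext_iff.mp e).1).symm
      rw [vertPart, parity_of_not e1, parity_of_not e2, add_zero, zero_add]
    simp only [hv] at h1 h2
    have h3 : ∑ H, parity (h (τ k) (r k) < h (τ k) H) * (a i j (τ k) H + a i j (τ k + 1) H) = 0 := by
      rw [← h1, ← sub_eq_zero, ← Finset.sum_sub_distrib, ← neg_eq_zero, ← Finset.sum_neg_distrib,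
        ← h2]
      refine Finset.sum_congr rfl fun F _ => ?_
      have := parity_le_add_lt (h (τ k) F) (h (τ k) (r k))
      linear_combination (- (a i j (τ k) F + a i j (τ k + 1) F)) * this
    simp only [mul_add, Finset.sum_add_distrib] at h3
    have h4 : ∑ H, parity (h (τ k) (r k) ≤ h (τ k) H) * a i j (τ k + 1) H =
        ∑ H, parity (h (τ k) (r k) < h (τ k) H) * a i j (τ k + 1) H := by
      refine Finset.sum_congr rfl fun H _ => ?_
      by_cases h0 : a i j (τ k + 1) H = 0
      · simp [h0]
      have h5 := (ha i j hij).supp _ _ h0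
      have h6 : h (τ k) (r k) ≤ h (τ k) H ↔ h (τ k) (r k) < h (τ k) H := by
        refine ⟨fun hle => lt_of_le_of_ne hle fun e => hout ?_, le_of_lt⟩
        rw [hinj _ _ _ (hvr k) h5.2.1 e]
        exact h5.1
      rw [propext h6]
    rw [h4]
    simp only [hW]
    linear_combination h3 - CharTwo.add_self_eq_zero
      (∑ H, parity (h (τ k) (r k) < h (τ k) H) * a i j (τ k) H)
  refine no_interleaving_labels W fun i j k l hij hkl hik hjk hjl => ?_
  have hil : i ≠ l := (hik.trans hkl).ne
  have hform := crossing_formula h N (a i j) (a k l)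
    (fun t F => parity ((τ i, r i) = (t, F)) + parity ((τ j, r j) = (t, F)))
    (fun t F => parity ((τ k, r k) = (t, F)) + parity ((τ l, r l) = (t, F)))
    (ha i j hij).zero ?_ ?_ (ha i j hij).total
  rotate_left
  · intro F
    by_contra hne
    exact lt_irrefl _ (hN _ _ (hvis i j hij N F hne).2)
  · intro t F H hF hH
    have h1 := (ha i j hij).supp t F hF
    have h2 := (ha k l hkl).supp t H hH
    exact hcons t F H h1.2.1 h2.2.1 h1.2.2 h2.2.2
  have hfar : ∀ F, F ∈ C k ∪ C l → F ∉ C i ∪ C j := by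
    rintro F (hF | hF)
    · exact hinter i j k hik.ne' hjk.symm F hF
    · exact hinter i j l hil.symm hjl.symm F hF
  have hleft : ∀ t, pairLE (h t) (vertPart (τ i, r i) (τ j, r j) (a i j) t) (a k l (t + 1)) +
      pairLT (h t) (vertPart (τ k, r k) (τ l, r l) (a k l) t) (a i j t) = 0 := by
    intro t
    have e1 : pairLE (h t) (vertPart (τ i, r i) (τ j, r j) (a i j) t) (a k l (t + 1)) = 0 := by
      rw [pairLE, Finset.sum_comm]
      refine Finset.sum_eq_zero fun H _ => ?_
      by_cases h0 : a k l (t + 1) H = 0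
      · simp [h0]
      have h1 := (ha k l hkl).supp t H h0
      have h2 := (ha i j hij).le t H h1.2.1 (hfar H h1.1)
      simp only [← mul_assoc, ← Finset.sum_mul]
      rw [h2, zero_mul]
    have e2 : pairLT (h t) (vertPart (τ k, r k) (τ l, r l) (a k l) t) (a i j t) = 0 := by
      rw [pairLT, Finset.sum_comm]
      refine Finset.sum_eq_zero fun H _ => ?_
      by_cases h0 : a i j t H = 0
      · simp [h0]
      have h1 := hvis i j hij t H h0
      have h2 := (ha k l hkl).lt t H h1.2 (fun hH => hfar H hH h1.1)
      simp only [← mul_assoc, ← Finset.sum_mul]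
      rw [h2, zero_mul]
    rw [e1, e2, add_zero]
  have hdelta : ∀ (f : ℕ → β → ZMod 2) (m : Fin 5),
      ∑ t ∈ Finset.range N, ∑ F, parity ((τ m, r m) = (t, F)) * f t F = f (τ m) (r m) := by
    intro f m
    rw [Finset.sum_eq_single (τ m)]
    · rw [← sum_mul_parity_eq (f (τ m)) (r m)]
      refine Finset.sum_congr rfl fun F _ => ?_
      rw [mul_comm]
      simp
    · intro t _ ht
      refine Finset.sum_eq_zero fun F _ => ?_
      rw [parity_of_not (fun e => ht (Prod.ext_iff.mp e).1.symm), zero_mul]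
    · exact fun hm => absurd (Finset.mem_range.mpr (hN _ _ (hvr m))) hm
  have hzero : ∑ t ∈ Finset.range N,
      (pairLE (h t) (fun F => parity ((τ i, r i) = (t, F)) + parity ((τ j, r j) = (t, F)) +
          a i j t F + a i j (t + 1) F) (a k l (t + 1)) +
        pairLT (h t) (fun F => parity ((τ k, r k) = (t, F)) + parity ((τ l, r l) = (t, F)) +
          a k l t F + a k l (t + 1) F) (a i j t)) = 0 :=
    Finset.sum_eq_zero fun t _ => hleft t
  rw [hzero] at hform
  have hT1 : ∀ (m : Fin 5), ∑ t ∈ Finset.range N,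
      pairLE (h t) (fun F => parity ((τ m, r m) = (t, F))) (a k l (t + 1)) =
      ∑ H, parity (h (τ m) (r m) ≤ h (τ m) H) * a k l (τ m + 1) H := by
    intro m
    rw [← hdelta (fun t F => ∑ H, parity (h t F ≤ h t H) * a k l (t + 1) H) m]
    refine Finset.sum_congr rfl fun t _ => Finset.sum_congr rfl fun F _ => ?_
    rw [Finset.mul_sum]
    exact Finset.sum_congr rfl fun H _ => by ring
  have hT2 : ∀ (m : Fin 5), ∑ t ∈ Finset.range N,
      pairLT (h t) (fun F => parity ((τ m, r m) = (t, F))) (a i j t) = W i j m := by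
    intro m
    change _ = ∑ H, parity (h (τ m) (r m) < h (τ m) H) * a i j (τ m) H
    rw [← hdelta (fun t F => ∑ H, parity (h t F < h t H) * a i j t H) m]
    refine Finset.sum_congr rfl fun t _ => Finset.sum_congr rfl fun F _ => ?_
    rw [Finset.mul_sum]
    exact Finset.sum_congr rfl fun H _ => by ring
  have hT3 : ∀ (m : Fin 5), ∑ t ∈ Finset.range N, (∑ F, parity ((τ m, r m) = (t, F))) *
      ∑ H, a k l (t + 1) H = parity (τ k < τ m + 1 ∧ τ m + 1 ≤ τ l) := by
    intro m
    rw [← hmass k l hkl, ← hdelta (fun t _ => ∑ H, a k l (t + 1) H) m]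
    exact Finset.sum_congr rfl fun t _ => by rw [Finset.sum_mul]
  have hk : parity (k < j ∧ j < l) = parity (τ k < τ j + 1 ∧ τ j + 1 ≤ τ l) := by
    have e1 : k < j ↔ τ k < τ j + 1 := by
      rw [Nat.lt_succ_iff, hτ.le_iff_le]
      exact ⟨le_of_lt, fun hle => lt_of_le_of_ne hle hjk.symm⟩
    have e2 : j < l ↔ τ j + 1 ≤ τ l := by rw [Nat.succ_le_iff, hτ.lt_iff_lt]
    rw [propext e1, propext e2]
  have hi0 : parity (τ k < τ i + 1 ∧ τ i + 1 ≤ τ l) = 0 := by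
    refine parity_of_not fun hcon => ?_
    have := hτ hik
    omega
  simp only [pairLE_add_left, pairLT_add_left, Finset.sum_add_distrib, add_mul, hT1, hT2, hT3]
    at hform
  rw [hwind k l i hkl hik.ne hil, hwind k l j hkl hjk hjl, hi0, ← hk] at hform
  rw [hform]
  ring

theorem noK5_barAdj {vis : ℕ → β → Prop} {h : ℕ → β → ℝ} {N : ℕ}
    (hN : ∀ t F, vis t F → t < N)
    (hinj : ∀ t F G, vis t F → vis t G → h t F = h t G → F = G)
    (hcons : ∀ t F G, vis t F → vis t G → vis (t + 1) F → vis (t + 1) G →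
      (h t F ≤ h t G ↔ h (t + 1) F ≤ h (t + 1) G))
    (hconv : ∀ s t u F, s ≤ t → t ≤ u → vis s F → vis u F → vis t F) :
    NoK5 (BarAdj vis h) := by
  have hmono : ∀ F G, BarAdj vis h F G → BarAdj (fun t => vis (t / 5)) (fun t => h (t / 5)) F G := by
    rintro F G ⟨t, ht⟩
    refine ⟨5 * t, ?_⟩
    have e : 5 * t / 5 = t := by omega
    simpa only [e] using ht
  refine NoK5.mono ?_ hmono
  rintro ⟨C, hC, hdisj, htouch⟩
  have hroot : ∀ i, ∃ t, ∃ F ∈ C i, vis t F := by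
    intro i
    obtain ⟨j, hj⟩ := exists_ne i
    obtain ⟨u, hu, v, hv, t, ht, -⟩ := htouch i j hj.symm
    exact ⟨t / 5, u, hu, ht⟩
  choose t r hr hvr using hroot
  have hσ : Monotone (t ∘ Tuple.sort t) := Tuple.monotone_sort t
  refine false_of_bar_model (N := 5 * N) (C := C ∘ Tuple.sort t)
    (τ := fun i => 5 * t (Tuple.sort t i) + i) (r := r ∘ Tuple.sort t) ?_ ?_ ?_ ?_ ?_
    (fun i => hC _) (fun i j hij => hdisj _ _ ((Tuple.sort t).injective.ne hij))
    (fun i j hij => htouch _ _ ((Tuple.sort t).injective.ne hij)) ?_ (fun i => hr _) ?_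
  · intro s F hs
    have := hN _ _ hs
    omega
  · exact fun s => hinj (s / 5)
  · intro s F G h1 h2 h3 h4
    rcases (by omega : (s + 1) / 5 = s / 5 ∨ (s + 1) / 5 = s / 5 + 1) with e | e
    · rw [e]
    · rw [e] at h3 h4 ⊢
      exact hcons _ F G h1 h2 h3 h4
  · exact fun s s' u F h1 h2 => hconv _ _ _ F (Nat.div_le_div_right h1) (Nat.div_le_div_right h2)
  · rintro u v ⟨s, h1, h2, h3, h4⟩
    exact ⟨s, h2, h1, h3.symm, fun K hK hKv hKu => (h4 K hK hKu hKv).symm⟩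
  · intro i j hij
    have h1 : t (Tuple.sort t i) ≤ t (Tuple.sort t j) := hσ hij.le
    have h2 : (i : ℕ) < j := hij
    dsimp only
    omega
  · intro i
    have : (5 * t (Tuple.sort t i) + (i : ℕ)) / 5 = t (Tuple.sort t i) := by
      have := i.2
      omega
    dsimp only [Function.comp]
    rw [this]
    exact hvr _
end BarGraph

/-- The graph obtained from `E` by joining each vertex `f` of `H` to `X f` and `Y f`. -/
def Attach {V : Type*} (E : V → V → Prop) (H : Set V) (X Y : V → V) (u v : V) : Prop :=
  E u v ∨ (u ∈ H ∧ (v = X u ∨ v = Y u)) ∨ (v ∈ H ∧ (u = X v ∨ u = Y v))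

theorem Attach.symm {V : Type*} {E : V → V → Prop} (hE : ∀ u v, E u v → E v u) {H : Set V}
    {X Y : V → V} : ∀ u v, Attach E H X Y u v → Attach E H X Y v u := by
  rintro u v (h | h | h)
  · exact Or.inl (hE _ _ h)
  · exact Or.inr (Or.inr h)
  · exact Or.inr (Or.inl h)

/-- Attaching vertices to vertices or edges of a `K₅`-minor-free graph creates no `K₅`-minor. -/
theorem NoK5.attach {V : Type*} {E : V → V → Prop} (hE : ∀ u v, E u v → E v u) (hK : NoK5 E)
    {H : Set V} {X Y : V → V} (hiso : ∀ u ∈ H, ∀ v, ¬ E u v)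
    (hX : ∀ u ∈ H, X u ∉ H) (hY : ∀ u ∈ H, Y u ∉ H)
    (hXY : ∀ u ∈ H, X u = Y u ∨ E (X u) (Y u)) : NoK5 (Attach E H X Y) := by
  rintro ⟨C, hC, hdisj, htouch⟩
  have hnb : ∀ u ∈ H, ∀ v, Attach E H X Y u v → v = X u ∨ v = Y u := by
    rintro u hu v (h | h | ⟨h1, h2⟩)
    · exact absurd h (hiso u hu v)
    · exact h.2
    · rcases h2 with rfl | rfl
      · exact absurd hu (hX v h1)
      · exact absurd hu (hY v h1)
  have hout : ∀ u ∈ H, ∀ v, Attach E H X Y u v → v ∉ H := by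
    intro u hu v huv
    rcases hnb u hu v huv with rfl | rfl
    · exact hX u hu
    · exact hY u hu
  -- a vertex of `H` in a cluster has a neighbour in that cluster
  have hin : ∀ i, ∀ u ∈ C i, u ∈ H → ∃ v ∈ C i, Attach E H X Y u v := by
    intro i u hu huH
    by_contra! hno
    have hCi : ({u} : Set V) = C i := by
      refine (hC i).2 {u} (singleton_subset_iff.mpr hu) (singleton_nonempty u) ?_
      rintro w rfl v hv hwv
      exact absurd hwv (hno v hv)
    have hch : ∀ j, ∃ v, j ≠ i → v ∈ C j ∧ (v = X u ∨ v = Y u) := by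
      intro j
      by_cases hj : j = i
      · exact ⟨u, fun h => absurd hj h⟩
      obtain ⟨w, hw, v, hv, hwv⟩ := htouch i j (Ne.symm hj)
      rw [← hCi] at hw
      obtain rfl : w = u := hw
      exact ⟨v, fun _ => ⟨hv, hnb w huH v hwv⟩⟩
    choose f hf using hch
    have key : ∀ j k, j ≠ i → k ≠ i → j ≠ k → f j ≠ f k := fun j k hj hk hjk e =>
      (hdisj j k hjk).le_bot ⟨(hf j hj).1, e ▸ (hf k hk).1⟩
    obtain ⟨j, k, l, hj, hk, hl, hjk, hjl, hkl⟩ : ∃ j k l : Fin 5, j ≠ i ∧ k ≠ i ∧ l ≠ i ∧ j ≠ k ∧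
        j ≠ l ∧ k ≠ l := by
      clear hno hCi hf key hu
      revert i
      decide
    have h1 := key j k hj hk hjk
    have h2 := key j l hj hl hjl
    have h3 := key k l hk hl hkl
    rcases (hf j hj).2 with e1 | e1 <;> rcases (hf k hk).2 with e2 | e2 <;>
      rcases (hf l hl).2 with e3 | e3 <;> rw [e1, e2] at h1 <;> rw [e1, e3] at h2 <;>
      rw [e2, e3] at h3 <;> first | exact h1 rfl | exact h2 rfl | exact h3 rfl
  have hbr : ∀ u ∈ H, ∀ v w, Attach E H X Y u v → Attach E H X Y u w → v = w ∨ E v w := by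
    intro u hu v w hv hw
    rcases hnb u hu v hv with rfl | rfl <;> rcases hnb u hu w hw with rfl | rfl
    · exact Or.inl rfl
    · exact hXY u hu
    · exact (hXY u hu).imp Eq.symm (hE _ _)
    · exact Or.inl rfl
  refine hK ⟨fun i => C i \ H, fun i => ⟨?_, ?_⟩, fun i j hij =>
    (hdisj i j hij).mono sdiff_subset sdiff_subset, ?_⟩
  · obtain ⟨u, hu⟩ := (hC i).1
    by_cases huH : u ∈ H
    · obtain ⟨v, hv, huv⟩ := hin i u hu huH
      exact ⟨v, hv, hout u huH v huv⟩
    · exact ⟨u, hu, huH⟩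
  · intro S hS hSne hcl
    have hS' : S ∪ {u | u ∈ C i ∧ u ∈ H ∧ ∃ v ∈ S, Attach E H X Y u v} = C i := by
      refine (hC i).2 _ ?_ (hSne.mono subset_union_left) ?_
      · rintro u (hu | hu)
        · exact (hS hu).1
        · exact hu.1
      · rintro u hu v hv huv
        by_cases hvH : v ∈ H
        · refine Or.inr ⟨hv, hvH, ?_⟩
          rcases hu with hu | ⟨-, huH, -⟩
          · exact ⟨u, hu, Attach.symm hE _ _ huv⟩
          · exact absurd hvH (hout u huH v huv)
        · refine Or.inl ?_
          rcases hu with hu | ⟨-, huH, w, hw, huw⟩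
          · refine hcl u hu v ⟨hv, hvH⟩ ?_
            rcases huv with h | h | h
            · exact h
            · exact absurd h.1 (hS hu).2
            · exact absurd h.1 hvH
          · rcases hbr u huH w v huw huv with rfl | h
            · exact hw
            · exact hcl w hw v ⟨hv, hvH⟩ h
    refine Subset.antisymm hS fun u hu => ?_
    have : u ∈ S ∪ {u | u ∈ C i ∧ u ∈ H ∧ ∃ v ∈ S, Attach E H X Y u v} := hS'.symm ▸ hu.1
    rcases this with h | h
    · exact h
    · exact absurd h.2.1 hu.2
  · have half : ∀ i j, i ≠ j → ∀ u ∈ C i, ∀ v ∈ C j, u ∈ H → Attach E H X Y u v →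
        ∃ u ∈ C i \ H, ∃ v ∈ C j \ H, E u v := by
      intro i j hij u hu v hv huH huv
      obtain ⟨w, hw, huw⟩ := hin i u hu huH
      refine ⟨w, ⟨hw, hout u huH w huw⟩, v, ⟨hv, hout u huH v huv⟩, ?_⟩
      rcases hbr u huH w v huw huv with rfl | h
      · exact ((hdisj i j hij).le_bot ⟨hw, hv⟩).elim
      · exact h
    intro i j hij
    obtain ⟨u, hu, v, hv, huv⟩ := htouch i j hij
    by_cases huH : u ∈ H
    · exact half i j hij u hu v hv huH huv
    by_cases hvH : v ∈ H
    · obtain ⟨w, hw, x, hx, h⟩ := half j i hij.symm v hv u hu hvH (Attach.symm hE _ _ huv)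
      exact ⟨x, hx, w, hw, hE _ _ h⟩
    · refine ⟨u, ⟨hu, huH⟩, v, ⟨hv, hvH⟩, ?_⟩
      rcases huv with h | h | h
      · exact h
      · exact absurd h.1 huH
      · exact absurd h.1 hvH

section Sweep

variable {β : Type*}

/-- A state of a sweep: the orders of the lower and of the upper ends of a family of intervals. -/
structure SweepState (β : Type*) where
  /-- The keys of the lower ends. -/
  lo : β → ℝ
  /-- The keys of the upper ends. -/
  hi : β → ℝ
  lo_inj : Function.Injective lo
  hi_inj : Function.Injective hi

namespace SweepState

/-- The interval of `G` contains that of `F`. -/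
def Cov (σ : SweepState β) (G F : β) : Prop := σ.lo G < σ.lo F ∧ σ.hi F < σ.hi G

/-- Both ends of `F` lie below those of `G`. -/
def Below (σ : SweepState β) (F G : β) : Prop := σ.lo F < σ.lo G ∧ σ.hi F < σ.hi G

/-- In passing from `σ` to `τ` only the lower ends or only the upper ends of one pair switch. -/
def Elementary (σ τ : SweepState β) : Prop :=
  ∃ x y, (∀ F G, ¬ (F = x ∧ G = y) → ¬ (F = y ∧ G = x) →
      (σ.lo F < σ.lo G ↔ τ.lo F < τ.lo G) ∧ (σ.hi F < σ.hi G ↔ τ.hi F < τ.hi G)) ∧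
    ((∀ F G, σ.lo F < σ.lo G ↔ τ.lo F < τ.lo G) ∨ ∀ F G, σ.hi F < σ.hi G ↔ τ.hi F < τ.hi G)

/-- Each comparison in `ρ` is made as in `σ` or as in `τ`. -/
def Between (σ ρ τ : SweepState β) : Prop :=
  ∀ F G, ((ρ.lo F < ρ.lo G ↔ σ.lo F < σ.lo G) ∨ (ρ.lo F < ρ.lo G ↔ τ.lo F < τ.lo G)) ∧
    ((ρ.hi F < ρ.hi G ↔ σ.hi F < σ.hi G) ∨ (ρ.hi F < ρ.hi G ↔ τ.hi F < τ.hi G))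

theorem lo_lt_or (σ : SweepState β) {F G : β} (h : F ≠ G) : σ.lo F < σ.lo G ∨ σ.lo G < σ.lo F :=
  lt_or_gt_of_ne fun e => h (σ.lo_inj e)

theorem hi_lt_or (σ : SweepState β) {F G : β} (h : F ≠ G) : σ.hi F < σ.hi G ∨ σ.hi G < σ.hi F :=
  lt_or_gt_of_ne fun e => h (σ.hi_inj e)

theorem Cov.ne {σ : SweepState β} {F G : β} (h : σ.Cov G F) : G ≠ F := by
  rintro rfl
  exact lt_irrefl _ h.1

theorem Below.ne {σ : SweepState β} {F G : β} (h : σ.Below F G) : F ≠ G := by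
  rintro rfl
  exact lt_irrefl _ h.1

theorem Cov.trans {σ : SweepState β} {F G K : β} (h : σ.Cov K G) (h' : σ.Cov G F) : σ.Cov K F :=
  ⟨h.1.trans h'.1, h'.2.trans h.2⟩

theorem Between.cov {σ ρ τ : SweepState β} (h : Between σ ρ τ) {F G : β} (h1 : σ.Cov G F)
    (h2 : τ.Cov G F) : ρ.Cov G F := by
  have a := (h G F).1
  have b := (h F G).2
  unfold Cov at *
  tauto

theorem Between.cov_or {σ ρ τ : SweepState β} (h : Between σ ρ τ) {F G : β}
    (hb : σ.Below F G → ¬ τ.Below G F) (hb' : σ.Below G F → ¬ τ.Below F G)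
    (h1 : ρ.Cov G F) : σ.Cov G F ∨ τ.Cov G F := by
  have a := (h G F).1.imp (fun e => e.mp h1.1) fun e => e.mp h1.1
  have b := (h F G).2.imp (fun e => e.mp h1.2) fun e => e.mp h1.2
  rcases σ.lo_lt_or h1.ne with c1 | c1 <;> rcases σ.hi_lt_or h1.ne with c2 | c2
  · have b' := b.resolve_left c2.not_gt
    rcases τ.lo_lt_or h1.ne with c3 | c3
    · exact Or.inr ⟨c3, b'⟩
    · exact absurd ⟨c3, b'⟩ (hb' ⟨c1, c2⟩)
  · exact Or.inl ⟨c1, c2⟩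
  · exact Or.inr ⟨a.resolve_left c1.not_gt, b.resolve_left c2.not_gt⟩
  · have a' := a.resolve_left c1.not_gt
    rcases τ.hi_lt_or h1.ne with c3 | c3
    · exact absurd ⟨a', c3⟩ (hb ⟨c1, c2⟩)
    · exact Or.inr ⟨a', c3⟩

theorem Between.below_or {σ ρ τ : SweepState β} (h : Between σ ρ τ) {F G : β}
    (h1 : ρ.Below F G) : σ.Below F G ∨ τ.Below F G ∨ (σ.Cov F G ∧ τ.Cov G F) ∨
      (σ.Cov G F ∧ τ.Cov F G) := by
  have a := (h F G).1.imp (fun e => e.mp h1.1) fun e => e.mp h1.1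
  have b := (h F G).2.imp (fun e => e.mp h1.2) fun e => e.mp h1.2
  rcases σ.lo_lt_or h1.ne with c1 | c1 <;> rcases σ.hi_lt_or h1.ne with c2 | c2
  · exact Or.inl ⟨c1, c2⟩
  · have b' := b.resolve_left c2.not_gt
    rcases τ.lo_lt_or h1.ne with c3 | c3
    · exact Or.inr (Or.inl ⟨c3, b'⟩)
    · exact Or.inr (Or.inr (Or.inl ⟨⟨c1, c2⟩, ⟨c3, b'⟩⟩))
  · have a' := a.resolve_left c1.not_gt
    rcases τ.hi_lt_or h1.ne with c3 | c3
    · exact Or.inr (Or.inl ⟨a', c3⟩)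
    · exact Or.inr (Or.inr (Or.inr ⟨⟨c1, c2⟩, ⟨a', c3⟩⟩))
  · exact Or.inr (Or.inl ⟨a.resolve_left c1.not_gt, b.resolve_left c2.not_gt⟩)

theorem Cov.not_below {σ : SweepState β} {F G : β} (h : σ.Cov G F) : ¬ σ.Below G F :=
  fun h' => lt_asymm h.2 h'.2

theorem Cov.not_below' {σ : SweepState β} {F G : β} (h : σ.Cov G F) : ¬ σ.Below F G :=
  fun h' => lt_asymm h.1 h'.1

theorem Cov.asymm {σ : SweepState β} {F G : β} (h : σ.Cov G F) : ¬ σ.Cov F G :=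
  fun h' => lt_asymm h.1 h'.1

theorem Below.asymm {σ : SweepState β} {F G : β} (h : σ.Below G F) : ¬ σ.Below F G :=
  fun h' => lt_asymm h.1 h'.1

end SweepState

/-- A sweep: no interval leaves another one twice, and no two intervals pass through each other. -/
structure IsSweep (N : ℕ) (s : ℕ → SweepState β) : Prop where
  cov : ∀ {F G i j k}, i < j → j < k → k ≤ N → (s j).Cov G F → (s i).Cov G F ∨ (s k).Cov G F
  below : ∀ {F G i j}, i ≤ N → j ≤ N → (s i).Below F G → ¬ (s j).Below G F

/-- Insertion of `σ` after position `t`. -/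
def insertState {α : Type*} (s : ℕ → α) (t : ℕ) (σ : α) (i : ℕ) : α :=
  if i ≤ t then s i else if i = t + 1 then σ else s (i - 1)

theorem insertState_of_le {α : Type*} {s : ℕ → α} {t i : ℕ} {σ : α} (h : i ≤ t) :
    insertState s t σ i = s i := if_pos h

theorem insertState_succ {α : Type*} {s : ℕ → α} {t : ℕ} {σ : α} :
    insertState s t σ (t + 1) = σ := by simp [insertState]

theorem insertState_of_lt {α : Type*} {s : ℕ → α} {t i : ℕ} {σ : α} (h : t < i) :
    insertState s t σ (i + 1) = s i := by
  rw [insertState, if_neg (by omega), if_neg (by omega), Nat.add_sub_cancel]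

theorem insertState_cases {α : Type*} (s : ℕ → α) (σ : α) {t i N : ℕ} (hi : i ≤ N + 1) (ht : t < N) :
    i = t + 1 ∨ ∃ i' ≤ N, insertState s t σ i = s i' ∧
      (i ≤ t ∧ i' = i ∨ t + 1 < i ∧ i' + 1 = i) := by
  rcases lt_trichotomy i (t + 1) with h | h | h
  · exact Or.inr ⟨i, by omega, insertState_of_le (by omega), Or.inl ⟨by omega, rfl⟩⟩
  · exact Or.inl h
  · obtain ⟨m, rfl⟩ : ∃ m, i = m + 1 := ⟨i - 1, by omega⟩
    exact Or.inr ⟨m, by omega, insertState_of_lt (by omega), Or.inr ⟨h, rfl⟩⟩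

theorem IsSweep.insert {N t : ℕ} {s : ℕ → SweepState β} (hs : IsSweep N s) (ht : t < N)
    {σ : SweepState β} (hσ : SweepState.Between (s t) σ (s (t + 1))) :
    IsSweep (N + 1) (insertState s t σ) := by
  have hor : ∀ F G, σ.Cov G F → (s t).Cov G F ∨ (s (t + 1)).Cov G F := fun F G h =>
    hσ.cov_or (hs.below ht.le ht) (hs.below ht.le ht) h
  have hsep : ∀ F G j, j ≤ N → σ.Below F G → ¬ (s j).Below G F := by
    intro F G j hj h hb
    have key : ∀ F' G', (s j).Below F' G' ∨ (s j).Below G' F' →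
        (s t).Cov F' G' → (s (t + 1)).Cov G' F' → False := by
      intro F' G' hb h1 h2
      rcases lt_trichotomy j t with hjt | rfl | hjt
      · rcases hs.cov hjt (Nat.lt_succ_self t) ht h1 with h3 | h3
        · exact hb.elim h3.not_below h3.not_below'
        · exact h3.asymm h2
      · exact hb.elim h1.not_below h1.not_below'
      · rcases (Nat.succ_le_of_lt hjt).lt_or_eq with hjt' | hjt'
        · rcases hs.cov (Nat.lt_succ_self t) hjt' hj h2 with h3 | h3
          · exact h3.asymm h1
          · exact hb.elim h3.not_below' h3.not_below
        · rw [← hjt'] at hb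
          exact hb.elim h2.not_below' h2.not_below
    rcases hσ.below_or h with h1 | h1 | h1 | h1
    · exact hs.below ht.le hj h1 hb
    · exact hs.below ht hj h1 hb
    · exact key F G (Or.inr hb) h1.1 h1.2
    · exact key G F (Or.inl hb) h1.1 h1.2
  constructor
  · intro F G i j k hij hjk hk h
    rcases insertState_cases s σ (i := i) (by omega) ht with hi | ⟨i', hi', ei, ci⟩ <;>
      rcases insertState_cases s σ (i := j) (by omega) ht with hj | ⟨j', hj', ej, cj⟩ <;>
      rcases insertState_cases s σ (i := k) hk ht with hk' | ⟨k', hk', ek, ck⟩ <;> try omega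
    · rw [ej] at h
      rw [ek, hi, insertState_succ]
      by_contra! hno
      have h1 : (s t).Cov G F :=
        (hs.cov (i := t) (j := j') (k := k') (by omega) (by omega) (by omega) h).resolve_right hno.2
      have h2 : (s (t + 1)).Cov G F := by
        by_cases e : j' = t + 1
        · exact e ▸ h
        · exact (hs.cov (i := t + 1) (j := j') (k := k') (by omega) (by omega) (by omega) h).resolve_right
            hno.2
      exact hno.1 (hσ.cov h1 h2)
    · rw [hj, insertState_succ] at h
      rw [ei, ek]
      rcases hor F G h with h1 | h1
      · by_cases e : i' = t
        · exact Or.inl (e ▸ h1)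
        · exact hs.cov (by omega) (by omega) (by omega) h1
      · by_cases e : k' = t + 1
        · exact Or.inr (e ▸ h1)
        · exact hs.cov (by omega) (by omega) (by omega) h1
    · rw [ej] at h
      rw [ei, hk', insertState_succ]
      by_contra! hno
      have h1 : (s (t + 1)).Cov G F :=
        (hs.cov (i := i') (j := j') (k := t + 1) (by omega) (by omega) (by omega) h).resolve_left hno.1
      have h2 : (s t).Cov G F := by
        by_cases e : j' = t
        · exact e ▸ h
        · exact (hs.cov (i := i') (j := j') (k := t) (by omega) (by omega) (by omega) h).resolve_left
            hno.1
      exact hno.2 (hσ.cov h2 h1)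
    · rw [ej] at h
      rw [ei, ek]
      exact hs.cov (by omega) (by omega) (by omega) h
  · intro F G i j hi hj h h'
    rcases insertState_cases s σ hi ht with hi | ⟨i', hi', ei, ci⟩ <;>
      rcases insertState_cases s σ hj ht with hj | ⟨j', hj', ej, cj⟩
    · rw [hi, insertState_succ] at h
      rw [hj, insertState_succ] at h'
      exact h.asymm h'
    · rw [hi, insertState_succ] at h
      rw [ej] at h'
      exact hsep F G j' hj' h h'
    · rw [hj, insertState_succ] at h'
      rw [ei] at h
      exact hsep G F i' hi' h' h
    · rw [ei] at h
      rw [ej] at h'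
      exact hs.below hi' hj' h h'

theorem swap_lt_swap_iff {f : β → ℝ} (hf : Function.Injective f) {x y : β} (hxy : f x < f y)
    (hadj : ∀ z, ¬ (f x < f z ∧ f z < f y)) {F G : β} (h1 : ¬ (F = x ∧ G = y))
    (h2 : ¬ (F = y ∧ G = x)) :
    f (Equiv.swap x y F) < f (Equiv.swap x y G) ↔ f F < f G := by
  have hne : x ≠ y := fun e => hxy.ne (congrArg f e)
  have side : ∀ z, z ≠ x → z ≠ y → (f x < f z ↔ f y < f z) ∧ (f z < f x ↔ f z < f y) := by
    intro z hzx hzy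
    have a : f z ≠ f x := fun e => hzx (hf e)
    have b : f z ≠ f y := fun e => hzy (hf e)
    refine ⟨⟨fun h => ?_, hxy.trans⟩, ⟨fun h => h.trans hxy, fun h => ?_⟩⟩
    · by_contra hc
      exact hadj z ⟨h, lt_of_le_of_ne (not_lt.mp hc) b⟩
    · by_contra hc
      exact hadj z ⟨lt_of_le_of_ne (not_lt.mp hc) a.symm, h⟩
  by_cases hFx : F = x
  · subst hFx
    by_cases hG : G = F
    · subst hG
      simp
    · have hGy : G ≠ y := fun e => h1 ⟨rfl, e⟩
      rw [Equiv.swap_apply_left, Equiv.swap_apply_of_ne_of_ne hG hGy]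
      exact (side G hG hGy).1.symm
  by_cases hFy : F = y
  · subst hFy
    by_cases hG : G = F
    · subst hG
      simp
    · have hGx : G ≠ x := fun e => h2 ⟨rfl, e⟩
      rw [Equiv.swap_apply_right, Equiv.swap_apply_of_ne_of_ne hGx hG]
      exact (side G hGx hG).1
  rw [Equiv.swap_apply_of_ne_of_ne hFx hFy]
  by_cases hGx : G = x
  · subst hGx
    rw [Equiv.swap_apply_left]
    exact (side F hFx hFy).2.symm
  by_cases hGy : G = y
  · subst hGy
    rw [Equiv.swap_apply_right]
    exact (side F hFx hFy).2
  rw [Equiv.swap_apply_of_ne_of_ne hGx hGy]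

variable [Fintype β]

/-- The number of pairs ordered differently by `f` and `g`. -/
noncomputable def inversions (f g : β → ℝ) : ℕ :=
  (Finset.univ.filter fun p : β × β => f p.1 < f p.2 ∧ g p.2 < g p.1).card

theorem exists_adjacent_inversion {f g : β → ℝ} (h : inversions f g ≠ 0) :
    ∃ x y, f x < f y ∧ g y < g x ∧ ∀ z, ¬ (f x < f z ∧ f z < f y) := by
  obtain ⟨⟨x, y⟩, hxy, hmin⟩ := Finset.exists_min_image
    (Finset.univ.filter fun p : β × β => f p.1 < f p.2 ∧ g p.2 < g p.1)
    (fun p => (Finset.univ.filter fun z => f p.1 < f z ∧ f z < f p.2).card)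
    (Finset.card_ne_zero.mp h)
  simp only [Finset.mem_filter, Finset.mem_univ, true_and, Prod.forall] at hxy hmin
  refine ⟨x, y, hxy.1, hxy.2, fun z hz => ?_⟩
  rcases lt_or_ge (g z) (g x) with h1 | h1
  · refine (hmin x z ⟨hz.1, h1⟩).not_gt (Finset.card_lt_card ⟨fun w hw => ?_, fun hsub => ?_⟩)
    · simp only [Finset.mem_filter, Finset.mem_univ, true_and] at hw ⊢
      exact ⟨hw.1, hw.2.trans hz.2⟩
    · have := hsub (show z ∈ _ by simpa using hz)
      simp at this
  · refine (hmin z y ⟨hz.2, hxy.2.trans_le h1⟩).not_gt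
      (Finset.card_lt_card ⟨fun w hw => ?_, fun hsub => ?_⟩)
    · simp only [Finset.mem_filter, Finset.mem_univ, true_and] at hw ⊢
      exact ⟨hz.1.trans hw.1, hw.2⟩
    · have := hsub (show z ∈ _ by simpa using hz)
      simp at this

theorem exists_adjacent_swap {f g : β → ℝ} (hf : Function.Injective f)
    (h : inversions f g ≠ 0) :
    ∃ f' : β → ℝ, Function.Injective f' ∧ inversions f' g < inversions f g ∧
      (∃ x y, ∀ F G, ¬ (F = x ∧ G = y) → ¬ (F = y ∧ G = x) → (f F < f G ↔ f' F < f' G)) ∧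
      ∀ F G, (f' F < f' G ↔ f F < f G) ∨ (f' F < f' G ↔ g F < g G) := by
  obtain ⟨x, y, hxy, hgxy, hadj⟩ := exists_adjacent_inversion h
  have hswap := fun F G h1 h2 => swap_lt_swap_iff (F := F) (G := G) hf hxy hadj h1 h2
  have hyx : f (Equiv.swap x y y) < f (Equiv.swap x y x) := by
    rwa [Equiv.swap_apply_left, Equiv.swap_apply_right]
  refine ⟨fun F => f (Equiv.swap x y F), hf.comp (Equiv.injective _), ?_,
    ⟨x, y, fun F G h1 h2 => (hswap F G h1 h2).symm⟩, fun F G => ?_⟩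
  · refine Finset.card_lt_card ⟨fun p hp => ?_, fun hsub => ?_⟩
    · simp only [Finset.mem_filter, Finset.mem_univ, true_and] at hp ⊢
      refine ⟨(hswap _ _ ?_ ?_).mp hp.1, hp.2⟩
      · rintro ⟨h1, h2⟩
        rw [h1, h2] at hp
        exact lt_asymm hp.1 hyx
      · rintro ⟨h1, h2⟩
        rw [h1, h2] at hp
        exact lt_asymm hp.2 hgxy
    · have := hsub (show (x, y) ∈ _ by simpa using ⟨hxy, hgxy⟩)
      simp only [Finset.mem_filter, Finset.mem_univ, true_and] at this
      exact lt_asymm this.1 hyx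
  · by_cases h1 : F = x ∧ G = y
    · rw [h1.1, h1.2]
      exact Or.inr ⟨fun h => absurd h hyx.not_gt, fun h => absurd h hgxy.not_gt⟩
    by_cases h2 : F = y ∧ G = x
    · rw [h2.1, h2.2]
      exact Or.inr ⟨fun _ => hgxy, fun _ => hyx⟩
    exact Or.inl (hswap F G h1 h2)

theorem lt_iff_of_inversions_eq_zero {f g : β → ℝ} (hf : Function.Injective f)
    (hg : Function.Injective g) (h : inversions f g = 0) (F G : β) : f F < f G ↔ g F < g G := by
  have key : ∀ F G, f F < f G → g F < g G := by
    intro F G hlt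
    by_contra hc
    have hmem : (F, G) ∈ Finset.univ.filter fun p : β × β => f p.1 < f p.2 ∧ g p.2 < g p.1 := by
      simp only [Finset.mem_filter, Finset.mem_univ, true_and]
      exact ⟨hlt, lt_of_le_of_ne (not_lt.mp hc) fun e => hlt.ne (congrArg f (hg e)).symm⟩
    rw [inversions, Finset.card_eq_zero] at h
    simp [h] at hmem
  refine ⟨key F G, fun hlt => ?_⟩
  by_contra hc
  exact lt_asymm hlt (key G F (lt_of_le_of_ne (not_lt.mp hc) fun e => hlt.ne (congrArg g (hf e)).symm))

/-- The number of switches between two states. -/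
noncomputable def SweepState.dist (σ τ : SweepState β) : ℕ :=
  inversions σ.lo τ.lo + inversions σ.hi τ.hi

theorem SweepState.elementary_of_dist_eq_zero [Nonempty β] {σ τ : SweepState β}
    (h : σ.dist τ = 0) : σ.Elementary τ := by
  obtain ⟨x⟩ := ‹Nonempty β›
  have h1 := lt_iff_of_inversions_eq_zero σ.lo_inj τ.lo_inj (Nat.eq_zero_of_add_eq_zero_right h)
  have h2 := lt_iff_of_inversions_eq_zero σ.hi_inj τ.hi_inj (Nat.eq_zero_of_add_eq_zero_left h)
  exact ⟨x, x, fun F G _ _ => ⟨h1 F G, h2 F G⟩, Or.inl h1⟩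

theorem SweepState.exists_between {σ τ : SweepState β} (h : σ.dist τ ≠ 0) :
    ∃ ρ : SweepState β, σ.Elementary ρ ∧ Between σ ρ τ ∧ ρ.dist τ < σ.dist τ := by
  by_cases h1 : inversions σ.lo τ.lo = 0
  · have h2 : inversions σ.hi τ.hi ≠ 0 := fun e => h (by rw [dist, h1, e])
    obtain ⟨f', hf', hlt, ⟨x, y, hxy⟩, hbet⟩ := exists_adjacent_swap σ.hi_inj h2
    exact ⟨⟨σ.lo, f', σ.lo_inj, hf'⟩, ⟨x, y, fun F G a b => ⟨Iff.rfl, hxy F G a b⟩,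
      Or.inl fun F G => Iff.rfl⟩, fun F G => ⟨Or.inl Iff.rfl, hbet F G⟩, Nat.add_lt_add_left hlt _⟩
  · obtain ⟨f', hf', hlt, ⟨x, y, hxy⟩, hbet⟩ := exists_adjacent_swap σ.lo_inj h1
    exact ⟨⟨f', σ.hi, hf', σ.hi_inj⟩, ⟨x, y, fun F G a b => ⟨hxy F G a b, Iff.rfl⟩,
      Or.inr fun F G => Iff.rfl⟩, fun F G => ⟨hbet F G, Or.inl Iff.rfl⟩, Nat.add_lt_add_right hlt _⟩

theorem IsSweep.exists_refinement_aux [Nonempty β] (k : ℕ) : ∀ (t : ℕ) (s : ℕ → SweepState β),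
    IsSweep (t + k) s → (∀ i < t, (s i).Elementary (s (i + 1))) →
    ∃ (N : ℕ) (s' : ℕ → SweepState β), IsSweep N s' ∧
      (∀ i < N, (s' i).Elementary (s' (i + 1))) ∧ ∀ c ≤ t + k, ∃ u ≤ N, s' u = s c := by
  induction k with
  | zero => exact fun t s hs hel => ⟨t, s, hs, hel, fun c hc => ⟨c, hc, rfl⟩⟩
  | succ k ih =>
    have main : ∀ (m t : ℕ) (s : ℕ → SweepState β), (s t).dist (s (t + 1)) = m →
        IsSweep (t + (k + 1)) s → (∀ i < t, (s i).Elementary (s (i + 1))) →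
        ∃ (N : ℕ) (s' : ℕ → SweepState β), IsSweep N s' ∧
          (∀ i < N, (s' i).Elementary (s' (i + 1))) ∧
          ∀ c ≤ t + (k + 1), ∃ u ≤ N, s' u = s c := by
      intro m
      induction m using Nat.strong_induction_on with
      | _ m ihm =>
        intro t s hm hs hel
        by_cases h0 : (s t).dist (s (t + 1)) = 0
        · have := ih (t + 1) s (by rwa [add_assoc, add_comm 1 k]) fun i hi => by
            rcases (Nat.lt_succ_iff.mp hi).lt_or_eq with h | rfl
            · exact hel i h
            · exact SweepState.elementary_of_dist_eq_zero h0
          rwa [add_assoc, add_comm 1 k] at this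
        · obtain ⟨ρ, hρ, hbet, hlt⟩ := SweepState.exists_between h0
          have e : t + 1 + (k + 1) = t + (k + 1) + 1 := by omega
          obtain ⟨N, s', h1, h2, h3⟩ := ihm (ρ.dist (s (t + 1))) (hm ▸ hlt) (t + 1)
            (insertState s t ρ)
            (by rw [insertState_succ, insertState_of_lt (Nat.lt_succ_self t)])
            (by rw [e]; exact hs.insert (by omega) hbet) fun i hi => by
              rcases (Nat.lt_succ_iff.mp hi).lt_or_eq with h | rfl
              · rw [insertState_of_le h.le, insertState_of_le (Nat.succ_le_of_lt h)]
                exact hel i h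
              · rw [insertState_of_le le_rfl, insertState_succ]
                exact hρ
          refine ⟨N, s', h1, h2, fun c hc => ?_⟩
          rcases le_or_gt c t with h | h
          · obtain ⟨u, hu, hue⟩ := h3 c (by omega)
            exact ⟨u, hu, by rw [hue, insertState_of_le h]⟩
          · obtain ⟨u, hu, hue⟩ := h3 (c + 1) (by omega)
            exact ⟨u, hu, by rw [hue, insertState_of_lt h]⟩
    exact fun t s => main _ t s rfl

theorem IsSweep.exists_refinement [Nonempty β] {n : ℕ} {s : ℕ → SweepState β} (hs : IsSweep n s) :
    ∃ (N : ℕ) (s' : ℕ → SweepState β), IsSweep N s' ∧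
      (∀ i < N, (s' i).Elementary (s' (i + 1))) ∧ ∀ c ≤ n, ∃ u ≤ N, s' u = s c := by
  have := IsSweep.exists_refinement_aux n 0 s (by rwa [zero_add]) fun i hi => absurd hi i.not_lt_zero
  rwa [zero_add] at this

end Sweep

section Visibility

variable {β : Type*} {N : ℕ} {s : ℕ → SweepState β}

theorem BarAdj.symm {vis : ℕ → β → Prop} {h : ℕ → β → ℝ} {F G : β} (hFG : BarAdj vis h F G) :
    BarAdj vis h G F := by
  obtain ⟨t, hF, hG, hne, hK⟩ := hFG
  exact ⟨t, hG, hF, hne.symm, fun K h1 h2 h3 => (hK K h1 h3 h2).symm⟩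

theorem SweepState.Elementary.symm {σ τ : SweepState β} (h : σ.Elementary τ) : τ.Elementary σ := by
  obtain ⟨x, y, h1, h2⟩ := h
  exact ⟨x, y, fun F G a b => ⟨(h1 F G a b).1.symm, (h1 F G a b).2.symm⟩,
    h2.imp (fun h F G => (h F G).symm) fun h F G => (h F G).symm⟩

/-- If an elementary step uncovers `A` from `Z`, no other pair changes. -/
theorem SweepState.Elementary.eq_of_cov {σ τ : SweepState β} (h : σ.Elementary τ) {A Z : β}
    (h1 : σ.Cov Z A) (h2 : ¬ τ.Cov Z A) {F G : β} (hFG : ¬ (F = A ∧ G = Z))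
    (hGF : ¬ (F = Z ∧ G = A)) :
    (σ.lo F < σ.lo G ↔ τ.lo F < τ.lo G) ∧ (σ.hi F < σ.hi G ↔ τ.hi F < τ.hi G) := by
  obtain ⟨x, y, h3, -⟩ := h
  by_cases e1 : A = x ∧ Z = y
  · rw [e1.1, e1.2] at hFG hGF
    exact h3 F G hFG hGF
  by_cases e2 : A = y ∧ Z = x
  · rw [e2.1, e2.2] at hFG hGF
    exact h3 F G hGF hFG
  exact absurd ⟨(h3 Z A (by tauto) (by tauto)).1.mp h1.1,
    (h3 A Z (by tauto) (by tauto)).2.mp h1.2⟩ h2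

theorem SweepState.Elementary.cov_of_ne {σ τ : SweepState β} (h : σ.Elementary τ) {A Z : β}
    (h1 : σ.Cov Z A) (h2 : ¬ τ.Cov Z A) {F G : β} (hFG : ¬ (F = A ∧ G = Z))
    (hGF : ¬ (F = Z ∧ G = A)) : σ.Cov F G ↔ τ.Cov F G :=
  and_congr (h.eq_of_cov h1 h2 hFG hGF).1
    (h.eq_of_cov h1 h2 (fun e => hGF e.symm) fun e => hFG e.symm).2

theorem SweepState.Elementary.not_cov_cov {σ τ : SweepState β} (h : σ.Elementary τ) {A Z : β}
    (h1 : σ.Cov Z A) : ¬ τ.Cov A Z := by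
  obtain ⟨x, y, -, h3 | h3⟩ := h
  · exact fun h2 => lt_asymm ((h3 _ _).mp h1.1) h2.1
  · exact fun h2 => lt_asymm ((h3 _ _).mp h1.2) h2.2

/-- The intervals contained in no other one at time `t`. -/
def SweepVis (N : ℕ) (s : ℕ → SweepState β) (t : ℕ) (F : β) : Prop :=
  t ≤ N ∧ ∀ G, ¬ (s t).Cov G F

theorem SweepVis.lt_iff {t : ℕ} {F G : β} (hF : SweepVis N s t F) (hG : SweepVis N s t G) :
    (s t).lo F < (s t).lo G ↔ (s t).hi F < (s t).hi G := by
  by_cases e : F = G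
  · simp [e]
  constructor
  · intro h
    exact ((s t).hi_lt_or e).resolve_right fun h' => hG.2 F ⟨h, h'⟩
  · intro h
    exact ((s t).lo_lt_or e).resolve_right fun h' => hF.2 G ⟨h', h⟩

/-- Adjacency of intervals that are consecutive among the visible ones at some time. -/
abbrev SweepAdj (N : ℕ) (s : ℕ → SweepState β) : β → β → Prop :=
  BarAdj (SweepVis N s) fun t => (s t).lo

theorem sweepAdj_of_lt {t : ℕ} {F G : β} (hF : SweepVis N s t F) (hG : SweepVis N s t G)
    (hlt : (s t).lo F < (s t).lo G)
    (hK : ∀ K, SweepVis N s t K → (s t).lo F < (s t).lo K → ¬ (s t).lo K < (s t).lo G) :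
    SweepAdj N s F G := by
  refine ⟨t, hF, hG, fun e => hlt.ne (congrArg _ e), fun K h1 h2 h3 => ⟨fun h => ?_, hlt.trans⟩⟩
  exact ((s t).lo_lt_or h3.symm).resolve_right (hK K h1 h)

theorem IsSweep.noK5_sweepAdj [Fintype β] (hs : IsSweep N s)
    (hel : ∀ i < N, (s i).Elementary (s (i + 1))) : NoK5 (SweepAdj N s) := by
  refine noK5_barAdj (N := N + 1) (fun t F h => Nat.lt_succ_of_le h.1)
    (fun t F G _ _ e => (s t).lo_inj e) (fun t F G h1 h2 h3 h4 => ?_) fun i j k F hij hjk hi hk => ?_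
  · rw [← not_lt, ← not_lt, not_iff_not]
    obtain ⟨x, y, -, h | h⟩ := hel t h3.1
    · exact h G F
    · rw [h2.lt_iff h1, h4.lt_iff h3]
      exact h G F
  · refine ⟨hjk.trans hk.1, fun G hG => ?_⟩
    rcases hij.lt_or_eq with h1 | rfl
    · rcases hjk.lt_or_eq with h2 | rfl
      · exact (hs.cov h1 h2 hk.1 hG).elim (hi.2 G) (hk.2 G)
      · exact hk.2 G hG
    · exact hi.2 G hG

theorem exists_sweepAdj_above [Fintype β] {t : ℕ} {A T : β} (hA : SweepVis N s t A)
    (hT : (s t).hi A < (s t).hi T) :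
    ∃ G, SweepAdj N s A G ∧ (s t).hi A < (s t).hi G ∧ (s t).lo G ≤ (s t).lo T := by
  obtain ⟨G, hG, hmin⟩ := Finset.exists_min_image
    (Finset.univ.filter fun G => (s t).hi A < (s t).hi G) (s t).lo ⟨T, by simpa using hT⟩
  simp only [Finset.mem_filter, Finset.mem_univ, true_and] at hG hmin
  have hGv : SweepVis N s t G := ⟨hA.1, fun K hK => (hmin K (hG.trans hK.2)).not_gt hK.1⟩
  refine ⟨G, sweepAdj_of_lt hA hGv ((hA.lt_iff hGv).mpr hG) fun K hK h1 h2 => ?_, hG, hmin T hT⟩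
  exact (hmin K ((hA.lt_iff hK).mp h1)).not_gt h2

theorem exists_vis_cov [Fintype β] {t : ℕ} (ht : t ≤ N) {A : β} (hA : ¬ SweepVis N s t A) :
    ∃ G, SweepVis N s t G ∧ (s t).Cov G A := by
  have hne : ∃ G, (s t).Cov G A := by
    by_contra! h
    exact hA ⟨ht, h⟩
  obtain ⟨G, hG, hmin⟩ := Finset.exists_min_image
    (Finset.univ.filter fun G => (s t).Cov G A) (s t).lo (by simpa [Finset.Nonempty] using hne)
  simp only [Finset.mem_filter, Finset.mem_univ, true_and] at hG hmin
  exact ⟨G, ⟨ht, fun K hK => (hmin K (hK.trans hG)).not_gt hK.1⟩, hG⟩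

theorem sweepAdj_of_uncover {p q : ℕ} (h : (s p).Elementary (s q)) {A Z : β}
    (hA : SweepVis N s q A) (hZ : (s p).Cov Z A) : SweepAdj N s A Z := by
  have hno := hA.2 Z
  have hZv : SweepVis N s q Z := by
    refine ⟨hA.1, fun K hK => ?_⟩
    have hKA : K ≠ A := by
      rintro rfl
      exact h.not_cov_cov hZ hK
    have h1 : (s p).Cov K Z :=
      (h.cov_of_ne hZ hno (fun e => hKA e.1) fun e => hZ.ne e.2).mpr hK
    refine hA.2 K ((h.cov_of_ne hZ hno (fun e => hKA e.1) fun e => hK.ne e.1).mp (h1.trans hZ))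
  rcases (s q).lo_lt_or hZ.ne with h0 | h0
  · refine BarAdj.symm (sweepAdj_of_lt hZv hA h0 fun K hK h1 h2 => ?_)
    have hKA : K ≠ A := fun e => h2.ne (congrArg _ e)
    have hKZ : K ≠ Z := fun e => h1.ne (congrArg _ e.symm)
    have a := (h.eq_of_cov hZ hno (fun e => hKZ e.2) fun e => hKA e.2).2.mpr ((hZv.lt_iff hK).mp h1)
    have b := (h.eq_of_cov hZ hno (fun e => hKA e.1) fun e => hKZ e.1).2.mpr ((hK.lt_iff hA).mp h2)
    exact lt_asymm (a.trans b) hZ.2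
  · refine sweepAdj_of_lt hA hZv h0 fun K hK h1 h2 => ?_
    have hKA : K ≠ A := fun e => h1.ne (congrArg _ e.symm)
    have hKZ : K ≠ Z := fun e => h2.ne (congrArg _ e)
    have a := (h.eq_of_cov hZ hno (fun e => hKZ e.2) fun e => hKA e.2).1.mpr h1
    have b := (h.eq_of_cov hZ hno (fun e => hKA e.1) fun e => hKZ e.1).1.mpr h2
    exact lt_asymm (a.trans b) hZ.1

theorem IsSweep.exists_sweepAdj_cov_of_lt (hs : IsSweep N s)
    (hel : ∀ i < N, (s i).Elementary (s (i + 1))) {A : β} {c u : ℕ} (hcu : c < u)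
    (hc : ¬ SweepVis N s c A) (hu : SweepVis N s u A) :
    ∃ G, SweepAdj N s A G ∧ (s c).Cov G A := by
  have hex : ∃ u, c < u ∧ SweepVis N s u A := ⟨u, hcu, hu⟩
  obtain ⟨h1, h2⟩ := Nat.find_spec hex
  set v := Nat.find hex with hv
  obtain ⟨w, hw⟩ : ∃ w, v = w + 1 := ⟨v - 1, by omega⟩
  have hwA : ¬ SweepVis N s w A := by
    rcases (show c ≤ w by omega).lt_or_eq with h | h
    · exact fun hvis => Nat.find_min hex (m := w) (by omega) ⟨h, hvis⟩
    · exact h ▸ hc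
  rw [hw] at h2
  obtain ⟨Z, hZ⟩ : ∃ Z, (s w).Cov Z A := by
    by_contra! h
    exact hwA ⟨(Nat.le_succ w).trans h2.1, h⟩
  refine ⟨Z, sweepAdj_of_uncover (hel w h2.1) h2 hZ, ?_⟩
  rcases (show c ≤ w by omega).lt_or_eq with h | h
  · exact (hs.cov h (Nat.lt_succ_self w) h2.1 hZ).resolve_right (h2.2 Z)
  · exact h ▸ hZ

theorem IsSweep.exists_sweepAdj_cov_of_gt (hs : IsSweep N s)
    (hel : ∀ i < N, (s i).Elementary (s (i + 1))) {A : β} {c u : ℕ} (huc : u < c) (hcN : c ≤ N)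
    (hc : ¬ SweepVis N s c A) (hu : SweepVis N s u A) :
    ∃ G, SweepAdj N s A G ∧ (s c).Cov G A := by
  have hex : ∃ w, ¬ SweepVis N s (u + 1 + w) A := ⟨c - (u + 1), by rwa [Nat.add_sub_cancel' huc]⟩
  have hf := Nat.find_spec hex
  set w := Nat.find hex with hw
  have hle : w ≤ c - (u + 1) := Nat.find_min' hex (by rwa [Nat.add_sub_cancel' huc])
  have hvis : SweepVis N s (u + w) A := by
    rcases w.eq_zero_or_pos with h | h
    · rwa [h]
    · have := Nat.find_min hex (m := w - 1) (by omega)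
      rw [not_not] at this
      rwa [show u + w = u + 1 + (w - 1) by omega]
  rw [show u + 1 + w = u + w + 1 by omega] at hf
  have hN : u + w + 1 ≤ N := by omega
  obtain ⟨Z, hZ⟩ : ∃ Z, (s (u + w + 1)).Cov Z A := by
    by_contra! h
    exact hf ⟨hN, h⟩
  refine ⟨Z, sweepAdj_of_uncover (hel _ hN).symm hvis hZ, ?_⟩
  rcases (show u + w + 1 ≤ c by omega).lt_or_eq with h | h
  · exact (hs.cov (Nat.lt_succ_self _) h hcN hZ).resolve_left (hvis.2 Z)
  · exact h ▸ hZ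

/-- A never visible interval is, at each time, contained in one of two adjacent intervals. -/
theorem IsSweep.exists_cov_pair [Fintype β] (hs : IsSweep N s)
    (hel : ∀ i < N, (s i).Elementary (s (i + 1))) {A : β} (hA : ∀ t, ¬ SweepVis N s t A) :
    ∃ X Y, (∃ t, SweepVis N s t X) ∧ (∃ t, SweepVis N s t Y) ∧ (X = Y ∨ SweepAdj N s X Y) ∧
      ∀ c ≤ N, (s c).Cov X A ∨ (s c).Cov Y A := by
  let V : ℕ → β → Prop := fun t Z => SweepVis N s t Z ∧ (s t).Cov Z A
  let L : ℕ → β → Prop := fun t Z => ∀ j ≤ t, (s j).Cov Z A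
  let R : ℕ → β → Prop := fun t Z => ∀ j, t ≤ j → j ≤ N → (s j).Cov Z A
  have hLR : ∀ t Z, (s t).Cov Z A → L t Z ∨ R t Z := by
    intro t Z hZ
    by_contra! hno
    obtain ⟨h1, h2⟩ := hno
    simp only [L, R, not_forall] at h1 h2
    obtain ⟨i, hi, hi'⟩ := h1
    obtain ⟨k, hk, hkN, hk'⟩ := h2
    have hit : i ≠ t := by
      rintro rfl
      exact hi' hZ
    have hkt : t ≠ k := by
      rintro rfl
      exact hk' hZ
    exact (hs.cov (lt_of_le_of_ne hi hit) (lt_of_le_of_ne hk hkt) hkN hZ).elim hi' hk'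
  by_cases hboth : ∃ t X Y, V t X ∧ L t X ∧ V t Y ∧ R t Y
  · obtain ⟨t, X, Y, hX, hXL, hY, hYR⟩ := hboth
    obtain ⟨⟨X', Y'⟩, hp, hmin⟩ := Finset.exists_min_image
      (Finset.univ.filter fun p : β × β => V t p.1 ∧ L t p.1 ∧ V t p.2 ∧ R t p.2)
      (fun p => |(s t).lo p.1 - (s t).lo p.2|) ⟨(X, Y),
        Finset.mem_filter.mpr ⟨Finset.mem_univ _, hX, hXL, hY, hYR⟩⟩
    simp only [Finset.mem_filter, Finset.mem_univ, true_and, Prod.forall] at hp hmin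
    obtain ⟨hX', hXL', hY', hYR'⟩ := hp
    refine ⟨X', Y', ⟨t, hX'.1⟩, ⟨t, hY'.1⟩, ?_, fun c hc => ?_⟩
    · by_cases hne : X' = Y'
      · exact Or.inl hne
      right
      rcases (s t).lo_lt_or hne with h0 | h0
      · refine sweepAdj_of_lt hX'.1 hY'.1 h0 fun K hK h1 h2 => ?_
        have hKA : (s t).Cov K A :=
          ⟨h2.trans hY'.2.1, hX'.2.2.trans ((hX'.1.lt_iff hK).mp h1)⟩
        rcases hLR t K hKA with h | h
        · have := hmin K Y' ⟨⟨hK, hKA⟩, h, hY', hYR'⟩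
          rw [abs_of_neg (by linarith), abs_of_neg (by linarith)] at this
          linarith
        · have := hmin X' K ⟨hX', hXL', ⟨hK, hKA⟩, h⟩
          rw [abs_of_neg (by linarith), abs_of_neg (by linarith)] at this
          linarith
      · refine BarAdj.symm (sweepAdj_of_lt hY'.1 hX'.1 h0 fun K hK h1 h2 => ?_)
        have hKA : (s t).Cov K A :=
          ⟨h2.trans hX'.2.1, hY'.2.2.trans ((hY'.1.lt_iff hK).mp h1)⟩
        rcases hLR t K hKA with h | h
        · have := hmin K Y' ⟨⟨hK, hKA⟩, h, hY', hYR'⟩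
          rw [abs_of_pos (by linarith), abs_of_pos (by linarith)] at this
          linarith
        · have := hmin X' K ⟨hX', hXL', ⟨hK, hKA⟩, h⟩
          rw [abs_of_pos (by linarith), abs_of_pos (by linarith)] at this
          linarith
    · rcases le_total c t with h | h
      · exact Or.inl (hXL' c h)
      · exact Or.inr (hYR' c h hc)
  exfalso
  have hR : ∃ t, ∃ Y, V t Y ∧ R t Y := by
    obtain ⟨Y, hY1, hY2⟩ := exists_vis_cov le_rfl (hA N)
    refine ⟨N, Y, ⟨hY1, hY2⟩, fun j h1 h2 => ?_⟩
    rwa [le_antisymm h2 h1]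
  obtain ⟨Y, hY, hYR⟩ := Nat.find_spec hR
  set u := Nat.find hR with hu
  have hu0 : u ≠ 0 := by
    intro h0
    refine hboth ⟨u, Y, Y, hY, fun j hj => ?_, hY, hYR⟩
    rw [show j = u by omega]
    exact hY.2
  obtain ⟨t, ht⟩ : ∃ t, u = t + 1 := ⟨u - 1, by omega⟩
  rw [ht] at hY hYR
  have htN : t < N := hY.1.1
  have hnR : ¬ ∃ Y, V t Y ∧ R t Y := Nat.find_min hR (by omega)
  obtain ⟨X, hX1, hX2⟩ := exists_vis_cov htN.le (hA t)
  have hXL : L t X := (hLR t X hX2).resolve_right fun h => hnR ⟨X, ⟨hX1, hX2⟩, h⟩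
  by_cases hX3 : (s (t + 1)).Cov X A
  · have hXL' : L (t + 1) X := by
      intro j hj
      rcases hj.lt_or_eq with h | rfl
      · exact hXL j (Nat.lt_succ_iff.mp h)
      · exact hX3
    have hXv : ¬ SweepVis N s (t + 1) X := fun h => hboth ⟨t + 1, X, Y, ⟨h, hX3⟩, hXL', hY, hYR⟩
    obtain ⟨Z, hZ1, hZ2⟩ := exists_vis_cov hY.1.1 hXv
    have hZA := hZ2.trans hX3
    have hZR : R (t + 1) Z :=
      (hLR _ Z hZA).resolve_left fun h => hboth ⟨t + 1, Z, Y, ⟨hZ1, hZA⟩, h, hY, hYR⟩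
    have hel' := (hel t htN).symm
    have hZt : (s t).Cov Z A := (hel'.cov_of_ne hZ2 (hX1.2 Z) (fun e => hZ2.ne e.1)
      fun e => hX2.ne e.2.symm).mp hZA
    refine hnR ⟨Z, ⟨⟨htN.le, fun K hK => ?_⟩, hZt⟩, fun j h1 h2 => ?_⟩
    · have hKX : K ≠ X := by
        rintro rfl
        exact hel'.not_cov_cov hZ2 hK
      exact hZ1.2 K ((hel'.cov_of_ne hZ2 (hX1.2 Z) (fun e => hKX e.1) fun e => hK.ne e.1).mpr hK)
    · rcases h1.lt_or_eq with h | rfl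
      · exact hZR j h h2
      · exact hZt
  · have hel' := hel t htN
    have hYX : Y ≠ X := by
      rintro rfl
      exact hX3 hY.2
    have hYA := hY.2.ne
    have hYt : (s t).Cov Y A := (hel'.cov_of_ne hX2 hX3 (fun e => hYA e.1)
      fun e => hYX e.1).mpr hY.2
    have hYR' : R t Y := by
      intro j h1 h2
      rcases h1.lt_or_eq with h | rfl
      · exact hYR j h h2
      · exact hYt
    obtain ⟨Z, hZ1, hZ2⟩ := exists_vis_cov htN.le fun h => hnR ⟨Y, ⟨h, hYt⟩, hYR'⟩
    exact hY.1.2 Z ((hel'.cov_of_ne hX2 hX3 (fun e => hYX e.2) fun e => hYA e.2).mp hZ2)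

theorem IsSweep.exists_noK5_of_elementary [Fintype β] (hs : IsSweep N s)
    (hel : ∀ i < N, (s i).Elementary (s (i + 1))) :
    ∃ E : β → β → Prop, (∀ u v, E u v → E v u) ∧ NoK5 E ∧ ∀ c ≤ N, ∀ A T,
      (s c).hi A < (s c).hi T → ∃ G, E A G ∧ (s c).hi A < (s c).hi G ∧
        ((s c).lo G ≤ (s c).lo A ∨ (s c).lo G ≤ (s c).lo T) := by
  have hpair : ∀ A, (∀ t, ¬ SweepVis N s t A) →
    ∃ X Y, (∃ t, SweepVis N s t X) ∧ (∃ t, SweepVis N s t Y) ∧ (X = Y ∨ SweepAdj N s X Y) ∧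
      ∀ c ≤ N, (s c).Cov X A ∨ (s c).Cov Y A := fun A hA => hs.exists_cov_pair hel hA
  choose! X Y hX hY hXY hcov using hpair
  refine ⟨Attach (SweepAdj N s) {A | ∀ t, ¬ SweepVis N s t A} X Y,
    Attach.symm fun u v => BarAdj.symm,
    NoK5.attach (fun u v => BarAdj.symm) (hs.noK5_sweepAdj hel) ?_ ?_ ?_ hXY, fun c hc A T hAT => ?_⟩
  · rintro u hu v ⟨t, ht, -⟩
    exact hu t ht
  · intro u hu h
    obtain ⟨t, ht⟩ := hX u hu
    exact h t ht
  · intro u hu h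
    obtain ⟨t, ht⟩ := hY u hu
    exact h t ht
  by_cases hA : SweepVis N s c A
  · obtain ⟨G, h1, h2, h3⟩ := exists_sweepAdj_above hA hAT
    exact ⟨G, Or.inl h1, h2, Or.inr h3⟩
  suffices h : ∃ G, Attach (SweepAdj N s) {A | ∀ t, ¬ SweepVis N s t A} X Y A G ∧
      (s c).Cov G A by
    obtain ⟨G, h1, h2⟩ := h
    exact ⟨G, h1, h2.2, Or.inl h2.1.le⟩
  by_cases hA' : ∀ t, ¬ SweepVis N s t A
  · rcases hcov A hA' c hc with h | h
    · exact ⟨X A, Or.inr (Or.inl ⟨hA', Or.inl rfl⟩), h⟩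
    · exact ⟨Y A, Or.inr (Or.inl ⟨hA', Or.inr rfl⟩), h⟩
  push Not at hA'
  obtain ⟨u, hu⟩ := hA'
  rcases lt_trichotomy c u with h | rfl | h
  · obtain ⟨G, h1, h2⟩ := hs.exists_sweepAdj_cov_of_lt hel h hA hu
    exact ⟨G, Or.inl h1, h2⟩
  · exact absurd hu hA
  · obtain ⟨G, h1, h2⟩ := hs.exists_sweepAdj_cov_of_gt hel h hc hA hu
    exact ⟨G, Or.inl h1, h2⟩

/-- A sweep over finitely many intervals has a `K₅`-minor-free graph in which any two-coloured
convex set of intervals has a two-coloured edge. -/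
theorem IsSweep.exists_noK5 [Fintype β] (hs : IsSweep N s) :
    ∃ E : β → β → Prop, (∀ u v, E u v → E v u) ∧ NoK5 E ∧ ∀ c ≤ N, ∀ S : Set β,
      (∀ F ∈ S, ∀ F' ∈ S, ∀ G, (s c).lo G ≤ (s c).lo F → (s c).hi F' ≤ (s c).hi G → G ∈ S) →
      ∀ χ : β → Prop, (∃ F ∈ S, χ F) → (∃ F ∈ S, ¬ χ F) →
      ∃ F ∈ S, ∃ G ∈ S, E F G ∧ χ F ∧ ¬ χ G := by
  rcases isEmpty_or_nonempty β with hβ | hβ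
  · refine ⟨fun _ _ => False, fun _ _ h => h, ?_, fun c _ S _ χ hF => hβ.elim hF.choose⟩
    rintro ⟨C, hC, -⟩
    exact hβ.elim (hC 0).1.choose
  obtain ⟨N', s', hs', hel, hcol⟩ := hs.exists_refinement
  obtain ⟨E, hE, hK, hloc⟩ := hs'.exists_noK5_of_elementary hel
  refine ⟨E, hE, hK, fun c hc S hS χ hF hG => ?_⟩
  obtain ⟨u, hu, hus⟩ := hcol c hc
  replace hloc := hloc u hu
  rw [hus] at hloc
  obtain ⟨T, hT, hTmax⟩ := Finset.exists_max_image (Finset.univ.filter (· ∈ S)) (s c).hi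
    ⟨hF.choose, by simpa using hF.choose_spec.1⟩
  obtain ⟨B, hB, hBT⟩ : ∃ B ∈ S, ¬ (χ B ↔ χ T) := by
    by_cases h : χ T
    · obtain ⟨B, h1, h2⟩ := hG
      exact ⟨B, h1, by tauto⟩
    · obtain ⟨B, h1, h2⟩ := hF
      exact ⟨B, h1, by tauto⟩
  obtain ⟨A, hA, hAmax⟩ := Finset.exists_max_image
    (Finset.univ.filter fun A => A ∈ S ∧ ¬ (χ A ↔ χ T)) (s c).hi ⟨B, by simpa using ⟨hB, hBT⟩⟩
  simp only [Finset.mem_filter, Finset.mem_univ, true_and] at hT hTmax hA hAmax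
  have hAT : (s c).hi A < (s c).hi T := lt_of_le_of_ne (hTmax A hA.1) fun e => by
    have := (s c).hi_inj e
    subst this
    exact hA.2 Iff.rfl
  obtain ⟨G, h1, h2, h3⟩ := hloc A T hAT
  have hGS : G ∈ S := by
    rcases h3 with h3 | h3
    · exact hS A hA.1 A hA.1 G h3 h2.le
    · exact hS T hT A hA.1 G h3 h2.le
  have hGT : χ G ↔ χ T := by
    by_contra h
    exact (hAmax G ⟨hGS, h⟩).not_gt h2
  by_cases h : χ A
  · exact ⟨A, hA.1, G, hGS, h1, h, by tauto⟩
  · exact ⟨G, hGS, A, hA.1, hE _ _ h1, by tauto, h⟩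

end Visibility

section Slices

variable {β : Type*}

/-- The vertical slices of a family of planar sets: the slice of `F` at `c ∈ [a F, b F]` is the
interval `[lo F c, hi F c]`. -/
structure SliceSystem (β : Type*) where
  /-- The left end of the projection. -/
  a : β → ℝ
  /-- The right end of the projection. -/
  b : β → ℝ
  /-- The lower end of a slice. -/
  lo : β → ℝ → ℝ
  /-- The upper end of a slice. -/
  hi : β → ℝ → ℝ
  lt : ∀ F, a F < b F
  nondeg : ∀ F c, a F < c → c < b F → lo F c < hi F c
  gen : ∀ F G c, F ≠ G → a F ≤ c → c ≤ b F → a G ≤ c → c ≤ b G → lo F c = lo G c →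
    hi F c = hi G c → lo F c = hi F c
  sub : ∀ F G c₁ c₂ c₃, c₁ < c₂ → c₂ < c₃ → a F ≤ c₁ → c₃ ≤ b F → a G ≤ c₂ → c₂ ≤ b G →
    lo G c₂ ≤ lo F c₂ → hi F c₂ ≤ hi G c₂ →
    (a G ≤ c₁ ∧ c₁ ≤ b G ∧ lo G c₁ ≤ lo F c₁ ∧ hi F c₁ ≤ hi G c₁) ∨
    (a G ≤ c₃ ∧ c₃ ≤ b G ∧ lo G c₃ ≤ lo F c₃ ∧ hi F c₃ ≤ hi G c₃)
  sep : ∀ F G c₁ c₂, c₁ < c₂ → a F ≤ c₁ → c₂ ≤ b F → a G ≤ c₁ → c₂ ≤ b G →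
    lo F c₁ < lo G c₁ → hi F c₁ < hi G c₁ → lo G c₂ < lo F c₂ → ¬ hi G c₂ < hi F c₂

namespace SliceSystem

variable (M : SliceSystem β)

/-- The mirror image. -/
@[simps]
def rev : SliceSystem β where
  a F := -M.b F
  b F := -M.a F
  lo F c := M.lo F (-c)
  hi F c := M.hi F (-c)
  lt F := neg_lt_neg (M.lt F)
  nondeg F c h1 h2 := M.nondeg F _ (lt_neg.mp h2) (neg_lt.mp h1)
  gen F G c hne h1 h2 h3 h4 := M.gen F G _ hne (le_neg.mp h2) (neg_le.mp h1) (le_neg.mp h4)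
    (neg_le.mp h3)
  sub F G c₁ c₂ c₃ h1 h2 h3 h4 h5 h6 h7 h8 := by
    have := M.sub F G _ _ _ (neg_lt_neg h2) (neg_lt_neg h1) (le_neg.mp h4) (neg_le.mp h3)
      (le_neg.mp h6) (neg_le.mp h5) h7 h8
    exact this.symm.imp (fun h => ⟨neg_le.mp h.2.1, le_neg.mp h.1, h.2.2⟩)
      fun h => ⟨neg_le.mp h.2.1, le_neg.mp h.1, h.2.2⟩
  sep F G c₁ c₂ h1 h2 h3 h4 h5 h6 h7 h8 h9 :=
    M.sep G F _ _ (neg_lt_neg h1) (le_neg.mp h5) (neg_le.mp h4) (le_neg.mp h3)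
      (neg_le.mp h2) h8 h9 h6 h7

/-- The distance to the projection of `F`. -/
noncomputable def dist (F : β) (c : ℝ) : ℝ := max 0 (max (M.a F - c) (c - M.b F))

/-- The point of the projection of `F` closest to `c`. -/
noncomputable def clamp (F : β) (c : ℝ) : ℝ := max (M.a F) (min c (M.b F))

/-- The length of a slice. -/
noncomputable def len (F : β) (c : ℝ) : ℝ :=
  if M.a F ≤ c ∧ c ≤ M.b F then M.hi F c - M.lo F c else 0

/-- The total length of two nearby slices. -/
noncomputable def near (δ : ℝ) (F : β) (c : ℝ) : ℝ := M.len F (c - δ) + M.len F (c + δ)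

/-- The key for ordering lower ends. -/
noncomputable def loKey (δ : ℝ) (ι : β → ℝ) (c : ℝ) (F : β) : ℝ ×ₗ ℝ ×ₗ ℝ ×ₗ ℝ ×ₗ ℝ :=
  toLex (M.dist F c, toLex (M.lo F (M.clamp F c), toLex (-M.hi F (M.clamp F c),
    toLex (-M.near δ F (M.clamp F c), -ι F))))

/-- The key for ordering upper ends. -/
noncomputable def hiKey (δ : ℝ) (ι : β → ℝ) (c : ℝ) (F : β) : ℝ ×ₗ ℝ ×ₗ ℝ ×ₗ ℝ ×ₗ ℝ :=
  toLex (-M.dist F c, toLex (M.hi F (M.clamp F c), toLex (-M.lo F (M.clamp F c),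
    toLex (M.near δ F (M.clamp F c), ι F))))

/-- At `c`, the set `G` dominates `F`. -/
def Dom (δ : ℝ) (ι : β → ℝ) (c : ℝ) (G F : β) : Prop :=
  M.loKey δ ι c G < M.loKey δ ι c F ∧ M.hiKey δ ι c F < M.hiKey δ ι c G

variable {M} {δ : ℝ} {ι : β → ℝ}

theorem dom_iff {c : ℝ} {F G : β} : M.Dom δ ι c G F ↔ M.dist G c < M.dist F c ∨
    M.dist G c = M.dist F c ∧ (M.lo G (M.clamp G c) ≤ M.lo F (M.clamp F c) ∧
      M.hi F (M.clamp F c) ≤ M.hi G (M.clamp G c)) ∧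
      (M.lo G (M.clamp G c) = M.lo F (M.clamp F c) →
        M.hi G (M.clamp G c) = M.hi F (M.clamp F c) →
        M.near δ F (M.clamp F c) < M.near δ G (M.clamp G c) ∨
        M.near δ F (M.clamp F c) = M.near δ G (M.clamp G c) ∧ ι F < ι G) := by
  simp only [Dom, loKey, hiKey, Prod.Lex.toLex_lt_toLex, neg_lt_neg_iff, neg_inj]
  grind

theorem below_iff {c : ℝ} {F G : β} :
    (M.loKey δ ι c F < M.loKey δ ι c G ∧ M.hiKey δ ι c F < M.hiKey δ ι c G) ↔
    M.dist F c = M.dist G c ∧ M.lo F (M.clamp F c) < M.lo G (M.clamp G c) ∧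
      M.hi F (M.clamp F c) < M.hi G (M.clamp G c) := by
  simp only [loKey, hiKey, Prod.Lex.toLex_lt_toLex, neg_lt_neg_iff, neg_inj]
  grind

theorem dist_nonneg (F : β) (c : ℝ) : 0 ≤ M.dist F c := le_max_left _ _

theorem dist_eq_zero {F : β} {c : ℝ} : M.dist F c = 0 ↔ M.a F ≤ c ∧ c ≤ M.b F := by
  rw [dist, max_eq_left_iff, max_le_iff]
  constructor <;> rintro ⟨h1, h2⟩ <;> constructor <;> linarith

theorem dist_of_le {F : β} {c : ℝ} (h : c ≤ M.a F) : M.dist F c = M.a F - c := by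
  have := M.lt F
  rw [dist, max_eq_left (a := M.a F - c) (by linarith), max_eq_right (by linarith)]

theorem dist_of_ge {F : β} {c : ℝ} (h : M.b F ≤ c) : M.dist F c = c - M.b F := by
  have := M.lt F
  rw [dist, max_eq_right (b := c - M.b F) (by linarith), max_eq_right (by linarith)]

theorem dist_lt {F : β} {c x : ℝ} (h0 : 0 < x) (h1 : M.a F - c < x) (h2 : c - M.b F < x) :
    M.dist F c < x := max_lt h0 (max_lt h1 h2)

theorem clamp_of_mem {F : β} {c : ℝ} (h1 : M.a F ≤ c) (h2 : c ≤ M.b F) : M.clamp F c = c := by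
  rw [clamp, min_eq_left h2, max_eq_right h1]

theorem clamp_of_le {F : β} {c : ℝ} (h : c ≤ M.a F) : M.clamp F c = M.a F := by
  rw [clamp, min_eq_left (h.trans (M.lt F).le), max_eq_left h]

theorem clamp_of_ge {F : β} {c : ℝ} (h : M.b F ≤ c) : M.clamp F c = M.b F := by
  rw [clamp, min_eq_right h, max_eq_right (M.lt F).le]

theorem dist_rev (F : β) (c : ℝ) : M.rev.dist F (-c) = M.dist F c := by
  simp only [dist, rev_a, rev_b]
  rw [max_comm (-M.b F - -c)]
  congr 2 <;> ring

theorem clamp_rev (F : β) (c : ℝ) : M.rev.clamp F (-c) = -M.clamp F c := by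
  have := M.lt F
  rcases le_total c (M.a F) with h | h
  · rw [clamp_of_le h, clamp_of_ge (by simpa using h), rev_b]
  rcases le_total c (M.b F) with h' | h'
  · rw [clamp_of_mem h h', clamp_of_mem (by simpa using h') (by simpa using h)]
  · rw [clamp_of_ge h', clamp_of_le (by simpa using h'), rev_a]

theorem len_rev (F : β) (c : ℝ) : M.rev.len F (-c) = M.len F c := by
  simp only [len, rev_a, rev_b, rev_lo, rev_hi, neg_neg, neg_le_neg_iff,
    and_comm (a := c ≤ M.b F)]

theorem near_rev (F : β) (c : ℝ) : M.rev.near δ F (-c) = M.near δ F c := by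
  rw [near, near, show -c - δ = -(c + δ) by ring, show -c + δ = -(c - δ) by ring, len_rev, len_rev,
    add_comm]

theorem dom_rev {c : ℝ} {F G : β} : M.rev.Dom δ ι (-c) G F ↔ M.Dom δ ι c G F := by
  simp only [dom_iff, dist_rev, clamp_rev, near_rev, rev_lo, rev_hi, neg_neg]

theorem Dom.ne {c : ℝ} {F G : β} (h : M.Dom δ ι c G F) : G ≠ F := by
  rintro rfl
  exact lt_irrefl _ h.1

theorem Dom.dist_le {c : ℝ} {F G : β} (h : M.Dom δ ι c G F) : M.dist G c ≤ M.dist F c :=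
  (dom_iff.mp h).elim (fun h => h.le) fun h => h.1.le

/-- Domination at two places with the same closest points. -/
theorem Dom.of_clamp {c c' : ℝ} {F G : β} (h : M.Dom δ ι c G F) (h0 : M.dist G c = M.dist F c)
    (h1 : M.dist G c' = M.dist F c') (hF : M.clamp F c' = M.clamp F c)
    (hG : M.clamp G c' = M.clamp G c) : M.Dom δ ι c' G F := by
  rw [dom_iff] at h ⊢
  rw [hF, hG]
  exact Or.inr ⟨h1, (h.resolve_left h0.not_lt).2⟩

theorem Dom.of_lt_left {c₁ c₂ : ℝ} {F G : β} (h : M.Dom δ ι c₂ G F) (h12 : c₁ < c₂)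
    (hF : c₂ < M.a F) : M.Dom δ ι c₁ G F := by
  have hle := h.dist_le
  have hF1 := dist_of_le (M := M) (h12.trans hF).le
  have hF2 := dist_of_le (M := M) hF.le
  have hG0 := dist_nonneg (M := M) G c₂
  rw [hF2] at hle
  have hG1 : M.a G - c₂ ≤ M.dist G c₂ := (le_max_left _ _).trans (le_max_right _ _)
  have hG2 : c₂ - M.b G ≤ M.dist G c₂ := (le_max_right _ _).trans (le_max_right _ _)
  by_cases hG : M.a G < M.a F
  · refine dom_iff.mpr (Or.inl ?_)
    rw [hF1]
    exact dist_lt (by linarith) (by linarith) (by linarith)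
  · have e : M.a G = M.a F := by linarith
    have h3 : M.dist G c₂ = M.dist F c₂ := by rw [hF2, dist_of_le (by linarith), e]
    refine h.of_clamp h3 ?_ ?_ ?_
    · rw [hF1, dist_of_le (by linarith), e]
    · rw [clamp_of_le (h12.trans hF).le, clamp_of_le hF.le]
    · rw [clamp_of_le (by linarith), clamp_of_le (by linarith)]

theorem Dom.of_eq_left {c₁ c₂ : ℝ} {F G : β} (h : M.Dom δ ι c₂ G F) (h12 : c₁ < c₂)
    (hF : c₂ = M.a F) : M.Dom δ ι c₁ G F := by
  have hle := h.dist_le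
  have hF1 := dist_of_le (M := M) (h12.trans_eq hF).le
  have hF2 := dist_of_le (M := M) hF.le
  rw [hF2, hF, sub_self] at hle
  obtain ⟨hG1, hG2⟩ := dist_eq_zero.mp (le_antisymm hle (dist_nonneg G _))
  rcases hG1.lt_or_eq with hG | hG
  · refine dom_iff.mpr (Or.inl ?_)
    rw [hF1]
    exact dist_lt (by linarith) (by linarith) (by linarith)
  · refine h.of_clamp ?_ ?_ ?_ ?_
    · rw [hF2, dist_of_le (by linarith), hG]
    · rw [hF1, dist_of_le (by linarith), hG]
    · rw [clamp_of_le (by linarith), clamp_of_le (by linarith)]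
    · rw [clamp_of_le (by linarith), clamp_of_le (by linarith)]

theorem exists_not_sub_of_present (hδ : 0 < δ) {D : Set ℝ}
    (hD : ∀ s ∈ D, ∀ t ∈ D, s < t → s + δ ≤ t)
    {c₁ c₂ : ℝ} (h1 : c₁ ∈ D) (h2 : c₂ ∈ D) (h12 : c₁ < c₂)
    {F G : β} (hne : F ≠ G) (hF : M.a F ≤ c₁) (hF2 : c₂ < M.b F) (hG2 : c₂ ≤ M.b G)
    (hsub : M.lo G c₂ ≤ M.lo F c₂ ∧ M.hi F c₂ ≤ M.hi G c₂) (hno : ¬ M.Dom δ ι c₁ G F) :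
    ∃ c < c₂, M.a F ≤ c ∧ ¬ (M.a G ≤ c ∧ M.lo G c ≤ M.lo F c ∧ M.hi F c ≤ M.hi G c) := by
  by_cases hs : M.a G ≤ c₁ ∧ M.lo G c₁ ≤ M.lo F c₁ ∧ M.hi F c₁ ≤ M.hi G c₁
  swap
  · exact ⟨c₁, h12, hF, hs⟩
  obtain ⟨hG, hs1, hs2⟩ := hs
  have hF1 : c₁ ≤ M.b F := by linarith
  have hG1 : c₁ ≤ M.b G := by linarith
  rw [dom_iff, dist_eq_zero.mpr ⟨hF, hF1⟩, dist_eq_zero.mpr ⟨hG, hG1⟩, clamp_of_mem hF hF1,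
    clamp_of_mem hG hG1] at hno
  push Not at hno
  obtain ⟨e1, e2, hle, -⟩ := hno.2 rfl ⟨hs1, hs2⟩
  have hdF := M.gen F G c₁ hne hF hF1 hG hG1 e1.symm e2.symm
  have hdG := M.gen G F c₁ hne.symm hG hG1 hF hF1 e1 e2
  have haF : M.a F = c₁ := by
    by_contra h
    exact (M.nondeg F c₁ (lt_of_le_of_ne hF h) (by linarith)).ne hdF
  have haG : M.a G = c₁ := by
    by_contra h
    exact (M.nondeg G c₁ (lt_of_le_of_ne hG h) (by linarith)).ne hdG
  have hc := hD _ h1 _ h2 h12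
  have hlen : M.hi G (c₁ + δ) - M.lo G (c₁ + δ) ≤ M.hi F (c₁ + δ) - M.lo F (c₁ + δ) := by
    rw [near, near, len, if_neg (by rintro ⟨h, -⟩; linarith), len,
      if_pos (by constructor <;> linarith), len, if_neg (by rintro ⟨h, -⟩; linarith), len,
      if_pos (by constructor <;> linarith)] at hle
    linarith
  have hns : ¬ (M.lo G (c₁ + δ) ≤ M.lo F (c₁ + δ) ∧ M.hi F (c₁ + δ) ≤ M.hi G (c₁ + δ)) := by
    rintro ⟨h3, h4⟩
    exact (M.nondeg F (c₁ + δ) (by linarith) (by linarith)).ne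
      (M.gen F G _ hne (by linarith) (by linarith) (by linarith) (by linarith) (by linarith)
        (by linarith))
  rcases hc.lt_or_eq with h | h
  · exact ⟨c₁ + δ, h, by linarith, fun h3 => hns h3.2⟩
  · rw [h] at hns
    exact absurd hsub hns

theorem exists_not_sub (hδ : 0 < δ) {D : Set ℝ}
    (hD : ∀ s ∈ D, ∀ t ∈ D, s < t → s + δ ≤ t)
    {c₁ c₂ : ℝ} (h1 : c₁ ∈ D) (h2 : c₂ ∈ D) (h12 : c₁ < c₂)
    {F G : β} (hFD : M.a F ∈ D) (hne : F ≠ G) (hF : M.a F < c₂) (hF2 : c₂ < M.b F)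
    (hG2 : c₂ ≤ M.b G)
    (hsub : M.lo G c₂ ≤ M.lo F c₂ ∧ M.hi F c₂ ≤ M.hi G c₂) (hno : ¬ M.Dom δ ι c₁ G F) :
    ∃ c < c₂, M.a F ≤ c ∧ ¬ (M.a G ≤ c ∧ M.lo G c ≤ M.lo F c ∧ M.hi F c ≤ M.hi G c) := by
  rcases le_or_gt (M.a F) c₁ with h | h
  · exact exists_not_sub_of_present hδ hD h1 h2 h12 hne h hF2 hG2 hsub hno
  rcases lt_trichotomy (M.a G) (M.a F) with hG | hG | hG
  · refine absurd (dom_iff.mpr (Or.inl ?_)) hno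
    rw [dist_of_le h.le]
    exact dist_lt (by linarith) (by linarith) (by linarith)
  · refine exists_not_sub_of_present (ι := ι) hδ hD hFD h2 hF hne le_rfl hF2 hG2 hsub fun hdom => hno ?_
    exact hdom.of_clamp (by rw [dist_of_le le_rfl, dist_of_le hG.ge, hG])
      (by rw [dist_of_le h.le, dist_of_le (by linarith), hG])
      (by rw [clamp_of_le h.le, clamp_of_le le_rfl])
      (by rw [clamp_of_le (by linarith), clamp_of_le hG.ge])
  · exact ⟨M.a F, hF, le_rfl, fun h => absurd h.1 (by linarith)⟩

theorem dom_or_dom (hδ : 0 < δ) {D : Set ℝ}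
    (hD : ∀ s ∈ D, ∀ t ∈ D, s < t → s + δ ≤ t)
    {c₁ c₂ c₃ : ℝ} (h1 : c₁ ∈ D) (h2 : c₂ ∈ D) (h3 : c₃ ∈ D) (h12 : c₁ < c₂)
    (h23 : c₂ < c₃) {F G : β} (haD : M.a F ∈ D) (hbD : M.b F ∈ D) (h : M.Dom δ ι c₂ G F) :
    M.Dom δ ι c₁ G F ∨ M.Dom δ ι c₃ G F := by
  by_contra! hno
  obtain ⟨hno1, hno3⟩ := hno
  have hrev : M.rev.Dom δ ι (-c₂) G F := dom_rev.mpr h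
  have hno3' : ¬ M.rev.Dom δ ι (-c₃) G F := fun h => hno3 (dom_rev.mp h)
  have ha : M.a F < c₂ := by
    rcases lt_trichotomy (M.a F) c₂ with h' | h' | h'
    · exact h'
    · exact absurd (h.of_eq_left h12 h'.symm) hno1
    · exact absurd (h.of_lt_left h12 h') hno1
  have hb : c₂ < M.b F := by
    rcases lt_trichotomy (M.b F) c₂ with h' | h' | h'
    · exact absurd (hrev.of_lt_left (neg_lt_neg h23) (neg_lt_neg h')) hno3'
    · exact absurd (hrev.of_eq_left (neg_lt_neg h23) (neg_inj.mpr h'.symm)) hno3'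
    · exact h'
  have hne := h.ne
  have hd := h.dist_le
  rw [dist_eq_zero.mpr ⟨ha.le, hb.le⟩] at hd
  have hd0 := le_antisymm hd (dist_nonneg G _)
  obtain ⟨hGa, hGb⟩ := dist_eq_zero.mp hd0
  rw [dom_iff, hd0, dist_eq_zero.mpr ⟨ha.le, hb.le⟩, clamp_of_mem hGa hGb,
    clamp_of_mem ha.le hb.le] at h
  have hsub := (h.resolve_left (lt_irrefl _)).2.1
  obtain ⟨x, hx, hxF, hxG⟩ := exists_not_sub hδ hD h1 h2 h12 haD hne.symm ha hb hGb hsub hno1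
  obtain ⟨y, hy, hyF, hyG⟩ := exists_not_sub (M := M.rev) (D := {t | -t ∈ D}) hδ
    (fun s hs t ht hst => by linarith [hD _ ht _ hs (neg_lt_neg hst)]) (by simpa using h3)
    (by simpa using h2) (neg_lt_neg h23) (by simpa using hbD) hne.symm (neg_lt_neg hb)
    (neg_lt_neg ha) (neg_le_neg hGa) (by simpa using hsub) hno3'
  simp only [rev_a, rev_lo, rev_hi] at hyF hyG
  rcases M.sub F G x c₂ (-y) hx (by linarith) hxF (by linarith) hGa hGb hsub.1 hsub.2 with h' | h'
  · exact hxG ⟨h'.1, h'.2.2⟩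
  · exact hyG ⟨by linarith [h'.2.1], h'.2.2⟩

theorem below_cases {c : ℝ} {F G : β} (hd : M.dist F c = M.dist G c)
    (hlo : M.lo F (M.clamp F c) < M.lo G (M.clamp G c))
    (hhi : M.hi F (M.clamp F c) < M.hi G (M.clamp G c)) :
    (∃ e, (M.a F ≤ e ∧ e ≤ M.b F) ∧ (M.a G ≤ e ∧ e ≤ M.b G) ∧ M.lo F e < M.lo G e ∧
      M.hi F e < M.hi G e) ∨ (M.b G < M.a F ∧ c = (M.a F + M.b G) / 2) ∨
      (M.b F < M.a G ∧ c = (M.a G + M.b F) / 2) := by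
  have hF := M.lt F
  have hG := M.lt G
  rcases lt_or_ge c (M.a F) with h1 | h1
  · rw [dist_of_le h1.le] at hd
    rcases lt_or_ge c (M.a G) with h2 | h2
    · rw [dist_of_le h2.le] at hd
      have e : M.a F = M.a G := by linarith
      rw [clamp_of_le h1.le, clamp_of_le h2.le, ← e] at hlo hhi
      exact Or.inl ⟨M.a F, ⟨by linarith, by linarith⟩, ⟨by linarith, by linarith⟩, hlo, hhi⟩
    · rcases le_or_gt c (M.b G) with h3 | h3
      · rw [dist_eq_zero.mpr ⟨h2, h3⟩] at hd
        linarith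
      · rw [dist_of_ge h3.le] at hd
        exact Or.inr (Or.inl ⟨by linarith, by linarith⟩)
  rcases le_or_gt c (M.b F) with h3 | h3
  · rw [dist_eq_zero.mpr ⟨h1, h3⟩, eq_comm, dist_eq_zero] at hd
    rw [clamp_of_mem h1 h3, clamp_of_mem hd.1 hd.2] at hlo hhi
    exact Or.inl ⟨c, ⟨h1, h3⟩, hd, hlo, hhi⟩
  rw [dist_of_ge h3.le] at hd
  rcases lt_or_ge c (M.a G) with h2 | h2
  · rw [dist_of_le h2.le] at hd
    exact Or.inr (Or.inr ⟨by linarith, by linarith⟩)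
  rcases le_or_gt c (M.b G) with h4 | h4
  · rw [dist_eq_zero.mpr ⟨h2, h4⟩] at hd
    linarith
  · rw [dist_of_ge h4.le] at hd
    have e : M.b F = M.b G := by linarith
    rw [clamp_of_ge h3.le, clamp_of_ge h4.le, ← e] at hlo hhi
    exact Or.inl ⟨M.b F, ⟨by linarith, by linarith⟩, ⟨by linarith, by linarith⟩, hlo, hhi⟩

theorem not_below_below {c c' : ℝ} {F G : β}
    (h : M.loKey δ ι c F < M.loKey δ ι c G ∧ M.hiKey δ ι c F < M.hiKey δ ι c G) :
    ¬ (M.loKey δ ι c' G < M.loKey δ ι c' F ∧ M.hiKey δ ι c' G < M.hiKey δ ι c' F) := by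
  intro h'
  have hcc : c ≠ c' := by
    rintro rfl
    exact lt_asymm h.1 h'.1
  rw [below_iff] at h h'
  rcases below_cases h.1 h.2.1 h.2.2 with ⟨e, h1, h2, h3, h4⟩ | ⟨h1, h2⟩ | ⟨h1, h2⟩ <;>
    rcases below_cases h'.1 h'.2.1 h'.2.2 with ⟨e', h1', h2', h3', h4'⟩ | ⟨h1', h2'⟩ | ⟨h1', h2'⟩
  · rcases lt_trichotomy e e' with he | rfl | he
    · exact M.sep F G e e' he h1.1 h2'.2 h2.1 h1'.2 h3 h4 h3' h4'
    · exact lt_asymm h3 h3'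
    · exact M.sep G F e' e he h1'.1 h2.2 h2'.1 h1.2 h3' h4' h3 h4
  all_goals first | linarith [h1.1, h1.2, h2.1, h2.2] | linarith [h1'.1, h1'.2, h2'.1, h2'.2] | skip
  all_goals first | exact hcc (by linarith) | linarith [M.lt F, M.lt G]

end SliceSystem

theorem exists_real_key {β γ : Type*} [Fintype β] [LinearOrder γ] {k : β → γ}
    (hk : Function.Injective k) :
    ∃ f : β → ℝ, Function.Injective f ∧ ∀ F G, f F < f G ↔ k F < k G := by
  have key : ∀ F G, k F < k G → (Finset.univ.filter fun K => k K < k F).card <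
      (Finset.univ.filter fun K => k K < k G).card := by
    intro F G h
    refine Finset.card_lt_card ⟨fun K hK => ?_, fun hs => ?_⟩
    · simp only [Finset.mem_filter, Finset.mem_univ, true_and] at hK ⊢
      exact hK.trans h
    · have := hs (show F ∈ _ by simpa using h)
      simp at this
  have hiff : ∀ F G, ((Finset.univ.filter fun K => k K < k F).card : ℝ) <
      ((Finset.univ.filter fun K => k K < k G).card : ℝ) ↔ k F < k G := by
    intro F G
    rw [Nat.cast_lt]
    refine ⟨fun h => ?_, key F G⟩
    by_contra hc
    rcases (not_lt.mp hc).lt_or_eq with h' | h'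
    · exact lt_asymm h (key G F h')
    · rw [h'] at h
      exact lt_irrefl _ h
  refine ⟨fun F => ((Finset.univ.filter fun K => k K < k F).card : ℝ), fun F G h => ?_, hiff⟩
  by_contra hne
  rcases lt_or_gt_of_ne fun e => hne (hk e) with h' | h'
  · exact ((hiff F G).mpr h').ne h
  · exact ((hiff G F).mpr h').ne' h

theorem exists_gap (D : Finset ℝ) : ∃ δ > 0, ∀ s ∈ D, ∀ t ∈ D, s < t → s + δ ≤ t := by
  by_cases h : ((D ×ˢ D).filter fun p => p.1 < p.2).Nonempty
  · obtain ⟨p, hp, hmin⟩ := Finset.exists_min_image _ (fun p : ℝ × ℝ => p.2 - p.1) h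
    simp only [Finset.mem_filter, Finset.mem_product, Prod.forall] at hp hmin
    exact ⟨p.2 - p.1, sub_pos.mpr hp.2, fun s hs t ht hst => by
      linarith [hmin s t ⟨⟨hs, ht⟩, hst⟩]⟩
  · refine ⟨1, one_pos, fun s hs t ht hst => absurd ⟨(s, t), ?_⟩ h⟩
    simp only [Finset.mem_filter, Finset.mem_product]
    exact ⟨⟨hs, ht⟩, hst⟩

theorem SliceSystem.exists_noK5 [Fintype β] (M : SliceSystem β) (C : Finset ℝ) :
    ∃ E : β → β → Prop, (∀ u v, E u v → E v u) ∧ NoK5 E ∧ ∀ c ∈ C, ∀ S : Set β,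
      (∀ F ∈ S, M.a F ≤ c ∧ c ≤ M.b F) →
      (∀ F ∈ S, ∀ F' ∈ S, ∀ G, M.a G ≤ c → c ≤ M.b G → M.lo G c ≤ M.lo F c →
        M.hi F' c ≤ M.hi G c → G ∈ S) →
      ∀ χ : β → Prop, (∃ F ∈ S, χ F) → (∃ F ∈ S, ¬ χ F) →
      ∃ F ∈ S, ∃ G ∈ S, E F G ∧ χ F ∧ ¬ χ G := by
  set D : Finset ℝ := C ∪ (Finset.univ.image M.a ∪ Finset.univ.image M.b) with hDdef
  have haD : ∀ F, M.a F ∈ D := fun F => by simp [hDdef]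
  have hbD : ∀ F, M.b F ∈ D := fun F => by simp [hDdef]
  obtain ⟨δ, hδ, hD⟩ := exists_gap D
  let ι : β → ℝ := fun F => ((Fintype.equivFin β F : ℕ) : ℝ)
  have hι : Function.Injective ι := fun F G h =>
    (Fintype.equivFin β).injective (Fin.ext (Nat.cast_injective h))
  have hlo : ∀ c, Function.Injective (M.loKey δ ι c) := by
    intro c F G h
    simp only [loKey, toLex_inj, Prod.mk.injEq, neg_inj] at h
    exact hι h.2.2.2.2
  have hhi : ∀ c, Function.Injective (M.hiKey δ ι c) := by
    intro c F G h
    simp only [hiKey, toLex_inj, Prod.mk.injEq, neg_inj] at h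
    exact hι h.2.2.2.2
  choose f hf hf' using fun c => exists_real_key (hlo c)
  choose g hg hg' using fun c => exists_real_key (hhi c)
  let col : ℕ → ℝ := fun i => if h : i < D.card then D.orderEmbOfFin rfl ⟨i, h⟩ else 0
  have hcolD : ∀ i < D.card, col i ∈ D := fun i hi => by
    simp only [col, dif_pos hi]
    exact Finset.orderEmbOfFin_mem D rfl _
  have hcol : ∀ i j, i < j → j < D.card → col i < col j := fun i j hij hj => by
    simp only [col, dif_pos hj, dif_pos (hij.trans hj)]
    exact (D.orderEmbOfFin rfl).strictMono hij
  let s : ℕ → SweepState β := fun i => ⟨f (col i), g (col i), hf _, hg _⟩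
  have hs : IsSweep (D.card - 1) s := by
    constructor
    · intro F G i j k hij hjk hk h
      simp only [SweepState.Cov, s, hf', hg'] at h ⊢
      exact dom_or_dom hδ (D := (D : Set ℝ)) hD (hcolD i (by omega)) (hcolD j (by omega))
        (hcolD k (by omega)) (hcol i j hij (by omega)) (hcol j k hjk (by omega)) (haD F) (hbD F) h
    · intro F G i j _ _ h
      simp only [SweepState.Below, s, hf', hg'] at h ⊢
      exact not_below_below h
  obtain ⟨E, hE, hK, hloc⟩ := hs.exists_noK5
  refine ⟨E, hE, hK, fun c hc S hS hcl => ?_⟩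
  have hcD : c ∈ D := by simp [hDdef, hc]
  obtain ⟨⟨i, hi⟩, hic⟩ : c ∈ Set.range (D.orderEmbOfFin rfl) := by
    rw [Finset.range_orderEmbOfFin]
    exact hcD
  have hi' : col i = c := by simp only [col, dif_pos hi, hic]
  refine hloc i (by omega) S fun F hF F' hF' G h1 h2 => ?_
  rw [← not_lt] at h1 h2
  simp only [s, hf', hg', hi', loKey, hiKey, Prod.Lex.toLex_lt_toLex] at h1 h2
  have dF := dist_eq_zero.mpr (hS F hF)
  have dF' := dist_eq_zero.mpr (hS F' hF')
  have dG0 := dist_nonneg (M := M) G c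
  rw [dF] at h1
  rw [dF'] at h2
  have dG : M.dist G c = 0 := by grind
  have hG := dist_eq_zero.mp dG
  rw [dG, clamp_of_mem hG.1 hG.2, clamp_of_mem (hS F hF).1 (hS F hF).2] at h1
  rw [dG, clamp_of_mem hG.1 hG.2, clamp_of_mem (hS F' hF').1 (hS F' hF').2] at h2
  exact hcl F hF F' hF' G hG.1 hG.2 (by grind) (by grind)

end Slices

section Crossing

/-- The oriented area spanned by two vectors of the plane. -/
def area (u v : ℝ × ℝ) : ℝ := u.1 * v.2 - u.2 * v.1

theorem area_smul_eq (u v x : ℝ × ℝ) : area u v • x = area x v • u + area u x • v := by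
  ext <;> simp [area] <;> ring

theorem continuous_area : Continuous fun p : (ℝ × ℝ) × ℝ × ℝ => area p.1 p.2 := by
  unfold area
  fun_prop

theorem exists_eq_of_lt_of_le {h : ℝ × ℝ → ℝ} (hh : Continuous h) {u v : ℝ × ℝ}
    (hu : h u < 0) (hv : 0 ≤ h v) : ∃ t : ℝ, 0 < t ∧ t ≤ 1 ∧ h ((1 - t) • u + t • v) = 0 := by
  have hc : ContinuousOn (fun t : ℝ => h ((1 - t) • u + t • v)) (Icc 0 1) :=
    Continuous.continuousOn (by fun_prop)
  obtain ⟨t, ht, h0⟩ := intermediate_value_Icc zero_le_one hc (show (0 : ℝ) ∈ _ by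
    simpa using ⟨hu.le, hv⟩)
  simp only at h0
  refine ⟨t, lt_of_le_of_ne ht.1 ?_, ht.2, h0⟩
  rintro rfl
  simp only [sub_zero, one_smul, zero_smul, add_zero] at h0
  exact hu.ne h0

theorem area_comb_left (u v w : ℝ × ℝ) (s t : ℝ) :
    area (s • u + t • v) w = s * area u w + t * area v w := by
  simp [area]; ring

theorem area_comb_right (u v w : ℝ × ℝ) (s t : ℝ) :
    area w (s • u + t • v) = s * area w u + t * area w v := by
  simp [area]; ring

theorem area_self (u : ℝ × ℝ) : area u u = 0 := by
  simp [area]; ring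

theorem area_swap (u v : ℝ × ℝ) : area u v = - area v u := by
  simp [area]; ring

theorem smul_ne_smul_of_area_left {x y w : ℝ × ℝ} {s t : ℝ} (hs : 0 < s) (ht : 0 < t)
    (hx : 0 < area x w) (hy : area y w < 0) : s • x ≠ t • y := by
  intro h
  have h1 := congrArg (fun z => area z w) h
  simp only [area, Prod.smul_fst, Prod.smul_snd, smul_eq_mul] at h1 hx hy
  nlinarith [mul_pos hs hx, mul_pos ht (neg_pos.2 hy)]

theorem smul_ne_smul_of_area_right {x y w : ℝ × ℝ} {s t : ℝ} (hs : 0 < s) (ht : 0 < t)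
    (hx : 0 < area w x) (hy : area w y < 0) : s • x ≠ t • y :=
  smul_ne_smul_of_area_left (w := -w) hs ht
    (by simpa [area, mul_comm, sub_eq_add_neg, add_comm] using hx)
    (by simpa [area, mul_comm, sub_eq_add_neg, add_comm] using hy)

theorem not_subset_pair {α : Type*} {S : Set α} {x y z : α} (hx : x ∈ S) (hy : y ∈ S)
    (hz : z ∈ S) (hxy : x ≠ y) (hyz : y ≠ z) (hxz : x ≠ z) : ¬ ∃ p q, S ⊆ {p, q} := by
  rintro ⟨p, q, h⟩
  have h1 := h hx
  have h2 := h hy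
  have h3 := h hz
  simp only [mem_insert_iff, mem_singleton_iff] at h1 h2 h3
  grind

/-- Two planar convex bodies that are star-shaped around a common interior point and alternate
along four directions have at least three common boundary points. -/
theorem not_frontier_subset_pair_of_zero {F G : Set (ℝ × ℝ)} (hF : IsCompact F)
    (hG : IsCompact G) (hFc : Convex ℝ F) (hGc : Convex ℝ G) (hF0 : (0 : ℝ × ℝ) ∈ interior F)
    (hG0 : (0 : ℝ × ℝ) ∈ interior G) {u v u' v' : ℝ × ℝ} (huF : u ∈ F) (huG : u ∉ G)
    (huF' : u' ∈ F) (huG' : u' ∉ G) (hvG : v ∈ G) (hvF : v ∉ F) (hvG' : v' ∈ G)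
    (hvF' : v' ∉ interior F) (h1 : 0 < area u v) (h2 : 0 < area v u') (h3 : 0 < area u' v')
    (h4 : 0 < area v' u) : ¬ ∃ p q, frontier F ∩ frontier G ⊆ {p, q} := by
  have nF : F ∈ nhds (0 : ℝ × ℝ) := mem_interior_iff_mem_nhds.1 hF0
  have nG : G ∈ nhds (0 : ℝ × ℝ) := mem_interior_iff_mem_nhds.1 hG0
  have cF := continuous_gauge hFc nF
  have cG := continuous_gauge hGc nG
  have mem_le : ∀ {S : Set (ℝ × ℝ)}, IsCompact S → Convex ℝ S → S ∈ nhds 0 → ∀ x,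
      gauge S x ≤ 1 ↔ x ∈ S := by
    intro S h hc hn x
    rw [gauge_le_one_iff_mem_closure hc hn, h.isClosed.closure_eq]
  have hu : gauge F u - gauge G u < 0 := by
    have := (mem_le hF hFc nF u).2 huF
    have := mt (mem_le hG hGc nG u).1 huG
    linarith
  have hu' : gauge F u' - gauge G u' < 0 := by
    have := (mem_le hF hFc nF u').2 huF'
    have := mt (mem_le hG hGc nG u').1 huG'
    linarith
  have hv : gauge G v - gauge F v < 0 := by
    have := (mem_le hG hGc nG v).2 hvG
    have := mt (mem_le hF hFc nF v).1 hvF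
    linarith
  have hv' : 0 ≤ gauge F v' - gauge G v' := by
    have := (mem_le hG hGc nG v').2 hvG'
    have := mt (gauge_lt_one_iff_mem_interior hFc nF).1 hvF'
    linarith
  have key : ∀ x : ℝ × ℝ, x ≠ 0 → gauge F x - gauge G x = 0 →
      ∃ s : ℝ, 0 < s ∧ s • x ∈ frontier F ∩ frontier G := by
    intro x hx hxx
    have hpos : 0 < gauge F x :=
      (gauge_pos (absorbent_nhds_zero nF) (NormedSpace.isVonNBounded_of_isBounded ℝ hF.isBounded)).2 hx
    refine ⟨(gauge F x)⁻¹, inv_pos.2 hpos, ?_, ?_⟩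
    · rw [← gauge_eq_one_iff_mem_frontier hFc nF, gauge_smul_of_nonneg (inv_pos.2 hpos).le,
        smul_eq_mul, inv_mul_cancel₀ hpos.ne']
    · rw [← gauge_eq_one_iff_mem_frontier hGc nG, gauge_smul_of_nonneg (inv_pos.2 hpos).le,
        smul_eq_mul, ← sub_eq_zero.1 hxx, inv_mul_cancel₀ hpos.ne']
  have lt_one : ∀ {u v : ℝ × ℝ} {t : ℝ}, t ≤ 1 → gauge F v - gauge G v ≠ 0 →
      gauge F ((1 - t) • u + t • v) - gauge G ((1 - t) • u + t • v) = 0 → t < 1 := by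
    intro u v t ht hne h0
    refine lt_of_le_of_ne ht ?_
    rintro rfl
    simp at h0
    exact hne h0
  obtain ⟨s, hs0, hs1, hs⟩ := exists_eq_of_lt_of_le (h := fun x => gauge F x - gauge G x)
    (cF.sub cG) hu (v := v) (by linarith)
  have hs1 := lt_one hs1 (by linarith) hs
  obtain ⟨t, ht0, ht1, ht⟩ := exists_eq_of_lt_of_le (h := fun x => gauge G x - gauge F x)
    (cG.sub cF) hv (v := u') (by linarith)
  have ht : gauge F ((1 - t) • v + t • u') - gauge G ((1 - t) • v + t • u') = 0 := by
    linarith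
  have ht1 := lt_one ht1 (by linarith) ht
  obtain ⟨r, hr0, hr1, hr⟩ := exists_eq_of_lt_of_le (h := fun x => gauge F x - gauge G x)
    (cF.sub cG) hu' hv'
  set x₁ := (1 - s) • u + s • v with hx₁
  set x₂ := (1 - t) • v + t • u' with hx₂
  set x₃ := (1 - r) • u' + r • v' with hx₃
  have s1 : 0 < 1 - s := by linarith
  have t1 : 0 < 1 - t := by linarith
  have r1 : 0 ≤ 1 - r := by linarith
  have e1 : 0 < area x₁ v := by
    rw [hx₁, area_comb_left, area_self]; nlinarith [mul_pos s1 h1]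
  have e2 : area x₂ v < 0 := by
    rw [hx₂, area_comb_left, area_self, area_swap u' v]; nlinarith [mul_pos ht0 h2]
  have e3 : 0 < area x₂ u' := by
    rw [hx₂, area_comb_left, area_self]; nlinarith [mul_pos t1 h2]
  have e4 : area x₃ u' < 0 := by
    rw [hx₃, area_comb_left, area_self, area_swap v' u']; nlinarith [mul_pos hr0 h3]
  have ne0 : ∀ {x w : ℝ × ℝ}, area x w ≠ 0 → x ≠ 0 := by
    rintro x w h rfl; exact h (by simp [area])
  obtain ⟨p₁, hp₁, m₁⟩ := key x₁ (ne0 e1.ne') hs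
  obtain ⟨p₂, hp₂, m₂⟩ := key x₂ (ne0 e2.ne) ht
  obtain ⟨p₃, hp₃, m₃⟩ := key x₃ (ne0 e4.ne) hr
  refine not_subset_pair m₁ m₂ m₃ (smul_ne_smul_of_area_left hp₁ hp₂ e1 e2)
    (smul_ne_smul_of_area_left hp₂ hp₃ e3 e4) ?_
  rcases le_or_gt 0 (area u u') with h | h
  · refine smul_ne_smul_of_area_left (w := u') hp₁ hp₃ ?_ e4
    rw [hx₁, area_comb_left]
    nlinarith [mul_pos hs0 h2, mul_nonneg s1.le h]
  · refine smul_ne_smul_of_area_right (w := u) hp₁ hp₃ ?_ ?_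
    · rw [hx₁, area_comb_right, area_self]; nlinarith [mul_pos hs0 h1]
    · rw [hx₃, area_comb_right, area_swap u v']
      nlinarith [mul_pos hr0 h4, mul_nonneg r1 (neg_pos.2 h).le]

theorem interior_inter_interior_nonempty {F G : Set (ℝ × ℝ)} (hFc : Convex ℝ F)
    (hGc : Convex ℝ G) (hFi : (interior F).Nonempty) (hGi : (interior G).Nonempty)
    {z a b a' b' : ℝ × ℝ} (hzF : z ∈ F) (hzG : z ∈ G) (haF : a ∈ F) (haF' : a' ∈ F)
    (hbG : b ∈ G) (hbG' : b' ∈ G) (h1 : 0 < area (a - z) (b - z))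
    (h2 : 0 < area (b - z) (a' - z)) (h3 : 0 < area (a' - z) (b' - z))
    (h4 : 0 < area (b' - z) (a - z)) : (interior F ∩ interior G).Nonempty := by
  by_contra hne
  rw [Set.not_nonempty_iff_eq_empty, ← Set.disjoint_iff_inter_eq_empty] at hne
  obtain ⟨f, c, hf, hg⟩ := geometric_hahn_banach_open hFc.interior isOpen_interior hGc.interior hne
  have hF : ∀ x ∈ F, f x ≤ c := by
    intro x hx
    have hx' : x ∈ closure (interior F) := by
      rw [hFc.closure_interior_eq_closure_of_nonempty_interior hFi]; exact subset_closure hx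
    exact closure_minimal (fun y hy => (hf y hy).le)
      (isClosed_le f.continuous continuous_const) hx'
  have hG : ∀ x ∈ G, c ≤ f x := by
    intro x hx
    have hx' : x ∈ closure (interior G) := by
      rw [hGc.closure_interior_eq_closure_of_nonempty_interior hGi]; exact subset_closure hx
    exact closure_minimal (fun y hy => hg y hy)
      (isClosed_le continuous_const f.continuous) hx'
  have hz : f z = c := le_antisymm (hF z hzF) (hG z hzG)
  have fu : f (a - z) ≤ 0 := by rw [map_sub, hz]; linarith [hF a haF]
  have fu' : f (a' - z) ≤ 0 := by rw [map_sub, hz]; linarith [hF a' haF']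
  have fv : 0 ≤ f (b - z) := by rw [map_sub, hz]; linarith [hG b hbG]
  have fv' : 0 ≤ f (b' - z) := by rw [map_sub, hz]; linarith [hG b' hbG']
  set u := a - z
  set u' := a' - z
  set v := b - z
  set v' := b' - z
  have e : ∀ x y w : ℝ × ℝ, area x y * f w = area w y * f x + area x w * f y := by
    intro x y w
    have := congrArg f (area_smul_eq x y w)
    simpa only [map_add, map_smul, smul_eq_mul] using this
  have e1 := e u u' v
  have e2 := e u u' v'
  rw [area_swap v' u', area_swap u v'] at e2
  have fu0 : f u = 0 := by
    rcases lt_trichotomy (area u u') 0 with h | h | h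
    · nlinarith [mul_nonneg (neg_pos.2 h).le fv', mul_nonneg h3.le (neg_nonneg.2 fu),
        mul_nonneg h4.le (neg_nonneg.2 fu')]
    · rw [h, zero_mul] at e1
      nlinarith [mul_nonneg h2.le (neg_nonneg.2 fu), mul_nonneg h1.le (neg_nonneg.2 fu')]
    · nlinarith [mul_nonneg h.le fv, mul_nonneg h2.le (neg_nonneg.2 fu),
        mul_nonneg h1.le (neg_nonneg.2 fu')]
  have e3 := e u v v'
  rw [fu0, mul_zero, zero_add, area_swap u v'] at e3
  have fv0 : f v = 0 := by
    nlinarith [mul_nonneg h1.le fv', mul_nonneg h4.le fv]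
  have f0 : ∀ w, f w = 0 := by
    intro w
    have := e u v w
    rw [fu0, fv0, mul_zero, mul_zero, add_zero] at this
    exact (mul_eq_zero.1 this).resolve_left h1.ne'
  obtain ⟨x, hx⟩ := hFi
  obtain ⟨y, hy⟩ := hGi
  have := hf x hx
  have := hg y hy
  rw [f0] at *
  linarith

/-- Two planar convex bodies with a common point around which they alternate along four directions
have at least three common boundary points. -/
theorem not_frontier_subset_pair {F G : Set (ℝ × ℝ)} (hF : IsCompact F)
    (hG : IsCompact G) (hFc : Convex ℝ F) (hGc : Convex ℝ G) (hFi : (interior F).Nonempty)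
    (hGi : (interior G).Nonempty) {z a b a' b' : ℝ × ℝ} (hzF : z ∈ F) (hzG : z ∈ G)
    (haF : a ∈ F) (haG : a ∉ G) (haF' : a' ∈ F) (haG' : a' ∉ G) (hbG : b ∈ G) (hbF : b ∉ F)
    (hbG' : b' ∈ G) (hbF' : b' ∉ interior F) (h1 : 0 < area (a - z) (b - z))
    (h2 : 0 < area (b - z) (a' - z)) (h3 : 0 < area (a' - z) (b' - z))
    (h4 : 0 < area (b' - z) (a - z)) : ¬ ∃ p q, frontier F ∩ frontier G ⊆ {p, q} := by
  obtain ⟨w, hwF, hwG⟩ := interior_inter_interior_nonempty hFc hGc hFi hGi hzF hzG haF haF' hbG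
    hbG' h1 h2 h3 h4
  have ev : ∀ x y : ℝ × ℝ, 0 < area (x - z) (y - z) →
      ∀ᶠ t in nhdsWithin (0 : ℝ) (Ioi 0),
        0 < area (x - (z + t • (w - z))) (y - (z + t • (w - z))) := by
    intro x y h
    have hc : Continuous fun t : ℝ => area (x - (z + t • (w - z))) (y - (z + t • (w - z))) :=
      continuous_area.comp (by fun_prop :
        Continuous fun t : ℝ => (x - (z + t • (w - z)), y - (z + t • (w - z))))
    have := hc.tendsto 0
    simp only [zero_smul, add_zero] at this
    exact (this.eventually (lt_mem_nhds h)).filter_mono nhdsWithin_le_nhds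
  have e1 : ∀ᶠ t in nhdsWithin (0 : ℝ) (Ioi 0), t ∈ Ioc (0 : ℝ) 1 :=
    Ioc_mem_nhdsGT one_pos
  obtain ⟨t, ht, k1, k2, k3, k4⟩ :=
    (e1.and ((ev _ _ h1).and ((ev _ _ h2).and ((ev _ _ h3).and (ev _ _ h4))))).exists
  have iF := hFc.add_smul_sub_mem_interior hzF hwF ht
  have iG := hGc.add_smul_sub_mem_interior hzG hwG ht
  set y := z + t • (w - z)
  rintro ⟨p, q, hpq⟩
  let e := Homeomorph.addRight y
  have hc : ∀ {S : Set (ℝ × ℝ)}, Convex ℝ S → Convex ℝ (e ⁻¹' S) := fun h =>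
    h.translate_preimage_left y
  refine not_frontier_subset_pair_of_zero (F := e ⁻¹' F) (G := e ⁻¹' G)
    (e.isCompact_preimage.2 hF) (e.isCompact_preimage.2 hG) (hc hFc) (hc hGc)
    (by rw [← e.preimage_interior]; simpa [e] using iF)
    (by rw [← e.preimage_interior]; simpa [e] using iG)
    (u := a - y) (u' := a' - y) (v := b - y) (v' := b' - y)
    (by simpa [e] using haF) (by simpa [e] using haG) (by simpa [e] using haF')
    (by simpa [e] using haG') (by simpa [e] using hbG) (by simpa [e] using hbF)
    (by simpa [e] using hbG') (by rw [← e.preimage_interior]; simpa [e] using hbF')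
    k1 k2 k3 k4 ⟨e.symm p, e.symm q, ?_⟩
  rw [← e.preimage_frontier, ← e.preimage_frontier]
  intro x hx
  have := hpq hx
  simp only [mem_insert_iff, mem_singleton_iff] at this ⊢
  rw [e.eq_symm_apply, e.eq_symm_apply]
  exact this

end Crossing

section PlanarBodies

theorem eq_Icc_of_convex_of_isCompact {s : Set ℝ} (hs : IsCompact s) (hc : Convex ℝ s)
    (hn : s.Nonempty) : s = Icc (sInf s) (sSup s) :=
  eq_Icc_of_connected_compact ⟨hn, hc.isPreconnected⟩ hs

theorem mem_iff_slice {K : Set (ℝ × ℝ)} (hK : IsCompact K) (hc : Convex ℝ K)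
    (hn : K.Nonempty) (c y : ℝ) :
    (c, y) ∈ K ↔ (sInf (Prod.fst '' K) ≤ c ∧ c ≤ sSup (Prod.fst '' K)) ∧
      sInf {y | (c, y) ∈ K} ≤ y ∧ y ≤ sSup {y | (c, y) ∈ K} := by
  have h1 := eq_Icc_of_convex_of_isCompact (hK.image continuous_fst)
    (hc.linear_image (LinearMap.fst ℝ ℝ ℝ)) (hn.image _)
  have h2 : {y | (c, y) ∈ K} = Prod.snd '' (K ∩ {p | p.1 = c}) := by
    ext y
    constructor
    · intro h; exact ⟨(c, y), ⟨h, rfl⟩, rfl⟩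
    · rintro ⟨⟨c', y'⟩, ⟨h, rfl⟩, rfl⟩; exact h
  have h3 : {y | (c, y) ∈ K}.Nonempty →
      {y | (c, y) ∈ K} = Icc (sInf {y | (c, y) ∈ K}) (sSup {y | (c, y) ∈ K}) := by
    intro h
    refine eq_Icc_of_convex_of_isCompact ?_ ?_ h
    · rw [h2]
      exact (hK.inter_right (isClosed_eq continuous_fst continuous_const)).image continuous_snd
    · rw [h2]
      refine (hc.inter ?_).linear_image (LinearMap.snd ℝ ℝ ℝ)
      exact (convex_singleton c).linear_preimage (LinearMap.fst ℝ ℝ ℝ)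
  have h4 : c ∈ Prod.fst '' K ↔ {y | (c, y) ∈ K}.Nonempty := by
    constructor
    · rintro ⟨⟨c', y'⟩, h, rfl⟩; exact ⟨y', h⟩
    · rintro ⟨y', h⟩; exact ⟨_, h, rfl⟩
  constructor
  · intro h
    have hy : y ∈ {y | (c, y) ∈ K} := h
    have hcm := h4.2 ⟨y, hy⟩
    rw [h1] at hcm
    rw [h3 ⟨y, hy⟩] at hy
    exact ⟨hcm, hy⟩
  · rintro ⟨ha, hb⟩
    have hcm : c ∈ Prod.fst '' K := by rw [h1]; exact ha
    have : y ∈ {y | (c, y) ∈ K} := by rw [h3 (h4.1 hcm)]; exact hb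
    exact this

theorem exists_slices {K : Set (ℝ × ℝ)} (hK : IsCompact K) (hc : Convex ℝ K)
    (hi : (interior K).Nonempty) : ∃ (a b : ℝ) (lo hi : ℝ → ℝ), a < b ∧
      (∀ c y, (c, y) ∈ K ↔ (a ≤ c ∧ c ≤ b) ∧ lo c ≤ y ∧ y ≤ hi c) ∧
      (∀ c, a ≤ c → c ≤ b → lo c ≤ hi c) ∧
      (∀ c, a < c → c < b → lo c < hi c) ∧
      (∀ c y, y ≤ lo c ∨ hi c ≤ y → (c, y) ∉ interior K) := by
  have hm := mem_iff_slice hK hc (hi.mono interior_subset)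
  have h1 := eq_Icc_of_convex_of_isCompact (hK.image continuous_fst)
    (hc.linear_image (LinearMap.fst ℝ ℝ ℝ)) ((hi.mono interior_subset).image _)
  set a := sInf (Prod.fst '' K)
  set b := sSup (Prod.fst '' K)
  set lo : ℝ → ℝ := fun c => sInf {y | (c, y) ∈ K}
  set up : ℝ → ℝ := fun c => sSup {y | (c, y) ∈ K}
  have hbox : ∀ c y, (c, y) ∈ interior K → ∃ δ > 0, (c, y - δ) ∈ K ∧ (c, y + δ) ∈ K ∧
      (c - δ, y) ∈ K ∧ (c + δ, y) ∈ K := by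
    intro c y h
    obtain ⟨δ, hδ, hb⟩ := Metric.mem_nhds_iff.1 (mem_interior_iff_mem_nhds.1 h)
    refine ⟨δ / 2, by linarith, hb ?_, hb ?_, hb ?_, hb ?_⟩ <;>
      simp [Prod.dist_eq, hδ, abs_of_pos hδ]
  have hab : ∀ x ∈ K, a ≤ x.1 ∧ x.1 ≤ b := fun x hx => ((hm x.1 x.2).1 hx).1
  obtain ⟨w, hw⟩ := hi
  have wab : a < w.1 ∧ w.1 < b := by
    obtain ⟨δ, hδ, -, -, k1, k2⟩ := hbox w.1 w.2 hw
    have := hab _ k1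
    have := hab _ k2
    simp only at *
    constructor <;> linarith
  have hab' : a < b := wab.1.trans wab.2
  have hinter : ∀ c, a < c → c < b → ∃ y, (c, y) ∈ interior K := by
    intro c h2 h3
    have hend : ∀ e, e ∈ Icc a b → ∃ y, (e, y) ∈ K := by
      intro e he
      rw [← h1] at he
      obtain ⟨⟨c', y'⟩, h, rfl⟩ := he
      exact ⟨y', h⟩
    have main : ∀ e, e ∈ Icc a b → ∀ s t : ℝ, 0 < s → 0 ≤ t → s + t = 1 → s * w.1 + t * e = c →
        ∃ y, (c, y) ∈ interior K := by
      intro e he s t hs ht hst h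
      obtain ⟨y, hy⟩ := hend e he
      refine ⟨s * w.2 + t * y, ?_⟩
      have := hc.combo_interior_self_mem_interior hw hy hs ht hst
      rw [← h]
      exact this
    rcases le_total c w.1 with h | h
    · have hd : 0 < w.1 - a := by linarith
      refine main a ⟨le_rfl, hab'.le⟩ ((c - a) / (w.1 - a)) ((w.1 - c) / (w.1 - a))
        (div_pos (by linarith) hd) (div_nonneg (by linarith) hd.le) ?_ ?_ <;> field_simp <;> ring
    · have hd : 0 < b - w.1 := by linarith
      refine main b ⟨hab'.le, le_rfl⟩ ((b - c) / (b - w.1)) ((c - w.1) / (b - w.1))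
        (div_pos (by linarith) hd) (div_nonneg (by linarith) hd.le) ?_ ?_ <;> field_simp <;> ring
  refine ⟨a, b, lo, up, hab', hm, ?_, ?_, ?_⟩
  · intro c h2 h3
    obtain ⟨⟨c', y'⟩, h, rfl⟩ : c ∈ Prod.fst '' K := by rw [h1]; exact ⟨h2, h3⟩
    have := ((hm _ _).1 h).2
    exact this.1.trans this.2
  · intro c h2 h3
    obtain ⟨y, hy⟩ := hinter c h2 h3
    obtain ⟨δ, hδ, k1, k2, -, -⟩ := hbox c y hy
    have := ((hm _ _).1 k1).2.1
    have := ((hm _ _).1 k2).2.2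
    simp only [lo, up]
    linarith
  · intro c y h hy
    obtain ⟨δ, hδ, k1, k2, -, -⟩ := hbox c y hy
    have := ((hm _ _).1 k1).2.1
    have := ((hm _ _).1 k2).2.2
    simp only [lo, up] at h
    rcases h with h | h <;> linarith

/-- The slices of planar convex pseudodisks in general position form a slice system. -/
theorem exists_sliceSystem {β : Type*} (K : β → Set (ℝ × ℝ)) (hK : ∀ F, IsCompact (K F))
    (hc : ∀ F, Convex ℝ (K F)) (hi : ∀ F, (interior (K F)).Nonempty)
    (hfr : ∀ F G, F ≠ G → ∃ p q : ℝ × ℝ, frontier (K F) ∩ frontier (K G) ⊆ {p, q} ∧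
      (p.1 = q.1 → p = q)) :
    ∃ M : SliceSystem β, ∀ F c y, (c, y) ∈ K F ↔
      (M.a F ≤ c ∧ c ≤ M.b F) ∧ M.lo F c ≤ y ∧ y ≤ M.hi F c := by
  choose a b lo up hab hm hle hlt hinter using fun F => exists_slices (hK F) (hc F) (hi F)
  have hno : ∀ {F G}, F ≠ G → ∃ p q, frontier (K F) ∩ frontier (K G) ⊆ {p, q} := by
    intro F G h
    obtain ⟨p, q, h1, -⟩ := hfr F G h
    exact ⟨p, q, h1⟩
  have hfrm : ∀ F c y, (c, y) ∈ K F → (y ≤ lo F c ∨ up F c ≤ y) → (c, y) ∈ frontier (K F) := by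
    intro F c y h1 h2
    exact ⟨subset_closure h1, hinter F c y h2⟩
  have hgen : ∀ F G c, F ≠ G → a F ≤ c → c ≤ b F → a G ≤ c → c ≤ b G → lo F c = lo G c →
      up F c = up G c → lo F c = up F c := by
    intro F G c hFG h1 h2 h3 h4 h5 h6
    obtain ⟨p, q, hpq, hv⟩ := hfr F G hFG
    have m1 := hle F c h1 h2
    have k1 : (c, lo F c) ∈ frontier (K F) ∩ frontier (K G) :=
      ⟨hfrm F c _ ((hm F _ _).2 ⟨⟨h1, h2⟩, le_rfl, m1⟩) (Or.inl le_rfl),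
        hfrm G c _ ((hm G _ _).2 ⟨⟨h3, h4⟩, h5.ge, h6 ▸ m1⟩) (Or.inl h5.le)⟩
    have k2 : (c, up F c) ∈ frontier (K F) ∩ frontier (K G) :=
      ⟨hfrm F c _ ((hm F _ _).2 ⟨⟨h1, h2⟩, m1, le_rfl⟩) (Or.inr le_rfl),
        hfrm G c _ ((hm G _ _).2 ⟨⟨h3, h4⟩, h5 ▸ m1, h6.le⟩) (Or.inr h6.ge)⟩
    have k1 := hpq k1
    have k2 := hpq k2
    simp only [mem_insert_iff, mem_singleton_iff] at k1 k2
    have : (c, lo F c) = (c, up F c) := by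
      rcases k1 with k1 | k1 <;> rcases k2 with k2 | k2 <;> rw [k1, k2]
      · exact hv (by rw [← k1, ← k2])
      · exact (hv (by rw [← k1, ← k2])).symm
    exact congrArg Prod.snd this
  have hesc : ∀ F G c, a F ≤ c → c ≤ b F →
      ¬ (a G ≤ c ∧ c ≤ b G ∧ lo G c ≤ lo F c ∧ up F c ≤ up G c) →
      ∃ y, (c, y) ∈ K F ∧ (c, y) ∉ K G := by
    intro F G c h1 h2 h
    have m1 := hle F c h1 h2
    by_contra! hcon
    have k1 := (hm G _ _).1 (hcon _ ((hm F _ _).2 ⟨⟨h1, h2⟩, le_rfl, m1⟩))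
    have k2 := (hm G _ _).1 (hcon _ ((hm F _ _).2 ⟨⟨h1, h2⟩, m1, le_rfl⟩))
    exact h ⟨k1.1.1, k1.1.2, k1.2.1, k2.2.2⟩
  refine ⟨⟨a, b, lo, up, hab, hlt, hgen, ?_, ?_⟩, hm⟩
  · intro F G c₁ c₂ c₃ h12 h23 ha hb hG1 hG2 hlo hup
    by_contra hcon
    rw [not_or] at hcon
    obtain ⟨n1, n3⟩ := hcon
    have hFG : F ≠ G := by
      rintro rfl
      exact n1 ⟨ha, by linarith, le_rfl, le_rfl⟩
    have hlt2 := hlt F c₂ (by linarith) (by linarith)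
    obtain ⟨y₁, e1, f1⟩ := hesc F G c₁ ha (by linarith) n1
    obtain ⟨y₃, e3, f3⟩ := hesc F G c₃ (by linarith) hb n3
    obtain ⟨m, hm1, hm2⟩ := exists_between hlt2
    have hzF : (c₂, m) ∈ K F := (hm _ _ _).2 ⟨⟨by linarith, by linarith⟩, hm1.le, hm2.le⟩
    have hzG : (c₂, m) ∈ K G :=
      (hm _ _ _).2 ⟨⟨hG1, hG2⟩, by linarith, by linarith⟩
    have hGu : (c₂, up G c₂) ∈ K G := (hm _ _ _).2 ⟨⟨hG1, hG2⟩, by linarith, le_rfl⟩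
    have hGl : (c₂, lo G c₂) ∈ K G := (hm _ _ _).2 ⟨⟨hG1, hG2⟩, le_rfl, by linarith⟩
    have iu := hinter F c₂ (up G c₂) (Or.inr hup)
    have il := hinter F c₂ (lo G c₂) (Or.inl hlo)
    have p1 : 0 < c₂ - c₁ := by linarith
    have p3 : 0 < c₃ - c₂ := by linarith
    have pu : 0 < up G c₂ - m := by linarith
    have pl : 0 < m - lo G c₂ := by linarith
    have A1 : 0 < area ((c₃, y₃) - (c₂, m)) ((c₂, up G c₂) - (c₂, m)) := by
      simp only [area, Prod.mk_sub_mk]; nlinarith [mul_pos p3 pu]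
    have A2 : 0 < area ((c₂, up G c₂) - (c₂, m)) ((c₁, y₁) - (c₂, m)) := by
      simp only [area, Prod.mk_sub_mk]; nlinarith [mul_pos p1 pu]
    have A3 : 0 < area ((c₁, y₁) - (c₂, m)) ((c₂, lo G c₂) - (c₂, m)) := by
      simp only [area, Prod.mk_sub_mk]; nlinarith [mul_pos p1 pl]
    have A4 : 0 < area ((c₂, lo G c₂) - (c₂, m)) ((c₃, y₃) - (c₂, m)) := by
      simp only [area, Prod.mk_sub_mk]; nlinarith [mul_pos p3 pl]
    rcases hup.lt_or_eq with hlt' | heq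
    · exact not_frontier_subset_pair (hK F) (hK G) (hc F) (hc G) (hi F) (hi G) hzF hzG e3 f3 e1 f1
        hGu (fun h => by have := ((hm _ _ _).1 h).2.2; linarith) hGl il A1 A2 A3 A4 (hno hFG)
    · rcases hlo.lt_or_eq with hlt' | heq'
      · exact not_frontier_subset_pair (hK F) (hK G) (hc F) (hc G) (hi F) (hi G) hzF hzG e1 f1 e3 f3
          hGl (fun h => by have := ((hm _ _ _).1 h).2.1; linarith) hGu iu A3 A4 A1 A2 (hno hFG)
      · exact hlt2.ne (hgen F G c₂ hFG (by linarith) (by linarith) hG1 hG2 heq'.symm heq)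
  · intro F G c₁ c₂ h12 haF hbF haG hbG h1 h2 h3 h4
    have hFG : F ≠ G := by
      rintro rfl
      exact h1.false
    have l1 := hle F c₁ haF (by linarith)
    have l2 := hle F c₂ (by linarith) hbF
    have l3 := hle G c₁ haG (by linarith)
    have l4 := hle G c₂ (by linarith) hbG
    have maF : (c₁, lo F c₁) ∈ K F := (hm _ _ _).2 ⟨⟨by linarith, by linarith⟩, le_rfl, l1⟩
    have maF' : (c₂, up F c₂) ∈ K F := (hm _ _ _).2 ⟨⟨by linarith, by linarith⟩, l2, le_rfl⟩
    have maG : (c₁, lo F c₁) ∉ K G := fun h => by have := ((hm _ _ _).1 h).2.1; linarith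
    have maG' : (c₂, up F c₂) ∉ K G := fun h => by have := ((hm _ _ _).1 h).2.2; linarith
    have mbG : (c₁, up G c₁) ∈ K G := (hm _ _ _).2 ⟨⟨by linarith, by linarith⟩, l3, le_rfl⟩
    have mbG' : (c₂, lo G c₂) ∈ K G := (hm _ _ _).2 ⟨⟨by linarith, by linarith⟩, le_rfl, l4⟩
    have mbF : (c₁, up G c₁) ∉ K F := fun h => by have := ((hm _ _ _).1 h).2.2; linarith
    have mbF' : (c₂, lo G c₂) ∉ K F := fun h => by have := ((hm _ _ _).1 h).2.1; linarith
    generalize lo F c₁ = f at *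
    generalize up F c₂ = f' at *
    generalize up G c₁ = g at *
    generalize lo G c₂ = g' at *
    have hA : 0 < g - f := by linarith
    have hB : 0 < f' - g' := by linarith
    obtain ⟨t, t0, t1, ht⟩ : ∃ t : ℝ, 0 < t ∧ 0 < 1 - t ∧ (1 - t) * (g - f) = t * (f' - g') := by
      have hne : g - f + (f' - g') ≠ 0 := by linarith
      refine ⟨(g - f) / (g - f + (f' - g')), by positivity, ?_, ?_⟩
      · rw [sub_pos, div_lt_one (by linarith)]; linarith
      · field_simp; ring
    set z : ℝ × ℝ := (c₁ + t * (c₂ - c₁), f + t * (f' - f)) with hz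
    have hz' : z = (c₁ + t * (c₂ - c₁), g + t * (g' - g)) := by
      rw [hz]; congr 1; linarith
    have hzF : z ∈ K F := by
      have := hc F maF maF' t1.le t0.le (by ring)
      convert this using 1
      rw [hz]; ext <;> simp <;> ring
    have hzG : z ∈ K G := by
      have := hc G mbG mbG' t1.le t0.le (by ring)
      convert this using 1
      rw [hz']; ext <;> simp <;> ring
    have v1 : (c₂, f') - z = (1 - t) • (c₂ - c₁, f' - f) := by
      rw [hz]; ext <;> simp <;> ring
    have v2 : (c₁, f) - z = (-t) • (c₂ - c₁, f' - f) := by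
      rw [hz]; ext <;> simp
    have v3 : (c₂, g') - z = (1 - t) • (c₂ - c₁, g' - g) := by
      rw [hz']; ext <;> simp <;> ring
    have v4 : (c₁, g) - z = (-t) • (c₂ - c₁, g' - g) := by
      rw [hz']; ext <;> simp
    have hD : 0 < (c₂ - c₁) * (g - f + (f' - g')) := mul_pos (by linarith) (by linarith)
    refine not_frontier_subset_pair (hK F) (hK G) (hc F) (hc G) (hi F) (hi G) hzF hzG maF' maG' maF
      maG mbG mbF mbG' (fun h => mbF' (interior_subset h)) ?_ ?_ ?_ ?_ (hno hFG)
    · rw [v1, v4]; simp only [area, Prod.smul_mk, smul_eq_mul]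
      nlinarith [mul_pos (mul_pos t0 t1) hD]
    · rw [v4, v2]; simp only [area, Prod.smul_mk, smul_eq_mul]
      nlinarith [mul_pos (mul_pos t0 t0) hD]
    · rw [v2, v3]; simp only [area, Prod.smul_mk, smul_eq_mul]
      nlinarith [mul_pos (mul_pos t0 t1) hD]
    · rw [v3, v1]; simp only [area, Prod.smul_mk, smul_eq_mul]
      nlinarith [mul_pos (mul_pos t1 t1) hD]

end PlanarBodies

section Assembly

/-- The shear `(x, y) ↦ (x + θ y, y)` of the Euclidean plane. -/
noncomputable def shear (θ : ℝ) : Plane ≃L[ℝ] ℝ × ℝ :=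
  LinearEquiv.toContinuousLinearEquiv
    { toFun := fun p => (p 0 + θ * p 1, p 1)
      invFun := fun x => !₂[x.1 - θ * x.2, x.2]
      map_add' := fun p q => by ext <;> simp; ring
      map_smul' := fun c p => by ext <;> simp; ring
      left_inv := fun p => by ext i; fin_cases i <;> simp
      right_inv := fun x => by ext <;> simp }

theorem shear_apply (θ : ℝ) (p : Plane) : shear θ p = (p 0 + θ * p 1, p 1) := rfl

theorem ConvexPseudodisks.mono {𝒮 𝒯 : Finset (Set Plane)} (h : ConvexPseudodisks 𝒮)
    (hT : 𝒯 ⊆ 𝒮) : ConvexPseudodisks 𝒯 :=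
  ⟨fun S hS => h.1 S (hT hS), fun A hA B hB => h.2 A (hT hA) B (hT hB)⟩

theorem exists_shear {ι : Type*} [Finite ι] (p q : ι → Plane) :
    ∃ θ : ℝ, ∀ i, (shear θ (p i)).1 = (shear θ (q i)).1 → p i = q i := by
  obtain ⟨θ, hθ⟩ := (Set.finite_range fun i => -(p i 0 - q i 0) / (p i 1 - q i 1)).exists_notMem
  refine ⟨θ, fun i hi => ?_⟩
  simp only [shear_apply] at hi
  by_cases h : p i 1 = q i 1
  · ext j
    fin_cases j
    · simpa [h] using hi
    · exact h
  · refine absurd ⟨i, ?_⟩ hθ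
    have : p i 1 - q i 1 ≠ 0 := sub_ne_zero.2 h
    simp only
    field_simp
    linarith

/-- Convex pseudodisks carry a graph without `K₅` minor in which the members containing any given
point of `P` are connected. -/
theorem ConvexPseudodisks.exists_noK5 {𝒮 : Finset (Set Plane)} (h : ConvexPseudodisks 𝒮)
    (P : Finset Plane) :
    ∃ E : 𝒮 → 𝒮 → Prop, (∀ u v, E u v → E v u) ∧ NoK5 E ∧
      ∀ p ∈ P, ∀ χ : 𝒮 → Prop, (∃ F : 𝒮, p ∈ F.1 ∧ χ F) → (∃ F : 𝒮, p ∈ F.1 ∧ ¬ χ F) →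
        ∃ F G : 𝒮, p ∈ F.1 ∧ p ∈ G.1 ∧ E F G ∧ χ F ∧ ¬ χ G := by
  have hex : ∀ i : 𝒮 × 𝒮, ∃ p q : Plane, i.1 ≠ i.2 →
      frontier i.1.1 ∩ frontier i.2.1 ⊆ {p, q} := by
    intro i
    by_cases hi : i.1 = i.2
    · exact ⟨0, 0, fun h => absurd hi h⟩
    · obtain ⟨p, q, hpq⟩ := h.2 i.1.1 i.1.2 i.2.1 i.2.2 fun h => hi (Subtype.ext h)
      exact ⟨p, q, fun _ => hpq⟩
  choose p q hpq using hex
  obtain ⟨θ, hθ⟩ := exists_shear p q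
  have hfront : ∀ S, frontier (shear θ '' S) = shear θ '' frontier S := fun S =>
    ((shear θ).toHomeomorph.image_frontier S).symm
  obtain ⟨M, hM⟩ := exists_sliceSystem (fun F : 𝒮 => shear θ '' F.1)
    (fun F => (h.1 F.1 F.2).1.image (shear θ).continuous)
    (fun F => (h.1 F.1 F.2).2.1.linear_image (shear θ).toLinearEquiv.toLinearMap)
    (fun F => by
      have := ((h.1 F.1 F.2).2.2).image (shear θ)
      rwa [show shear θ '' interior F.1 = interior (shear θ '' F.1) from
        (shear θ).toHomeomorph.image_interior F.1] at this)
    (fun F G hFG => by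
      refine ⟨shear θ (p (F, G)), shear θ (q (F, G)), ?_, fun hh => congrArg _ (hθ _ hh)⟩
      rw [hfront, hfront, ← Set.image_inter (shear θ).injective]
      rintro _ ⟨x, hx, rfl⟩
      have := hpq (F, G) hFG hx
      simp only [mem_insert_iff, mem_singleton_iff] at this ⊢
      exact this.imp (congrArg _) (congrArg _))
  have hmem : ∀ (x : Plane) (F : 𝒮), x ∈ F.1 ↔
      (M.a F ≤ (shear θ x).1 ∧ (shear θ x).1 ≤ M.b F) ∧
        M.lo F (shear θ x).1 ≤ (shear θ x).2 ∧ (shear θ x).2 ≤ M.hi F (shear θ x).1 := by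
    intro x F
    rw [← hM, Prod.mk.eta, (shear θ).injective.mem_set_image]
  obtain ⟨E, hE, hK, hloc⟩ := M.exists_noK5 (P.image fun x => (shear θ x).1)
  refine ⟨E, hE, hK, fun x hx χ h1 h2 => ?_⟩
  obtain ⟨F, hF, G, hG, h3, h4, h5⟩ := hloc (shear θ x).1 (Finset.mem_image_of_mem _ hx)
    {F | x ∈ F.1} (fun F hF => ((hmem x F).1 hF).1)
    (fun F hF F' hF' G hG1 hG2 hlo hhi => (hmem x G).2 ⟨⟨hG1, hG2⟩,
      hlo.trans ((hmem x F).1 hF).2.1, ((hmem x F').1 hF').2.2.trans hhi⟩) χ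
    (by obtain ⟨F, hF⟩ := h1; exact ⟨F, hF⟩) (by obtain ⟨F, hF⟩ := h2; exact ⟨F, hF⟩)
  exact ⟨F, G, hF, hG, h3, h4, h5⟩

/-- A locally optimal cover of points by convex pseudodisks is nearly as small as any other
cover. -/
theorem ConvexPseudodisks.card_diff_le {𝒮 : Finset (Set Plane)} (h : ConvexPseudodisks 𝒮)
    {P : Finset Plane} {𝒪 𝒬 : Finset (Set Plane)} (hO : 𝒪 ⊆ 𝒮) (hQ : 𝒬 ⊆ 𝒮)
    (cO : CoversIn P 𝒪) (cQ : CoversIn P 𝒬) {b : ℕ} (hb : 2400 ^ 2 ≤ b)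
    (hloc : BLocallyOptimalCover 𝒮 𝒬 P b) :
    ((𝒬 \ 𝒪).card : ℝ) ≤ (𝒪 \ 𝒬).card +
      2400 * ((𝒬 \ 𝒪).card + (𝒪 \ 𝒬).card) / √b := by
  set 𝒯 := (𝒬 \ 𝒪) ∪ (𝒪 \ 𝒬) with h𝒯
  have hT : 𝒯 ⊆ 𝒮 := Finset.union_subset (Finset.sdiff_subset.trans hQ)
    (Finset.sdiff_subset.trans hO)
  obtain ⟨E, hE, hK, hp⟩ := (h.mono hT).exists_noK5 P
  have hcard : ∀ 𝒰 : Finset (Set Plane), 𝒰 ⊆ 𝒯 →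
      (Finset.univ.filter fun F : 𝒯 => F.1 ∈ 𝒰).card = 𝒰.card := by
    intro 𝒰 hU
    rw [← Finset.card_map (Function.Embedding.subtype _)]
    congr 1
    ext F
    simp only [Finset.mem_map, Finset.mem_filter, Finset.mem_univ, true_and,
      Function.Embedding.subtype_apply]
    exact ⟨by rintro ⟨G, hG, rfl⟩; exact hG, fun hF => ⟨⟨F, hU hF⟩, hF, rfl⟩⟩
  have main := exchange_bound hE hK b hb
    (Finset.univ.filter fun F : 𝒯 => F.1 ∈ 𝒬 \ 𝒪) (Finset.univ.filter fun F : 𝒯 => F.1 ∈ 𝒪 \ 𝒬)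
    (by
      rw [Finset.disjoint_left]
      intro F h1 h2
      simp only [Finset.mem_filter, Finset.mem_sdiff] at h1 h2
      exact h1.2.2 h2.2.1)
    (by
      intro X hX hXb X' hX' hXX'
      by_contra! hlt
      have inj : Function.Injective (Subtype.val : 𝒯 → Set Plane) := Subtype.val_injective
      refine hloc ⟨X.image Subtype.val, ?_, ?_, X'.image Subtype.val, ?_, ?_, ?_⟩
      · intro F hF
        obtain ⟨G, hG, rfl⟩ := Finset.mem_image.1 hF
        exact (Finset.mem_sdiff.1 (Finset.mem_filter.1 (hX hG)).2).1
      · rwa [Finset.card_image_of_injective _ inj]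
      · intro F hF
        obtain ⟨G, hG, rfl⟩ := Finset.mem_image.1 hF
        exact hT G.2
      · rwa [Finset.card_image_of_injective _ inj, Finset.card_image_of_injective _ inj]
      · intro x hx
        by_contra! hcon
        have hQX : ∀ F ∈ 𝒬, x ∈ F → ∃ G ∈ X, G.1 = F := by
          intro F hF hxF
          by_contra hn
          refine hcon F (Finset.mem_union_left _ (Finset.mem_sdiff.2 ⟨hF, ?_⟩)) hxF
          simpa using hn
        obtain ⟨F, hF, hxF⟩ := cQ x hx
        obtain ⟨F', hF', hxF'⟩ := cO x hx
        obtain ⟨G, hG, rfl⟩ := hQX F hF hxF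
        have hF'Q : F' ∉ 𝒬 := by
          intro hm
          obtain ⟨G', hG', rfl⟩ := hQX F' hm hxF'
          exact (Finset.mem_sdiff.1 (Finset.mem_filter.1 (hX hG')).2).2 hF'
        obtain ⟨U, V, hU, hV, hUV, hUQ, hVQ⟩ := hp x hx (fun F => F.1 ∈ 𝒬) ⟨G, hxF, hF⟩
          ⟨⟨F', Finset.mem_union_right _ (Finset.mem_sdiff.2 ⟨hF', hF'Q⟩)⟩, hxF', hF'Q⟩
        obtain ⟨U', hU', hUU⟩ := hQX U.1 hUQ hU
        rw [Subtype.val_injective hUU] at hU'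
        have hVO : V.1 ∈ 𝒪 \ 𝒬 :=
          (Finset.mem_union.1 V.2).resolve_left fun hm => hVQ (Finset.mem_sdiff.1 hm).1
        refine hcon V.1 (Finset.mem_union_right _ (Finset.mem_image_of_mem _ ?_)) hV
        exact hXX' U hU' V (Finset.mem_filter.2 ⟨Finset.mem_univ _, hVO⟩) hUV)
  rwa [hcard _ Finset.subset_union_left, hcard _ Finset.subset_union_right] at main

end Assembly

theorem local_search_ptas_set_cover_pseudodisks :
    ∃ α : ℝ, 0 < α ∧
      ∀ 𝒮 : Finset (Set Plane), ConvexPseudodisks 𝒮 →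
      ∀ P : Finset Plane, (↑P : Set Plane) ⊆ ⋃ S ∈ 𝒮, (S : Set Plane) →
      ∀ 𝒪 : Finset (Set Plane), 𝒪 ⊆ 𝒮 → CoversIn P 𝒪 →
        (∀ 𝒪' : Finset (Set Plane), 𝒪' ⊆ 𝒮 → CoversIn P 𝒪' →
          𝒪.card ≤ 𝒪'.card) →
      ∀ ε : ℝ, 0 < ε → ε < 1 →
      ∀ b : ℕ, α / ε ^ 2 ≤ (b : ℝ) →
      ∀ 𝒬 : Finset (Set Plane), 𝒬 ⊆ 𝒮 → CoversIn P 𝒬 →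
        BLocallyOptimalCover 𝒮 𝒬 P b →
        (¬ ∃ Q ∈ 𝒬, ∃ R ∈ 𝒮, R ∉ 𝒬 ∧
            (Q \ ⋃ P' ∈ 𝒬.erase Q, (P' : Set Plane)) ⊆ R) →
        (𝒬.card : ℝ) ≤ (1 + ε) * 𝒪.card := by
  refine ⟨9600 ^ 2, by norm_num, ?_⟩
  intro 𝒮 h𝒮 P _ 𝒪 hO cO _ ε hε hε1 b hb 𝒬 hQ cQ hloc _
  have hβ : 9600 / ε ≤ √b := by
    refine Real.le_sqrt_of_sq_le ?_
    rwa [div_pow]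
  have hb' : 2400 ^ 2 ≤ b := by
    have h1 : (9600 : ℝ) ^ 2 ≤ 9600 ^ 2 / ε ^ 2 :=
      le_div_self (by norm_num) (by positivity) (by nlinarith)
    have h2 : ((2400 ^ 2 : ℕ) : ℝ) ≤ b := by
      push_cast
      linarith
    exact_mod_cast h2
  have key := le_of_exchange_bound (c := ((𝒬 ∩ 𝒪).card : ℝ)) (Nat.cast_nonneg _)
    (Nat.cast_nonneg _) (Nat.cast_nonneg _) hε hε1 hβ
    (h𝒮.card_diff_le hO hQ cO cQ hb' hloc)
  have e1 : ((𝒬 ∩ 𝒪).card : ℝ) + (𝒬 \ 𝒪).card = 𝒬.card := by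
    exact_mod_cast Finset.card_inter_add_card_sdiff 𝒬 𝒪
  have e2 : ((𝒬 ∩ 𝒪).card : ℝ) + (𝒪 \ 𝒬).card = 𝒪.card := by
    rw [Finset.inter_comm]
    exact_mod_cast Finset.card_inter_add_card_sdiff 𝒪 𝒬
  rwa [e1, e2] at key
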